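/- arXiv:2011.05464 — 3 statements merged into one kernel-verified Lean document; each statement's English description precedes it below -/
import Mathlib

section
/- For every natural number n ≥ 1, the n-th symmetric product F_n(𝔈) of Erdős space, endowed with the Vietoris topology, is homeomorphic to Erdős space 𝔈. -/
open Set Topology

noncomputable section

/-- The Vietoris topology on the powerset of `X` induced by a topology `τ`,
generated by the sets `{F | F ⊆ U}` and `{F | F ∩ U ≠ ∅}` for `U` a nonempty `τ`-open set. -/
def VietorisTop {X : Type*} (τ : TopologicalSpace X) : TopologicalSpace (Set X) :=
  TopologicalSpace.generateFrom
    ({S : Set (Set X) | ∃ U : Set X, IsOpen[τ] U ∧ U.Nonempty ∧ S = {F : Set X | F ⊆ U}} ∪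
     {S : Set (Set X) | ∃ U : Set X, IsOpen[τ] U ∧ U.Nonempty ∧ S = {F : Set X | (F ∩ U).Nonempty}})

/-- The hyperspace `K(X)` of nonempty compact subsets of `X`. -/
def HypK (X : Type*) [TopologicalSpace X] : Type _ := {F : Set X // F.Nonempty ∧ IsCompact F}

/-- `K(X)` carries the Vietoris topology. -/
instance (X : Type*) [τ : TopologicalSpace X] : TopologicalSpace (HypK X) :=
  (VietorisTop τ).induced Subtype.val

/-- The `n`-th symmetric product `F_n(X)`: nonempty subsets of `X` with at most `n` points. -/
def HypFn (n : ℕ) (X : Type*) [TopologicalSpace X] : Type _ :=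
  {F : Set X // F.Nonempty ∧ F.Finite ∧ F.ncard ≤ n}

/-- `F_n(X)` carries the Vietoris topology. -/
instance (n : ℕ) (X : Type*) [τ : TopologicalSpace X] : TopologicalSpace (HypFn n X) :=
  (VietorisTop τ).induced Subtype.val

/-- The hyperspace `F(X)` of nonempty finite subsets of `X`. -/
def HypFin (X : Type*) [TopologicalSpace X] : Type _ := {F : Set X // F.Nonempty ∧ F.Finite}

/-- `F(X)` carries the Vietoris topology. -/
instance (X : Type*) [τ : TopologicalSpace X] : TopologicalSpace (HypFin X) :=
  (VietorisTop τ).induced Subtype.val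

/-- A space is almost zero-dimensional if every point has a neighborhood basis consisting of
sets each of which is an intersection of clopen sets. -/
def IsAZD (X : Type*) [TopologicalSpace X] : Prop :=
  ∀ x : X, ∀ U ∈ nhds x, ∃ V ∈ nhds x, V ⊆ U ∧
    ∃ C : Set (Set X), (∀ c ∈ C, IsClopen c) ∧ V = ⋂₀ C

/-- `X` is `𝒜`-cohesive: every point has a neighborhood containing no nonempty proper
subset of an element `A ∈ 𝒜` that is clopen in the subspace topology of `A`. -/
def CohesiveWrt (X : Type*) [TopologicalSpace X] (𝒜 : Set (Set X)) : Prop :=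
  ∀ x : X, ∃ U ∈ nhds x, ∀ A ∈ 𝒜, ∀ C : Set X,
    C ⊆ U → C ⊆ A → C.Nonempty → C ≠ A → ¬ IsClopen {y : A | (y : X) ∈ C}

/-- A space is cohesive if it is `{X}`-cohesive. -/
def Cohesive (X : Type*) [TopologicalSpace X] : Prop := CohesiveWrt X {Set.univ}

/-- Erdős space: the rational points of the Hilbert space `ℓ²`. -/
def ErdosSpace : Type :=
  {x : lp (fun _ : ℕ => ℝ) 2 // ∀ n : ℕ, ∃ q : ℚ, x.val n = (q : ℝ)}

instance : TopologicalSpace ErdosSpace := by unfold ErdosSpace; infer_instance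

/-- Complete Erdős space: points of `ℓ²` all of whose coordinates lie in `{0} ∪ {1/m : m ≥ 1}`. -/
def CompleteErdosSpace : Type :=
  {x : lp (fun _ : ℕ => ℝ) 2 // ∀ n : ℕ, x.val n = 0 ∨ ∃ m : ℕ, 0 < m ∧ x.val n = 1 / (m : ℝ)}

instance : TopologicalSpace CompleteErdosSpace := by unfold CompleteErdosSpace; infer_instance

/-- Countable metrizable spaces have bases of clopen sets. -/
lemma exists_isClopen_subset_of_countable {A : Type*} [TopologicalSpace A] [Countable A]
    [TopologicalSpace.MetrizableSpace A] {a : A} {U : Set A} (hU : U ∈ 𝓝 a) :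
    ∃ D : Set A, IsClopen D ∧ a ∈ D ∧ D ⊆ U := by
  let := TopologicalSpace.metrizableSpaceMetric A
  obtain ⟨ε, hε, hεU⟩ := Metric.mem_nhds_iff.1 hU
  have hc : (Set.range fun b : A => dist b a).Countable := Set.countable_range _
  obtain ⟨r, hr, hr0⟩ : ∃ r ∈ Set.Ioo (0 : ℝ) ε, r ∈ (Set.range fun b : A => dist b a)ᶜ :=
    (hc.dense_compl ℝ).exists_mem_open isOpen_Ioo (Set.nonempty_Ioo.2 hε) |>.imp
      fun r h => ⟨h.2, h.1⟩
  have heq : Metric.ball a r = Metric.closedBall a r := by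
    ext b
    rw [Metric.mem_ball, Metric.mem_closedBall]
    exact ⟨le_of_lt, fun h => lt_of_le_of_ne h fun h' => hr0 ⟨b, h'⟩⟩
  refine ⟨Metric.ball a r, ⟨heq ▸ Metric.isClosed_closedBall, Metric.isOpen_ball⟩,
    Metric.mem_ball_self hr.1, (Metric.ball_subset_ball hr.2.le).trans hεU⟩

/-- A continuous open surjection in whose fibres no point is isolated. -/
structure IsPerfectBundle {A B : Type*} [TopologicalSpace A] [TopologicalSpace B]
    (q : A → B) : Prop where
  continuous : Continuous q
  surjective : Function.Surjective q
  image_mem_nhds : ∀ a, ∀ U ∈ 𝓝 a, q '' U ∈ 𝓝 (q a)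
  exists_ne : ∀ a, ∀ U ∈ 𝓝 a, ∃ b ∈ U, b ≠ a ∧ q b = q a

/-- A finite approximation to a homeomorphism between two bundles over `B`: matching locally
constant colourings of both sides together with finitely many matched points. -/
structure BundleApprox {A A' B : Type*} [TopologicalSpace A] [TopologicalSpace A']
    (q : A → B) (q' : A' → B) where
  col : A → ℕ
  col' : A' → ℕ
  pairs : Set (A × A')
  continuous_col : Continuous col
  continuous_col' : Continuous col'
  finite_pairs : pairs.Finite
  forth : ∀ a, ∃ a', q' a' = q a ∧ col' a' = col a
  back : ∀ a', ∃ a, q a = q' a' ∧ col a = col' a'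
  compat : ∀ m ∈ pairs, q' m.2 = q m.1 ∧ col' m.2 = col m.1
  bij : ∀ m ∈ pairs, ∀ l ∈ pairs, m.1 = l.1 ↔ m.2 = l.2

namespace BundleApprox

variable {A A' B : Type*} [TopologicalSpace A] [TopologicalSpace A'] {q : A → B} {q' : A' → B}

instance : Preorder (BundleApprox q q') where
  le S T := S.pairs ⊆ T.pairs ∧ ∀ a b, T.col a = T.col' b → S.col a = S.col' b
  le_refl S := ⟨subset_rfl, fun _ _ h => h⟩
  le_trans S T R h h' := ⟨h.1.trans h'.1, fun a b hab => h.2 a b (h'.2 a b hab)⟩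

open Classical in
/-- The colour `2 c + 1` on `D` and `2 c` off `D`. -/
def splitCol {A : Type*} (c : A → ℕ) (D : Set A) (a : A) : ℕ := 2 * c a + if a ∈ D then 1 else 0

lemma splitCol_eq_iff {A A' : Type*} {c : A → ℕ} {c' : A' → ℕ} {D : Set A} {D' : Set A'}
    {a : A} {a' : A'} :
    splitCol c D a = splitCol c' D' a' ↔ c a = c' a' ∧ (a ∈ D ↔ a' ∈ D') := by
  unfold splitCol
  split_ifs with h h' h' <;> simp [h, h'] <;> omega

lemma continuous_splitCol {A : Type*} [TopologicalSpace A] {c : A → ℕ} (hc : Continuous c)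
    {D : Set A} (hD : IsClopen D) : Continuous (splitCol c D) := by
  classical
  have h : Continuous fun a => if a ∈ D then 1 else 0 :=
    continuous_if (by simp [hD.frontier_eq]) continuousOn_const continuousOn_const
  unfold splitCol
  exact (continuous_const.mul hc).add (by convert h)

lemma exists_partner [T1Space A'] [TopologicalSpace B] (hq' : IsPerfectBundle q')
    {c' : A' → ℕ} (hc' : Continuous c') {P : Set A'} (hP : P.Finite) {n : ℕ} {b : B}
    (h : ∃ a', q' a' = b ∧ c' a' = n) : ∃ a', q' a' = b ∧ c' a' = n ∧ a' ∉ P := by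
  obtain ⟨a', hb, hn⟩ := h
  have hU : {x | c' x = n} ∩ (P \ {a'})ᶜ ∈ 𝓝 a' := by
    refine Filter.inter_mem ((isOpen_discrete {n}).preimage hc' |>.mem_nhds hn) ?_
    exact (hP.subset Set.sdiff_subset).isClosed.isOpen_compl.mem_nhds (by simp)
  by_cases ha : a' ∈ P
  · obtain ⟨x, ⟨hx, hxP⟩, hne, hqx⟩ := hq'.exists_ne a' _ hU
    exact ⟨x, hqx.trans hb, hx, fun h => hxP ⟨h, hne⟩⟩
  · exact ⟨a', hb, hn, ha⟩

lemma splitCol_forth {A A' B : Type*} {q : A → B} {q' : A' → B} {c : A → ℕ}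
    {c' : A' → ℕ} {a : A} {a' : A'} {D : Set A} {D' : Set A'} {O : Set B} (hcc : c' a' = c a)
    (forth : ∀ a, ∃ a', q' a' = q a ∧ c' a' = c a)
    (hD' : D' ⊆ {x | c' x = c' a'}) (hD : D ⊆ {x | c x = c a})
    (h₁ : O ⊆ q' '' D') (h₂ : O ⊆ q' '' ({x | c' x = c' a'} \ D')) (x : A) :
    ∃ x', q' x' = q x ∧ splitCol c' (D' ∩ q' ⁻¹' O) x' = splitCol c (D ∩ q ⁻¹' O) x := by
  by_cases hx : c x = c a ∧ q x ∈ O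
  · by_cases hxD : x ∈ D
    · obtain ⟨x', hx', hqx⟩ := h₁ hx.2
      refine ⟨x', hqx, splitCol_eq_iff.2 ⟨by rw [hD' hx', hcc, hx.1], ?_⟩⟩
      simp [hx', hqx, hx.2, hxD]
    · obtain ⟨x', hx', hqx⟩ := h₂ hx.2
      refine ⟨x', hqx, splitCol_eq_iff.2 ⟨by rw [hx'.1, hcc, hx.1], ?_⟩⟩
      simp [hx'.2, hxD]
  · obtain ⟨x', hqx, hcx⟩ := forth x
    refine ⟨x', hqx, splitCol_eq_iff.2 ⟨hcx, ?_⟩⟩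
    constructor
    · rintro ⟨h, h'⟩
      exact (hx ⟨by rw [← hcx, hD' h, hcc], by rw [← hqx]; exact h'⟩).elim
    · rintro ⟨h, h'⟩
      exact (hx ⟨hD h, h'⟩).elim

lemma exists_piece [Countable A] [TopologicalSpace.MetrizableSpace A] [TopologicalSpace B]
    (hq : IsPerfectBundle q) {c : A → ℕ} (hc : Continuous c) {P : Set A} (hP : P.Finite)
    {a : A} {U : Set A} (hU : U ∈ 𝓝 a) :
    ∃ D : Set A, IsClopen D ∧ a ∈ D ∧ D ⊆ U ∧ D ⊆ {x | c x = c a} ∧ (∀ x ∈ D, x ∈ P → x = a) ∧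
      q '' D ∈ 𝓝 (q a) ∧ q '' ({x | c x = c a} \ D) ∈ 𝓝 (q a) := by
  have hC : {x | c x = c a} ∈ 𝓝 a := (isOpen_discrete {c a}).preimage hc |>.mem_nhds rfl
  obtain ⟨b, hbC, hba, hqb⟩ := hq.exists_ne a _ hC
  have hV : U ∩ {x | c x = c a} ∩ (insert b P \ {a})ᶜ ∈ 𝓝 a := by
    refine Filter.inter_mem (Filter.inter_mem hU hC) ?_
    exact ((hP.insert b).subset Set.sdiff_subset).isClosed.isOpen_compl.mem_nhds (by simp)
  obtain ⟨D, hD, haD, hDV⟩ := exists_isClopen_subset_of_countable hV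
  refine ⟨D, hD, haD, fun x hx => (hDV hx).1.1, fun x hx => (hDV hx).1.2, fun x hx hxP => ?_,
    hq.image_mem_nhds a D (hD.isOpen.mem_nhds haD), ?_⟩
  · by_contra hne
    exact (hDV hx).2 ⟨Or.inr hxP, hne⟩
  · rw [← hqb]
    refine hq.image_mem_nhds b _ (Filter.inter_mem
      ((isOpen_discrete {c a}).preimage hc |>.mem_nhds hbC) (hD.isClosed.isOpen_compl.mem_nhds ?_))
    exact fun hbD => (hDV hbD).2 ⟨Or.inl rfl, hba⟩

variable [Countable A] [TopologicalSpace.MetrizableSpace A] [Countable A']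
  [TopologicalSpace.MetrizableSpace A'] [TopologicalSpace B] [Countable B]
  [TopologicalSpace.MetrizableSpace B]

lemma exists_extend (hq : IsPerfectBundle q) (hq' : IsPerfectBundle q') (S : BundleApprox q q')
    {a : A} {a' : A'} (hqa : q' a' = q a) (hca : S.col' a' = S.col a)
    (hbij : ∀ m ∈ S.pairs, m.1 = a ↔ m.2 = a') {U : Set A} {U' : Set A'} (hU : U ∈ 𝓝 a)
    (hU' : U' ∈ 𝓝 a') :
    ∃ T, S ≤ T ∧ (a, a') ∈ T.pairs ∧ (∀ b, T.col b = T.col a → b ∈ U) ∧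
      ∀ b, T.col' b = T.col' a' → b ∈ U' := by
  obtain ⟨D, hD, haD, hDU, hDc, hDP, hn₁, hn₂⟩ :=
    exists_piece hq S.continuous_col (S.finite_pairs.image Prod.fst) hU
  obtain ⟨D', hD', haD', hDU', hDc', hDP', hn₁', hn₂'⟩ :=
    exists_piece hq' S.continuous_col' (S.finite_pairs.image Prod.snd) hU'
  rw [hqa] at hn₁' hn₂'
  obtain ⟨O, hO, haO, hOs⟩ := exists_isClopen_subset_of_countable
    (Filter.inter_mem (Filter.inter_mem hn₁ hn₂) (Filter.inter_mem hn₁' hn₂'))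
  have hmem : ∀ m ∈ S.pairs, m.1 ∈ D ∩ q ⁻¹' O ↔ m.2 ∈ D' ∩ q' ⁻¹' O := by
    intro m hm
    constructor
    · intro h
      rw [(hbij m hm).1 (hDP _ h.1 ⟨m, hm, rfl⟩)]
      exact ⟨haD', by simpa [hqa] using haO⟩
    · intro h
      rw [(hbij m hm).2 (hDP' _ h.1 ⟨m, hm, rfl⟩)]
      exact ⟨haD, haO⟩
  refine ⟨{ col := splitCol S.col (D ∩ q ⁻¹' O)
            col' := splitCol S.col' (D' ∩ q' ⁻¹' O)
            pairs := insert (a, a') S.pairs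
            continuous_col := continuous_splitCol S.continuous_col
              (hD.inter (hO.preimage hq.continuous))
            continuous_col' := continuous_splitCol S.continuous_col'
              (hD'.inter (hO.preimage hq'.continuous))
            finite_pairs := S.finite_pairs.insert _
            forth := splitCol_forth hca S.forth hDc' hDc (fun x hx => (hOs hx).2.1)
              (fun x hx => (hOs hx).2.2)
            back := splitCol_forth hca.symm S.back hDc hDc' (fun x hx => (hOs hx).1.1)
              (fun x hx => (hOs hx).1.2)
            compat := ?_
            bij := ?_ }, ⟨Set.subset_insert _ _, ?_⟩, Set.mem_insert _ _, ?_, ?_⟩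
  · rintro m (rfl | hm)
    · refine ⟨hqa, splitCol_eq_iff.2 ⟨hca, ?_⟩⟩
      simp [haD, haD', hqa, haO]
    · exact ⟨(S.compat m hm).1, splitCol_eq_iff.2 ⟨(S.compat m hm).2, (hmem m hm).symm⟩⟩
  · rintro m (rfl | hm) l (rfl | hl)
    · simp
    · simpa [eq_comm] using hbij l hl
    · exact hbij m hm
    · exact S.bij m hm l hl
  · exact fun x y h => (splitCol_eq_iff.1 h).1
  · exact fun b hb => hDU ((splitCol_eq_iff.1 hb).2.2 ⟨haD, haO⟩).1
  · exact fun b hb => hDU' ((splitCol_eq_iff.1 hb).2.2 ⟨haD', by simpa [hqa] using haO⟩).1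

lemma exists_le_of_left (hq : IsPerfectBundle q) (hq' : IsPerfectBundle q')
    (S : BundleApprox q q') (a : A) {U : Set A} (hU : U ∈ 𝓝 a) :
    ∃ T, S ≤ T ∧ (∃ a', (a, a') ∈ T.pairs) ∧ ∀ b, T.col b = T.col a → b ∈ U := by
  by_cases ha : ∃ a', (a, a') ∈ S.pairs
  · obtain ⟨a', h⟩ := ha
    obtain ⟨T, h₁, h₂, h₃, -⟩ := S.exists_extend hq hq' (S.compat _ h).1 (S.compat _ h).2
      (fun m hm => S.bij m hm _ h) hU Filter.univ_mem
    exact ⟨T, h₁, ⟨a', h₂⟩, h₃⟩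
  · obtain ⟨a', hqa, hca, hP⟩ := exists_partner hq' S.continuous_col'
      (S.finite_pairs.image Prod.snd) (S.forth a)
    obtain ⟨T, h₁, h₂, h₃, -⟩ := S.exists_extend hq hq' hqa hca
      (fun m hm => ⟨fun h => (ha ⟨m.2, h ▸ hm⟩).elim, fun h => (hP ⟨m, hm, h⟩).elim⟩)
      hU Filter.univ_mem
    exact ⟨T, h₁, ⟨a', h₂⟩, h₃⟩

lemma exists_le_of_right (hq : IsPerfectBundle q) (hq' : IsPerfectBundle q')
    (S : BundleApprox q q') (a' : A') {U : Set A'} (hU : U ∈ 𝓝 a') :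
    ∃ T, S ≤ T ∧ (∃ a, (a, a') ∈ T.pairs) ∧ ∀ b, T.col' b = T.col' a' → b ∈ U := by
  by_cases ha : ∃ a, (a, a') ∈ S.pairs
  · obtain ⟨a, h⟩ := ha
    obtain ⟨T, h₁, h₂, -, h₃⟩ := S.exists_extend hq hq' (S.compat _ h).1 (S.compat _ h).2
      (fun m hm => S.bij m hm _ h) Filter.univ_mem hU
    exact ⟨T, h₁, ⟨a, h₂⟩, h₃⟩
  · obtain ⟨a, hqa, hca, hP⟩ := exists_partner hq S.continuous_col
      (S.finite_pairs.image Prod.fst) (S.back a')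
    obtain ⟨T, h₁, h₂, -, h₃⟩ := S.exists_extend hq hq' hqa.symm hca.symm
      (fun m hm => ⟨fun h => (hP ⟨m, hm, h⟩).elim, fun h => (ha ⟨m.1, h ▸ hm⟩).elim⟩)
      Filter.univ_mem hU
    exact ⟨T, h₁, ⟨a, h₂⟩, h₃⟩

end BundleApprox

/-- Two bundles over the same base, with countable metrizable total spaces and base, are
homeomorphic over the base. -/
theorem IsPerfectBundle.exists_homeomorph {A A' B : Type*} [TopologicalSpace A]
    [TopologicalSpace A'] [TopologicalSpace B] [Countable A] [Countable A'] [Countable B]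
    [TopologicalSpace.MetrizableSpace A] [TopologicalSpace.MetrizableSpace A']
    [TopologicalSpace.MetrizableSpace B] {q : A → B} {q' : A' → B} (hq : IsPerfectBundle q)
    (hq' : IsPerfectBundle q') : ∃ g : A ≃ₜ A', ∀ a, q' (g a) = q a := by
  classical
  let S₀ : BundleApprox q q' :=
    { col := fun _ => 0, col' := fun _ => 0, pairs := ∅
      continuous_col := continuous_const, continuous_col' := continuous_const
      finite_pairs := Set.finite_empty
      forth := fun a => (hq'.surjective (q a)).imp fun _ h => ⟨h, rfl⟩
      back := fun a => (hq.surjective (q' a)).imp fun _ h => ⟨h, rfl⟩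
      compat := by simp, bij := by simp }
  obtain ⟨b, hbc, -, hb⟩ := TopologicalSpace.exists_countable_basis A
  obtain ⟨b', hbc', -, hb'⟩ := TopologicalSpace.exists_countable_basis A'
  have := hbc.to_subtype
  have := hbc'.to_subtype
  let task : A × b ⊕ A' × b' → Order.Cofinal (BundleApprox q q') := fun t => t.elim
    (fun t => ⟨{T | t.1 ∈ t.2.1 → (∃ a', (t.1, a') ∈ T.pairs) ∧
      ∀ x, T.col x = T.col t.1 → x ∈ t.2.1}, fun S => by
        by_cases h : t.1 ∈ t.2.1
        · obtain ⟨T, hT, h'⟩ := S.exists_le_of_left hq hq' t.1 ((hb.isOpen t.2.2).mem_nhds h)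
          exact ⟨T, fun _ => h', hT⟩
        · exact ⟨S, fun h' => (h h').elim, le_rfl⟩⟩)
    (fun t => ⟨{T | t.1 ∈ t.2.1 → (∃ a, (a, t.1) ∈ T.pairs) ∧
      ∀ x, T.col' x = T.col' t.1 → x ∈ t.2.1}, fun S => by
        by_cases h : t.1 ∈ t.2.1
        · obtain ⟨T, hT, h'⟩ := S.exists_le_of_right hq hq' t.1 ((hb'.isOpen t.2.2).mem_nhds h)
          exact ⟨T, fun _ => h', hT⟩
        · exact ⟨S, fun h' => (h h').elim, le_rfl⟩⟩)
  let : Encodable (A × b ⊕ A' × b') := Encodable.ofCountable _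
  let σ := Order.sequenceOfCofinals S₀ task
  have hσ : Monotone σ := Order.sequenceOfCofinals.monotone S₀ task
  have htask : ∀ t, ∃ i, σ i ∈ task t := fun t =>
    ⟨_, Order.sequenceOfCofinals.encode_mem S₀ task t⟩
  have hleft : ∀ a, ∀ U ∈ 𝓝 a, ∃ i, (∃ a', (a, a') ∈ (σ i).pairs) ∧
      ∀ x, (σ i).col x = (σ i).col a → x ∈ U := by
    intro a U hU
    obtain ⟨V, hV, haV, hVU⟩ := hb.mem_nhds_iff.1 hU
    obtain ⟨i, hi⟩ := htask (Sum.inl (a, ⟨V, hV⟩))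
    exact ⟨i, (hi haV).1, fun x hx => hVU ((hi haV).2 x hx)⟩
  have hright : ∀ a, ∀ U ∈ 𝓝 a, ∃ i, (∃ a', (a', a) ∈ (σ i).pairs) ∧
      ∀ x, (σ i).col' x = (σ i).col' a → x ∈ U := by
    intro a U hU
    obtain ⟨V, hV, haV, hVU⟩ := hb'.mem_nhds_iff.1 hU
    obtain ⟨i, hi⟩ := htask (Sum.inr (a, ⟨V, hV⟩))
    exact ⟨i, (hi haV).1, fun x hx => hVU ((hi haV).2 x hx)⟩
  choose i g hg using fun a => (hleft a _ Filter.univ_mem).imp fun i h => h.1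
  choose i' g' hg' using fun a => (hright a _ Filter.univ_mem).imp fun i h => h.1
  have hcol : ∀ {a a' k} l, (a, a') ∈ (σ k).pairs → (σ l).col a = (σ l).col' a' := by
    intro a a' k l h
    have h' := (hσ (le_max_left k l)).1 h
    exact (hσ (le_max_right k l)).2 _ _ ((σ (max k l)).compat _ h').2.symm
  have hbij : ∀ {a a' x x' k l}, (a, a') ∈ (σ k).pairs → (x, x') ∈ (σ l).pairs →
      (a = x ↔ a' = x') := fun {a a' x x' k l} h h' =>
    (σ (max k l)).bij _ ((hσ (le_max_left k l)).1 h) _ ((hσ (le_max_right k l)).1 h')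
  refine ⟨{ toFun := g
            invFun := g'
            left_inv := fun a => (hbij (hg' (g a)) (hg a)).2 rfl
            right_inv := fun a => (hbij (hg (g' a)) (hg' a)).1 rfl
            continuous_toFun := continuous_iff_continuousAt.2 fun a U hU => ?_
            continuous_invFun := continuous_iff_continuousAt.2 fun a U hU => ?_ },
    fun a => ((σ (i a)).compat _ (hg a)).1⟩
  · obtain ⟨k, -, hk⟩ := hright _ U hU
    have : {x | (σ k).col x = (σ k).col a} ∈ 𝓝 a :=
      (isOpen_discrete {(σ k).col a}).preimage (σ k).continuous_col |>.mem_nhds rfl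
    refine Filter.mem_map.2 (Filter.mem_of_superset this fun x hx => ?_)
    exact hk _ (by rw [← hcol k (hg x), ← hcol k (hg a), hx])
  · obtain ⟨k, -, hk⟩ := hleft _ U hU
    have : {x | (σ k).col' x = (σ k).col' a} ∈ 𝓝 a :=
      (isOpen_discrete {(σ k).col' a}).preimage (σ k).continuous_col' |>.mem_nhds rfl
    refine Filter.mem_map.2 (Filter.mem_of_superset this fun x hx => ?_)
    exact hk _ (by rw [hcol k (hg' x), hcol k (hg' a), hx])

/-- A tower of countable metrizable spaces with weights, in which every bonding map together with
the weight is a perfect bundle. -/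
structure Tower where
  A : ℕ → Type
  [top : ∀ k, TopologicalSpace (A k)]
  [countable : ∀ k, Countable (A k)]
  [metrizable : ∀ k, TopologicalSpace.MetrizableSpace (A k)]
  p : ∀ k, A (k + 1) → A k
  s : ∀ k, A k → ℕ
  bundle_zero : IsPerfectBundle (s 0)
  bundle_succ : ∀ k, IsPerfectBundle fun a : A (k + 1) => (p k a, s (k + 1) a)

namespace Tower

attribute [instance] Tower.top Tower.countable Tower.metrizable

/-- The total weight of a sequence. -/
def weight (t : Tower) (a : ∀ k, t.A k) : ℝ := ∑' k, (2⁻¹ : ℝ) ^ k * t.s k (a k)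

/-- Threads of the tower of finite total weight. -/
def IsThread (t : Tower) (a : ∀ k, t.A k) : Prop :=
  (∀ k, t.p k (a (k + 1)) = a k) ∧ Summable fun k => (2⁻¹ : ℝ) ^ k * t.s k (a k)

/-- A space is a realization of a tower if it is the space of threads of finite weight with the
weakest topology making the projections and the weight continuous. -/
structure Realizes (t : Tower) (E : Type*) [TopologicalSpace E] (f : E → ∀ k, t.A k) :
    Prop where
  isThread : ∀ x, t.IsThread (f x)
  injective : Function.Injective f
  exists_eq : ∀ a, t.IsThread a → ∃ x, f x = a
  isInducing : IsInducing fun x => (f x, t.weight (f x))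

lemma exists_levelwise (t t' : Tower) : ∃ g : ∀ k, t.A k ≃ₜ t'.A k,
    (∀ k a, t'.s k (g k a) = t.s k a) ∧ ∀ k a, t'.p k (g (k + 1) a) = g k (t.p k a) := by
  obtain ⟨g₀, hg₀⟩ := t.bundle_zero.exists_homeomorph t'.bundle_zero
  have step : ∀ k (g : t.A k ≃ₜ t'.A k), ∃ g' : t.A (k + 1) ≃ₜ t'.A (k + 1),
      (∀ a, t'.s (k + 1) (g' a) = t.s (k + 1) a) ∧ ∀ a, t'.p k (g' a) = g (t.p k a) := by
    intro k g
    let G : t.A k × ℕ ≃ₜ t'.A k × ℕ := g.prodCongr (Homeomorph.refl ℕ)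
    have h := t.bundle_succ k
    have hG : IsPerfectBundle fun a : t.A (k + 1) => G (t.p k a, t.s (k + 1) a) :=
      { continuous := G.continuous.comp h.continuous
        surjective := G.surjective.comp h.surjective
        image_mem_nhds := fun a U hU => by
          have := G.isOpenMap.image_mem_nhds (h.image_mem_nhds a U hU)
          rwa [Set.image_image] at this
        exists_ne := fun a U hU => by
          obtain ⟨b, hb, hne, hq⟩ := h.exists_ne a U hU
          exact ⟨b, hb, hne, congrArg G hq⟩ }
    obtain ⟨g', hg'⟩ := hG.exists_homeomorph (t'.bundle_succ k)
    exact ⟨g', fun a => congrArg Prod.snd (hg' a), fun a => congrArg Prod.fst (hg' a)⟩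
  choose next hs hp using step
  let g : ∀ k, t.A k ≃ₜ t'.A k := fun k => Nat.rec g₀ next k
  refine ⟨g, fun k a => ?_, fun k a => hp k (g k) a⟩
  cases k with
  | zero => exact hg₀ a
  | succ k => exact hs k (g k) a

lemma Realizes.exists_continuous {t t' : Tower} {E E' : Type*} [TopologicalSpace E]
    [TopologicalSpace E'] {f : E → ∀ k, t.A k} {f' : E' → ∀ k, t'.A k} (hf : t.Realizes E f)
    (hf' : t'.Realizes E' f') (g : ∀ k, t.A k ≃ₜ t'.A k)
    (hs : ∀ k a, t'.s k (g k a) = t.s k a)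
    (hp : ∀ k a, t'.p k (g (k + 1) a) = g k (t.p k a)) :
    ∃ h : E → E', Continuous h ∧ ∀ x k, f' (h x) k = g k (f x k) := by
  have key : ∀ x, ∃ y, f' y = fun k => g k (f x k) := fun x => hf'.exists_eq _
    ⟨fun k => by rw [hp, (hf.isThread x).1], by simpa only [hs] using (hf.isThread x).2⟩
  choose h hh using key
  refine ⟨h, ?_, fun x k => congrFun (hh x) k⟩
  have hc := hf.isInducing.continuous
  rw [hf'.isInducing.continuous_iff]
  have hfun : ((fun y => (f' y, t'.weight (f' y))) ∘ h) =
      fun x => ((fun k => g k (f x k)), t.weight (f x)) := by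
    funext x
    simp only [Function.comp_apply, hh, weight, hs]
  rw [hfun]
  exact (continuous_pi fun k => (g k).continuous.comp
    ((continuous_apply k).comp hc.fst)).prodMk hc.snd

/-- Realizations of any two towers are homeomorphic. -/
theorem Realizes.homeomorph {t t' : Tower} {E E' : Type*} [TopologicalSpace E]
    [TopologicalSpace E'] {f : E → ∀ k, t.A k} {f' : E' → ∀ k, t'.A k} (hf : t.Realizes E f)
    (hf' : t'.Realizes E' f') : Nonempty (E ≃ₜ E') := by
  obtain ⟨g, hs, hp⟩ := t.exists_levelwise t'
  obtain ⟨h, hc, hh⟩ := hf.exists_continuous hf' g hs hp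
  obtain ⟨h', hc', hh'⟩ := hf'.exists_continuous hf (fun k => (g k).symm)
    (fun k a => by rw [← hs, Homeomorph.apply_symm_apply])
    (fun k a => by rw [← (g k).symm_apply_apply (t.p k _), ← hp, Homeomorph.apply_symm_apply])
  exact ⟨{  toFun := h
            invFun := h'
            left_inv := fun x => hf.injective <| funext fun k => by rw [hh', hh]; simp
            right_inv := fun x => hf'.injective <| funext fun k => by rw [hh, hh']; simp
            continuous_toFun := hc
            continuous_invFun := hc' }⟩

end Tower

/-- The norm topology of `ℓ²` is generated by the coordinates and the squared norm. -/
lemma isInducing_coord_norm_sq :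
    IsInducing fun x : lp (fun _ : ℕ => ℝ) 2 => ((fun n => x n), ‖x‖ ^ 2) := by
  classical
  have hcoord : ∀ n, Continuous fun x : lp (fun _ : ℕ => ℝ) 2 => x n := fun n =>
    (lp.evalCLM ℝ (fun _ : ℕ => ℝ) 2 n).continuous
  refine isInducing_iff_nhds.2 fun y => le_antisymm ?_ ?_
  · exact ((continuous_pi hcoord).prodMk (by fun_prop)).continuousAt.le_comap
  refine Metric.nhds_basis_ball.ge_iff.2 fun ε hε => ?_
  obtain ⟨F, hF⟩ : ∃ F : Finset ℕ, ‖y - ∑ i ∈ F, lp.single 2 i (y i)‖ < ε / 2 := by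
    have h := lp.hasSum_single (p := 2) (by simp) y
    obtain ⟨F, hF⟩ := (Metric.tendsto_nhds.1 h (ε / 2) (half_pos hε)).exists
    exact ⟨F, by rwa [dist_comm, dist_eq_norm] at hF⟩
  set y' := ∑ i ∈ F, lp.single 2 i (y i) with hy'
  let h : (ℕ → ℝ) × ℝ → ℝ := fun z => z.2 - 2 * ∑ i ∈ F, z.1 i * y i + ‖y'‖ ^ 2
  have hh : Continuous h := by fun_prop
  have hval : ∀ x : lp (fun _ : ℕ => ℝ) 2, h ((fun n => x n), ‖x‖ ^ 2) = ‖x - y'‖ ^ 2 := by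
    intro x
    have hin : inner ℝ x y' = ∑ i ∈ F, x i * y i := by
      rw [hy', inner_sum]
      refine Finset.sum_congr rfl fun i _ => ?_
      rw [lp.inner_single_right]
      simp [mul_comm]
    rw [norm_sub_sq_real, hin]
  have hmem : h ⁻¹' Iio ((ε / 2) ^ 2) ∈ 𝓝 ((fun n => y n), ‖y‖ ^ 2) := by
    refine hh.continuousAt.preimage_mem_nhds (Iio_mem_nhds ?_)
    rw [hval]
    gcongr
  refine Filter.mem_of_superset (Filter.preimage_mem_comap hmem) fun x hx => ?_
  have hx' : ‖x - y'‖ < ε / 2 := by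
    rw [mem_preimage, mem_preimage, hval, mem_Iio] at hx
    exact lt_of_pow_lt_pow_left₀ 2 (by positivity) hx
  rw [Metric.mem_ball, dist_eq_norm]
  calc ‖x - y‖ ≤ ‖x - y'‖ + ‖y' - y‖ := norm_sub_le_norm_sub_add_norm_sub ..
    _ < ε / 2 + ε / 2 := add_lt_add hx' (by rwa [norm_sub_rev])
    _ = ε := add_halves ε

/-- The integer part of a rescaled square; it is locally constant on the rationals because the
scale is irrational. -/
def sqLevel (k : ℕ) (q : ℚ) : ℕ := ⌊(q : ℝ) ^ 2 * 2 ^ k / √2⌋₊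

lemma sq_mul_div_sqrt_two_ne (k m : ℕ) (hm : m ≠ 0) (q : ℚ) : (q : ℝ) ^ 2 * 2 ^ k / √2 ≠ m := by
  intro h
  have h2 : (√2 : ℝ) ≠ 0 := by positivity
  have hm' : (m : ℝ) ≠ 0 := by exact_mod_cast hm
  refine irrational_sqrt_two ⟨q ^ 2 * 2 ^ k / m, ?_⟩
  push_cast
  rw [div_eq_iff h2] at h
  rw [h]
  field_simp

lemma continuous_sqLevel (k : ℕ) : Continuous (sqLevel k) := by
  refine continuous_iff_continuousAt.2 fun q => ?_
  have hc : Continuous fun x : ℚ => (x : ℝ) ^ 2 * 2 ^ k / √2 := by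
    have := Rat.continuous_coe_real
    fun_prop
  have h1 : ∀ᶠ x : ℚ in 𝓝 q, (x : ℝ) ^ 2 * 2 ^ k / √2 < sqLevel k q + 1 :=
    hc.continuousAt.eventually_lt_const (Nat.lt_floor_add_one _)
  have h2 : ∀ᶠ x : ℚ in 𝓝 q, sqLevel k q ≤ (x : ℝ) ^ 2 * 2 ^ k / √2 := by
    rcases eq_or_ne (sqLevel k q) 0 with h | h
    · exact Filter.Eventually.of_forall fun x => by rw [h, Nat.cast_zero]; positivity
    · exact (hc.continuousAt.eventually_const_lt (lt_of_le_of_ne (Nat.floor_le (by positivity))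
        (sq_mul_div_sqrt_two_ne k _ h q).symm)).mono fun x hx => hx.le
  refine Filter.Tendsto.congr' ?_ tendsto_const_nhds
  filter_upwards [h1, h2] with x hx1 hx2
  exact ((Nat.floor_eq_iff (by positivity)).2 ⟨hx2, hx1⟩).symm

lemma exists_sqLevel_eq (k m : ℕ) : ∃ q, sqLevel k q = m := by
  have h2 : (0 : ℝ) < √2 := by positivity
  have hlt : √(m * √2 / 2 ^ k) < √((m + 1) * √2 / 2 ^ k) := by
    apply Real.sqrt_lt_sqrt (by positivity)
    gcongr
    linarith
  obtain ⟨q, hq1, hq2⟩ := exists_rat_btwn hlt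
  refine ⟨q, (Nat.floor_eq_iff (by positivity)).2 ?_⟩
  have hq : (0 : ℝ) ≤ q := (Real.sqrt_nonneg _).trans hq1.le
  rw [Real.sqrt_lt' ((Real.sqrt_nonneg _).trans_lt hq1), div_lt_iff₀ (by positivity)] at hq1
  rw [Real.lt_sqrt hq, lt_div_iff₀ (by positivity)] at hq2
  exact ⟨(le_div_iff₀ h2).2 hq1.le, (div_lt_iff₀ h2).2 hq2⟩

lemma sqLevel_le (k : ℕ) (q : ℚ) : √2 * ((2⁻¹ : ℝ) ^ k * sqLevel k q) ≤ (q : ℝ) ^ 2 := by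
  have h2 : (0 : ℝ) < √2 := by positivity
  have h : (sqLevel k q : ℝ) ≤ (q : ℝ) ^ 2 * 2 ^ k / √2 := Nat.floor_le (by positivity)
  rw [le_div_iff₀ h2] at h
  calc √2 * ((2⁻¹ : ℝ) ^ k * sqLevel k q) = (2⁻¹ : ℝ) ^ k * (sqLevel k q * √2) := by ring
    _ ≤ (2⁻¹ : ℝ) ^ k * ((q : ℝ) ^ 2 * 2 ^ k) := by gcongr
    _ = (q : ℝ) ^ 2 := by rw [inv_pow]; field_simp

lemma sq_le_sqLevel (k : ℕ) (q : ℚ) :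
    (q : ℝ) ^ 2 ≤ √2 * ((2⁻¹ : ℝ) ^ k * sqLevel k q) + √2 * (2⁻¹ : ℝ) ^ k := by
  have h2 : (0 : ℝ) < √2 := by positivity
  have h : (q : ℝ) ^ 2 * 2 ^ k / √2 < sqLevel k q + 1 := Nat.lt_floor_add_one _
  rw [div_lt_iff₀ h2] at h
  calc (q : ℝ) ^ 2 = (2⁻¹ : ℝ) ^ k * ((q : ℝ) ^ 2 * 2 ^ k) := by rw [inv_pow]; field_simp
    _ ≤ (2⁻¹ : ℝ) ^ k * ((sqLevel k q + 1) * √2) := by gcongr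
    _ = _ := by ring

lemma exists_update_last {k : ℕ} (a : Fin (k + 1) → ℚ) {U : Set (Fin (k + 1) → ℚ)}
    (hU : U ∈ 𝓝 a) : ∃ x ≠ a (Fin.last k), Function.update a (Fin.last k) x ∈ U ∧
      sqLevel k x = sqLevel k (a (Fin.last k)) := by
  have h1 : ∀ᶠ x in 𝓝 (a (Fin.last k)), Function.update a (Fin.last k) x ∈ U := by
    have : Continuous fun x => Function.update a (Fin.last k) x := by fun_prop
    refine this.continuousAt.preimage_mem_nhds ?_
    rwa [Function.update_eq_self]
  have h2 : ∀ᶠ x in 𝓝 (a (Fin.last k)), sqLevel k x = sqLevel k (a (Fin.last k)) :=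
    (continuous_sqLevel k).continuousAt.eventually (p := (· = _)) (mem_nhds_discrete.2 rfl)
  have := ((h1.and h2).filter_mono nhdsWithin_le_nhds).and
    (self_mem_nhdsWithin (a := a (Fin.last k)) (s := {a (Fin.last k)}ᶜ))
  obtain ⟨x, ⟨hx1, hx2⟩, hx3⟩ := this.exists
  exact ⟨x, hx3, hx1, hx2⟩

/-- The tower of finite-dimensional rational vectors underlying Erdős space. -/
def erdosTower : Tower where
  A k := Fin (k + 1) → ℚ
  p _ a := fun i => a i.castSucc
  s k a := sqLevel k (a (Fin.last k))
  bundle_zero :=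
    { continuous := (continuous_sqLevel 0).comp (continuous_apply _)
      surjective := fun m => (exists_sqLevel_eq 0 m).imp' (fun q _ => q) fun _ h => h
      image_mem_nhds := fun a U hU => mem_nhds_discrete.2 ⟨a, mem_of_mem_nhds hU, rfl⟩
      exists_ne := fun a U hU => by
        obtain ⟨x, hx, hxU, hs⟩ := exists_update_last a hU
        refine ⟨_, hxU, fun h => hx ?_, by simpa using hs⟩
        simpa using congrFun h (Fin.last 0) }
  bundle_succ k :=
    { continuous := (continuous_pi fun i => continuous_apply _).prodMk
        ((continuous_sqLevel _).comp (continuous_apply _))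
      surjective := fun ⟨b, m⟩ => by
        obtain ⟨q, hq⟩ := exists_sqLevel_eq (k + 1) m
        exact ⟨Fin.snoc (α := fun _ => ℚ) b q, by simp [hq]⟩
      image_mem_nhds := fun a U hU => by
        have hc : Continuous fun b : Fin (k + 1) → ℚ =>
            (Fin.snoc (α := fun _ => ℚ) b (a (Fin.last _)) : Fin (k + 2) → ℚ) :=
          Continuous.finSnoc (A := fun _ => ℚ) continuous_id continuous_const
        rw [nhds_prod_eq, nhds_discrete ℕ]
        have hV : (fun b : Fin (k + 1) → ℚ =>
            (Fin.snoc (α := fun _ => ℚ) b (a (Fin.last _)) : Fin (k + 2) → ℚ)) ⁻¹' U ∈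
              𝓝 (fun i : Fin (k + 1) => a i.castSucc) := by
          refine hc.continuousAt.preimage_mem_nhds ?_
          convert! hU
          exact Fin.snoc_init_self a
        filter_upwards [Filter.prod_mem_prod hV (Filter.mem_pure.2 (mem_singleton _))]
        rintro ⟨b, m⟩ ⟨hb, rfl⟩
        exact ⟨_, hb, by simp⟩
      exists_ne := fun a U hU => by
        obtain ⟨x, hx, hxU, hs⟩ := exists_update_last a hU
        refine ⟨_, hxU, fun h => hx ?_, ?_⟩
        · simpa using congrFun h (Fin.last _)
        · ext i
          · simp
          · simpa using hs }

namespace ErdosSpace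

/-- The rational coordinates of a point of Erdős space. -/
def coord (x : ErdosSpace) (n : ℕ) : ℚ := (x.2 n).choose

lemma coe_coord (x : ErdosSpace) (n : ℕ) : (x.coord n : ℝ) = x.1 n := (x.2 n).choose_spec.symm

lemma hasSum_coord_sq (x : ErdosSpace) : HasSum (fun n => (x.coord n : ℝ) ^ 2) (‖x.1‖ ^ 2) := by
  have h := lp.hasSum_norm (p := 2) (by simp) x.1
  simpa [coe_coord] using h

lemma isInducing_coord : IsInducing fun x : ErdosSpace => (x.coord, ‖x.1‖ ^ 2) := by
  have h1 : IsInducing fun x : ErdosSpace => ((fun n => x.1 n), ‖x.1‖ ^ 2) :=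
    isInducing_coord_norm_sq.comp IsInducing.subtypeVal
  have h2 : IsInducing (Prod.map (fun (q : ℕ → ℚ) n => (q n : ℝ)) (id : ℝ → ℝ)) :=
    (IsInducing.piMap fun _ : ℕ => Rat.isUniformEmbedding_coe_real.isEmbedding.isInducing).prodMap
      IsInducing.id
  refine h2.of_comp_iff.1 ?_
  convert! h1 using 1
  funext x
  simp [coe_coord]

/-- The defect between the squared norm and the weight is continuous in the coordinates. -/
lemma continuous_defect : Continuous fun q : ℕ → ℚ =>
    ∑' k, ((q k : ℝ) ^ 2 - √2 * ((2⁻¹ : ℝ) ^ k * sqLevel k (q k))) := by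
  refine continuous_tsum (u := fun k => √2 * (2⁻¹ : ℝ) ^ k) (fun k => ?_)
    ((summable_geometric_of_lt_one (by norm_num) (by norm_num)).mul_left _) fun k q => ?_
  · have h1 : Continuous fun q : ℕ → ℚ => (q k : ℝ) :=
      Rat.continuous_coe_real.comp (continuous_apply k)
    have h2 : Continuous fun q : ℕ → ℚ => (sqLevel k (q k) : ℝ) :=
      continuous_of_discreteTopology.comp ((continuous_sqLevel k).comp (continuous_apply k))
    fun_prop
  · have h1 := sqLevel_le k (q k)
    have h2 := sq_le_sqLevel k (q k)
    rw [Real.norm_eq_abs, abs_le]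
    constructor
    · have : 0 ≤ √2 * (2⁻¹ : ℝ) ^ k := by positivity
      linarith
    · linarith

lemma summable_sqLevel (x : ErdosSpace) :
    Summable fun k => (2⁻¹ : ℝ) ^ k * sqLevel k (x.coord k) := by
  have h : Summable fun k => √2 * ((2⁻¹ : ℝ) ^ k * sqLevel k (x.coord k)) :=
    Summable.of_nonneg_of_le (fun k => by positivity) (fun k => sqLevel_le k _)
      x.hasSum_coord_sq.summable
  exact (summable_mul_left_iff (by positivity)).1 h

theorem realizes : erdosTower.Realizes ErdosSpace fun x _ i => x.coord i where
  isThread x := ⟨fun k => rfl, x.summable_sqLevel⟩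
  injective x y h := by
    refine Subtype.ext (lp.ext (funext fun n => ?_))
    rw [← coe_coord, ← coe_coord]
    exact congrArg _ (congrFun (congrFun h n) (Fin.last n))
  exists_eq a ha := by
    have hval : ∀ k (i : Fin (k + 1)), a k i = a i (Fin.last i) := by
      intro k
      induction k with
      | zero => intro i; obtain rfl := Fin.fin_one_eq_zero i; rfl
      | succ k ih =>
        intro i
        induction i using Fin.lastCases with
        | last => rfl
        | cast i => exact (congrFun (ha.1 k) i).trans (ih i)
    let y : ℕ → ℝ := fun n => (a n (Fin.last n) : ℚ)
    have hs : Summable fun n => y n ^ 2 := by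
      refine Summable.of_nonneg_of_le (fun n => sq_nonneg _)
        (fun n => sq_le_sqLevel n (a n (Fin.last n))) ?_
      exact (ha.2.mul_left _).add
        ((summable_geometric_of_lt_one (by norm_num) (by norm_num)).mul_left _)
    have hy : Memℓp y 2 := memℓp_gen (by simpa using hs)
    refine ⟨⟨⟨y, hy⟩, fun n => ⟨_, rfl⟩⟩, funext fun k => funext fun i => ?_⟩
    rw [hval]
    exact Rat.cast_injective (α := ℝ) (coe_coord _ _)
  isInducing := by
    let D : (ℕ → ℚ) → ℝ := fun q =>
      ∑' k, ((q k : ℝ) ^ 2 - √2 * ((2⁻¹ : ℝ) ^ k * sqLevel k (q k)))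
    have hD : ∀ x : ErdosSpace, D x.coord =
        ‖x.1‖ ^ 2 - √2 * erdosTower.weight fun _ i => x.coord i := by
      intro x
      have h := x.hasSum_coord_sq.sub (x.summable_sqLevel.hasSum.mul_left √2)
      exact h.tsum_eq
    have hc := isInducing_coord.continuous
    have hcoord : Continuous fun x : ErdosSpace => x.coord := hc.fst
    have h2 : (√2 : ℝ) ≠ 0 := by positivity
    have hw : Continuous fun x : ErdosSpace => erdosTower.weight fun _ i => x.coord i := by
      have : (fun x : ErdosSpace => erdosTower.weight fun _ i => x.coord i) =
          fun x => (‖x.1‖ ^ 2 - D x.coord) / √2 := by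
        funext x
        rw [hD]
        field_simp
        ring
      rw [this]
      exact (hc.snd.sub (continuous_defect.comp hcoord)).div_const _
    let P : (∀ k, erdosTower.A k) → ℕ → ℚ := fun a n => a n (Fin.last n)
    have hP : Continuous P := continuous_pi fun n =>
      (continuous_apply (Fin.last n)).comp (continuous_apply (A := fun k => Fin (k + 1) → ℚ) n)
    let G : (∀ k, erdosTower.A k) × ℝ → (ℕ → ℚ) × ℝ := fun z => (P z.1, √2 * z.2 + D (P z.1))
    refine IsInducing.of_comp (g := G) ?_ ?_ ?_
    · refine Continuous.prodMk (continuous_pi fun k => ?_) hw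
      exact continuous_pi fun i : Fin (k + 1) => (continuous_apply (i : ℕ)).comp hcoord
    · exact (hP.comp continuous_fst).prodMk ((continuous_const.mul continuous_snd).add
        (continuous_defect.comp (hP.comp continuous_fst)))
    · convert! isInducing_coord using 1
      funext x
      refine Prod.ext rfl ?_
      change √2 * _ + D x.coord = _
      rw [hD]
      ring

end ErdosSpace

namespace ErdosModel

/-- The entries of the arrays, ordered lexicographically. -/
abbrev Coef := ℤ ×ₗ ℤ

instance : Countable Coef := inferInstanceAs (Countable (ℤ × ℤ))

/-- The size of an entry, a seminorm vanishing on the infinitely large entry `unit`. -/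
def size (γ : Coef) : ℕ := (ofLex γ).2.natAbs

/-- A positive entry of size zero. -/
def unit : Coef := toLex (1, 0)

lemma unit_pos : 0 < unit := Prod.Lex.toLex_lt_toLex.2 (Or.inl one_pos)

@[simp] lemma size_zero : size 0 = 0 := rfl

@[simp] lemma size_unit : size unit = 0 := rfl

lemma size_add_le (a b : Coef) : size (a + b) ≤ size a + size b := Int.natAbs_add_le _ _

lemma size_neg (a : Coef) : size (-a) = size a := Int.natAbs_neg _

lemma size_toLex (m : ℕ) : size (toLex (0, (m : ℤ))) = m := rfl

/-- Arrays of entries; position `j` lies in the row `row j`. -/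
abbrev Arr := ℕ → Coef

/-- The row of a position. -/
def row (j : ℕ) : ℕ := (Nat.unpair j).1

/-- The distinguished position of a row, which carries the weight. -/
def mark (k : ℕ) : ℕ := Nat.pair k 0

lemma row_le (j : ℕ) : row j ≤ j := Nat.unpair_left_le j

lemma row_pair (k m : ℕ) : row (Nat.pair k m) = k := by simp [row]

@[simp] lemma row_mark (k : ℕ) : row (mark k) = k := row_pair k 0

/-- Lexicographic positivity of an array. -/
def Pos (d : Arr) : Prop := 0 < toLex d

lemma pos_iff {d : Arr} : Pos d ↔ ∃ m, (∀ j < m, d j = 0) ∧ 0 < d m := by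
  constructor
  · rintro ⟨m, h, hm⟩
    exact ⟨m, fun j hj => (h j hj).symm, hm⟩
  · rintro ⟨m, h, hm⟩
    exact ⟨m, fun j hj => (h j hj).symm, hm⟩

lemma Pos.ne_zero {d : Arr} (h : Pos d) : d ≠ 0 := fun h0 => lt_irrefl _ (h0 ▸ h : Pos 0)

lemma Pos.add {d d' : Arr} (h : Pos d) (h' : Pos d') : Pos (d + d') :=
  add_pos (a := toLex d) (b := toLex d') h h'

lemma Pos.not_neg {d : Arr} (h : Pos d) : ¬ Pos (-d) := fun h' =>
  (h.add h').ne_zero (add_neg_cancel d)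

/-- Truncation of an array to the positions below `i`. -/
def tr (i : ℕ) : Arr →+ Arr where
  toFun z j := if j < i then z j else 0
  map_zero' := by ext j; simp
  map_add' x y := by funext j; by_cases h : j < i <;> simp [h]

lemma tr_apply (i : ℕ) (z : Arr) (j : ℕ) : tr i z j = if j < i then z j else 0 := rfl

lemma tr_apply_of_lt {i j : ℕ} (h : j < i) (z : Arr) : tr i z j = z j := if_pos h

lemma tr_apply_of_le {i j : ℕ} (h : i ≤ j) (z : Arr) : tr i z j = 0 := if_neg h.not_gt

lemma tr_tr {i j : ℕ} (h : i ≤ j) (z : Arr) : tr i (tr j z) = tr i z := by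
  funext l
  simp only [tr_apply]
  split_ifs <;> first | rfl | omega

lemma Pos.tr {d : Arr} (h : Pos d) (i : ℕ) (hi : tr i d ≠ 0) : Pos (tr i d) := by
  obtain ⟨m, hm, hdm⟩ := pos_iff.1 h
  have hmi : m < i := by
    by_contra hle
    refine hi (funext fun j => ?_)
    rw [tr_apply]
    split_ifs with hj
    · exact hm j (by omega)
    · rfl
  refine pos_iff.2 ⟨m, fun j hj => ?_, by rwa [tr_apply_of_lt hmi]⟩
  rw [tr_apply_of_lt (hj.trans hmi), hm j hj]

/-- The part of an array in the rows up to `k`. -/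
def rows (k : ℕ) : Arr →+ Arr where
  toFun z j := if row j ≤ k then z j else 0
  map_zero' := by ext j; simp
  map_add' x y := by funext j; by_cases h : row j ≤ k <;> simp [h]

lemma rows_apply (k : ℕ) (z : Arr) (j : ℕ) : rows k z j = if row j ≤ k then z j else 0 := rfl

lemma rows_apply_of_le {k j : ℕ} (h : row j ≤ k) (z : Arr) : rows k z j = z j := if_pos h

lemma rows_rows {k l : ℕ} (h : k ≤ l) (z : Arr) : rows k (rows l z) = rows k z := by
  funext j
  simp only [rows_apply]
  split_ifs <;> first | rfl | omega

lemma rows_rows' {k l : ℕ} (h : k ≤ l) (z : Arr) : rows l (rows k z) = rows k z := by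
  funext j
  simp only [rows_apply]
  split_ifs <;> first | rfl | omega

lemma tr_rows (i k : ℕ) (z : Arr) : tr i (rows k z) = rows k (tr i z) := by
  funext j
  simp only [tr_apply, rows_apply]
  split_ifs <;> rfl

/-- Position `j` carries the first nonzero entry of `d`. -/
def IsLead (d : Arr) (j : ℕ) : Prop := (∀ l < j, d l = 0) ∧ d j ≠ 0

lemma IsLead.congr {d d' : Arr} {j : ℕ} (h : IsLead d j) (hd : ∀ l ≤ j, d l = d' l) :
    IsLead d' j :=
  ⟨fun l hl => by rw [← hd l hl.le, h.1 l hl], by rw [← hd j le_rfl]; exact h.2⟩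

lemma IsLead.eq {d : Arr} {i j : ℕ} (h : IsLead d i) (h' : IsLead d j) : i = j := by
  rcases lt_trichotomy i j with hij | hij | hij
  · exact (h.2 (h'.1 i hij)).elim
  · exact hij
  · exact (h'.2 (h.1 j hij)).elim

lemma exists_isLead {d : Arr} {j : ℕ} (h : d j ≠ 0) : ∃ l ≤ j, IsLead d l := by
  classical
  have hex : ∃ l, d l ≠ 0 := ⟨j, h⟩
  exact ⟨Nat.find hex, Nat.find_min' hex h, fun l hl => not_not.1 (Nat.find_min hex hl),
    Nat.find_spec hex⟩

lemma Pos.exists_isLead {d : Arr} (h : Pos d) : ∃ m, IsLead d m ∧ 0 < d m := by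
  obtain ⟨m, hm, hpos⟩ := pos_iff.1 h
  exact ⟨m, ⟨hm, hpos.ne'⟩, hpos⟩

open Classical in
/-- The part of an array in the rows up to `k`, with the leading position marked by `unit` if it
lies outside these rows. -/
def mrows (k : ℕ) (d : Arr) (j : ℕ) : Coef :=
  if row j ≤ k then d j else if IsLead d j then unit else 0

lemma mrows_apply_of_le {k j : ℕ} (h : row j ≤ k) (d : Arr) : mrows k d j = d j := if_pos h

lemma mrows_apply_of_isLead {k j : ℕ} (h : k < row j) {d : Arr} (hd : IsLead d j) :
    mrows k d j = unit := by
  rw [mrows, if_neg h.not_ge, if_pos hd]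

lemma mrows_apply_of_not_isLead {k j : ℕ} (h : k < row j) {d : Arr} (hd : ¬ IsLead d j) :
    mrows k d j = 0 := by
  rw [mrows, if_neg h.not_ge, if_neg hd]

lemma mrows_congr {k j : ℕ} {d d' : Arr} (h : ∀ l ≤ j, d l = d' l) :
    mrows k d j = mrows k d' j := by
  have : IsLead d j ↔ IsLead d' j :=
    ⟨fun hd => hd.congr h, fun hd => hd.congr fun l hl => (h l hl).symm⟩
  rcases le_or_gt (row j) k with hr | hr
  · rw [mrows_apply_of_le hr, mrows_apply_of_le hr, h j le_rfl]
  · by_cases hd : IsLead d j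
    · rw [mrows_apply_of_isLead hr hd, mrows_apply_of_isLead hr (this.1 hd)]
    · rw [mrows_apply_of_not_isLead hr hd, mrows_apply_of_not_isLead hr (mt this.2 hd)]

lemma isLead_mrows_of_isLead {k j : ℕ} {d : Arr} (h : IsLead d j) : IsLead (mrows k d) j := by
  refine ⟨fun l hl => ?_, ?_⟩
  · rcases le_or_gt (row l) k with hr | hr
    · rw [mrows_apply_of_le hr, h.1 l hl]
    · exact mrows_apply_of_not_isLead hr fun h' => h'.2 (h.1 l hl)
  · rcases le_or_gt (row j) k with hr | hr
    · rw [mrows_apply_of_le hr]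
      exact h.2
    · rw [mrows_apply_of_isLead hr h]
      exact unit_pos.ne'

@[simp] lemma mrows_zero (k : ℕ) : mrows k 0 = 0 := by
  funext j
  rcases le_or_gt (row j) k with hr | hr
  · rw [mrows_apply_of_le hr]
  · exact mrows_apply_of_not_isLead hr fun h => h.2 rfl

lemma mrows_eq_zero {k : ℕ} {d : Arr} : mrows k d = 0 ↔ d = 0 := by
  refine ⟨fun h => ?_, fun h => by rw [h, mrows_zero]⟩
  by_contra hd
  obtain ⟨j, hj⟩ := Function.ne_iff.1 hd
  obtain ⟨l, -, hl⟩ := exists_isLead hj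
  exact (isLead_mrows_of_isLead (k := k) hl).2 (congrFun h l)

lemma isLead_mrows {k j : ℕ} {d : Arr} : IsLead (mrows k d) j ↔ IsLead d j := by
  refine ⟨fun h => ?_, isLead_mrows_of_isLead⟩
  have hd : d ≠ 0 := fun h0 => h.2 (by rw [h0, mrows_zero]; rfl)
  obtain ⟨i, hi⟩ := Function.ne_iff.1 hd
  obtain ⟨l, -, hl⟩ := exists_isLead hi
  rwa [h.eq (isLead_mrows_of_isLead hl)]

lemma mrows_mrows {k l : ℕ} (h : k ≤ l) (d : Arr) : mrows k (mrows l d) = mrows k d := by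
  funext j
  rcases le_or_gt (row j) k with hr | hr
  · rw [mrows_apply_of_le hr, mrows_apply_of_le hr, mrows_apply_of_le (hr.trans h)]
  · by_cases hd : IsLead d j
    · rw [mrows_apply_of_isLead hr hd, mrows_apply_of_isLead hr (isLead_mrows.2 hd)]
    · rw [mrows_apply_of_not_isLead hr hd, mrows_apply_of_not_isLead hr (mt isLead_mrows.1 hd)]

lemma mrows_mrows' {k l : ℕ} (h : k ≤ l) (d : Arr) : mrows l (mrows k d) = mrows k d := by
  funext j
  rcases le_or_gt (row j) l with hr | hr
  · rw [mrows_apply_of_le hr]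
  · by_cases hd : IsLead d j
    · rw [mrows_apply_of_isLead hr (isLead_mrows.2 hd),
        mrows_apply_of_isLead (h.trans_lt hr) hd]
    · rw [mrows_apply_of_not_isLead hr (mt isLead_mrows.1 hd),
        mrows_apply_of_not_isLead (h.trans_lt hr) hd]

lemma tr_mrows (i k : ℕ) (d : Arr) : tr i (mrows k d) = mrows k (tr i d) := by
  funext j
  rcases lt_or_ge j i with hj | hj
  · rw [tr_apply_of_lt hj]
    exact mrows_congr fun l hl => (tr_apply_of_lt (hl.trans_lt hj) d).symm
  · rw [tr_apply_of_le hj]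
    rcases le_or_gt (row j) k with hr | hr
    · rw [mrows_apply_of_le hr, tr_apply_of_le hj]
    · exact (mrows_apply_of_not_isLead hr fun h => h.2 (tr_apply_of_le hj d)).symm

lemma Pos.mrows {d : Arr} (h : Pos d) (k : ℕ) : Pos (mrows k d) := by
  obtain ⟨m, hm, hpos⟩ := h.exists_isLead
  refine pos_iff.2 ⟨m, (isLead_mrows_of_isLead hm).1, ?_⟩
  rcases le_or_gt (row m) k with hr | hr
  · rwa [mrows_apply_of_le hr]
  · rw [mrows_apply_of_isLead hr hm]
    exact unit_pos

lemma pos_of_forall_mrows {d : Arr} (h : ∀ k, Pos (mrows k d)) : Pos d := by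
  obtain ⟨m, hm, -⟩ := (h 0).exists_isLead
  have hm' := isLead_mrows.1 hm
  obtain ⟨l, hl, hpos⟩ := (h (row m)).exists_isLead
  obtain rfl := (isLead_mrows.1 hl).eq hm'
  rw [mrows_apply_of_le le_rfl] at hpos
  exact pos_iff.2 ⟨l, hm'.1, hpos⟩

lemma mrows_apply_eq_zero {i j k : ℕ} {d : Arr} (hd : tr i d ≠ 0) (hij : i ≤ j) (hr : k < row j) :
    mrows k d j = 0 := by
  obtain ⟨l, hl⟩ := Function.ne_iff.1 hd
  have hli : l < i := by
    by_contra hle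
    exact hl (tr_apply_of_le (not_lt.1 hle) d)
  rw [tr_apply_of_lt hli] at hl
  obtain ⟨m, hml, hm⟩ := ErdosModel.exists_isLead hl
  exact mrows_apply_of_not_isLead hr fun h => by
    have := h.eq hm
    omega

/-- Arrays with finitely many nonzero entries. -/
def FinSupp (z : Arr) : Prop := ∃ M, ∀ j ≥ M, z j = 0

/-- Arrays with finitely many nonzero entries in each row. -/
def RowFinite (z : Arr) : Prop := ∀ k, FinSupp (rows k z)

lemma FinSupp.add {x y : Arr} (hx : FinSupp x) (hy : FinSupp y) : FinSupp (x + y) := by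
  obtain ⟨M, hM⟩ := hx
  obtain ⟨M', hM'⟩ := hy
  exact ⟨max M M', fun j hj => by
    rw [Pi.add_apply, hM j (le_of_max_le_left hj), hM' j (le_of_max_le_right hj), add_zero]⟩

lemma FinSupp.neg {x : Arr} (hx : FinSupp x) : FinSupp (-x) :=
  hx.imp fun M hM j hj => by rw [Pi.neg_apply, hM j hj, neg_zero]

lemma finSupp_zero : FinSupp 0 := ⟨0, fun _ _ => rfl⟩

lemma FinSupp.rows {x : Arr} (hx : FinSupp x) (k : ℕ) : FinSupp (rows k x) :=
  hx.imp fun M hM j hj => by rw [rows_apply, hM j hj, ite_self]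

lemma finSupp_tr (i : ℕ) (x : Arr) : FinSupp (tr i x) := ⟨i, fun _ hj => tr_apply_of_le hj x⟩

lemma finSupp_iff {x : Arr} : FinSupp x ↔ ∃ M, ∀ i ≥ M, tr i x = x := by
  refine exists_congr fun M => ⟨fun h i hi => funext fun j => ?_, fun h j hj => ?_⟩
  · rcases lt_or_ge j i with hj | hj
    · exact tr_apply_of_lt hj x
    · rw [tr_apply_of_le hj, h j (hi.trans hj)]
  · rw [← h M le_rfl, tr_apply_of_le hj]

lemma finSupp_mrows {d : Arr} {k : ℕ} (hd : FinSupp (ErdosModel.rows k d)) :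
    FinSupp (mrows k d) := by
  obtain ⟨M, hM⟩ := hd
  by_cases h0 : d = 0
  · rw [h0, mrows_zero]
    exact finSupp_zero
  obtain ⟨i, hi⟩ := Function.ne_iff.1 h0
  obtain ⟨m, -, hm⟩ := exists_isLead hi
  refine ⟨max M (m + 1), fun j hj => ?_⟩
  rcases le_or_gt (row j) k with hr | hr
  · rw [mrows_apply_of_le hr, ← rows_apply_of_le hr d]
    exact hM j (le_of_max_le_left hj)
  · refine mrows_apply_of_not_isLead hr fun h => ?_
    have := le_of_max_le_right hj
    have := h.eq hm
    omega

lemma rows_mrows (k : ℕ) (d : Arr) : rows k (mrows k d) = rows k d := by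
  funext j
  simp only [rows_apply]
  split_ifs with h
  · exact mrows_apply_of_le h d
  · rfl

lemma countable_finSupp : {z : Arr | FinSupp z}.Countable := by
  refine (countable_range fun f : ℕ →₀ Coef => (f : Arr)).mono ?_
  rintro z ⟨M, hM⟩
  refine ⟨Finsupp.ofSupportFinite z ((finite_lt_nat M).subset fun j hj => ?_), rfl⟩
  by_contra hle
  exact hj (hM j (not_lt.1 hle))

/-- The weight of an array. -/
def wt (z : Arr) : ℝ := ∑' k, (2⁻¹ : ℝ) ^ k * size (z (mark k))

/-- Row-finite arrays of finite weight. -/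
def good : AddSubgroup Arr where
  carrier := {z | RowFinite z ∧ Summable fun k => (2⁻¹ : ℝ) ^ k * size (z (mark k))}
  zero_mem' := ⟨fun k => by rw [map_zero]; exact finSupp_zero, by simp⟩
  add_mem' {x y} hx hy := by
    refine ⟨fun k => by rw [map_add]; exact (hx.1 k).add (hy.1 k),
      Summable.of_nonneg_of_le (fun k => by positivity) (fun k => ?_) (hx.2.add hy.2)⟩
    rw [← mul_add]
    gcongr
    exact_mod_cast size_add_le _ _
  neg_mem' {x} hx := ⟨fun k => by rw [map_neg]; exact (hx.1 k).neg, by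
    simpa only [Pi.neg_apply, size_neg] using hx.2⟩

lemma good_of_finSupp {z : Arr} (hz : FinSupp z) : z ∈ good := by
  refine ⟨fun k => hz.rows k, ?_⟩
  obtain ⟨M, hM⟩ := hz
  refine summable_of_ne_finset_zero (s := Finset.range M) fun k hk => ?_
  have hk : M ≤ mark k := (not_lt.1 (Finset.mem_range.not.1 hk)).trans (Nat.left_le_pair k 0)
  simp [hM _ hk]

lemma wt_nonneg (z : Arr) : 0 ≤ wt z := tsum_nonneg fun k => by positivity

lemma wt_add_le {x y : Arr} (hx : x ∈ good) (hy : y ∈ good) : wt (x + y) ≤ wt x + wt y := by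
  rw [wt, wt, wt, ← hx.2.tsum_add hy.2]
  refine (good.add_mem hx hy).2.tsum_le_tsum (fun k => ?_) (hx.2.add hy.2)
  rw [← mul_add]
  gcongr
  exact_mod_cast size_add_le _ _

lemma wt_neg (x : Arr) : wt (-x) = wt x := by simp only [wt, Pi.neg_apply, size_neg]

lemma wt_sub_le {x y : Arr} (hx : x ∈ good) (hy : y ∈ good) : wt (x - y) ≤ wt x + wt y := by
  rw [sub_eq_add_neg, ← wt_neg y]
  exact wt_add_le hx (good.neg_mem hy)

lemma abs_wt_sub_wt_le {x y : Arr} (hx : x ∈ good) (hy : y ∈ good) :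
    |wt x - wt y| ≤ wt (x - y) := by
  have h1 := wt_add_le (good.sub_mem hx hy) hy
  have h2 := wt_add_le (good.sub_mem hy hx) hx
  rw [sub_add_cancel] at h1 h2
  rw [← neg_sub, wt_neg] at h2
  rw [abs_le]
  constructor <;> linarith

lemma wt_eq_add (i : ℕ) {x : Arr} (hx : x ∈ good) : wt x = wt (tr i x) + wt (x - tr i x) := by
  have ht := good_of_finSupp (finSupp_tr i x)
  rw [wt, wt, wt, ← ht.2.tsum_add (good.sub_mem hx ht).2]
  refine tsum_congr fun k => ?_
  rw [← mul_add, Pi.sub_apply]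
  rcases lt_or_ge (mark k) i with h | h
  · simp [tr_apply_of_lt h]
  · simp [tr_apply_of_le h]

/-- Arrays with a common truncation and almost the same weight are close. -/
lemma wt_sub_le_of_tr_eq {i : ℕ} {x y : Arr} (hx : x ∈ good) (hy : y ∈ good)
    (h : tr i x = tr i y) : wt (x - y) ≤ wt x - wt y + 2 * wt (y - tr i y) := by
  have ht := good_of_finSupp (finSupp_tr i y)
  have h1 := wt_eq_add i hx
  have h2 := wt_eq_add i hy
  rw [h] at h1
  have h3 := wt_sub_le (good.sub_mem hx ht) (good.sub_mem hy ht)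
  rw [sub_sub_sub_cancel_right] at h3
  linarith

lemma tendsto_wt_sub_tr {x : Arr} (hx : x ∈ good) :
    Filter.Tendsto (fun i => wt (x - tr i x)) Filter.atTop (𝓝 0) := by
  have key := tendsto_tsum_of_dominated_convergence (𝓕 := Filter.atTop)
    (f := fun i k => (2⁻¹ : ℝ) ^ k * size ((x - tr i x) (mark k))) (g := fun _ => 0) hx.2
    (fun k => ?_) (Filter.Eventually.of_forall fun i k => ?_)
  · simpa [wt] using key
  · refine tendsto_const_nhds.congr' ?_
    filter_upwards [Filter.eventually_gt_atTop (mark k)] with i hi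
    simp [tr_apply_of_lt hi]
  · rw [Real.norm_of_nonneg (by positivity), Pi.sub_apply, tr_apply]
    split_ifs
    · simp only [sub_self, size_zero, Nat.cast_zero, mul_zero]
      positivity
    · rw [sub_zero]

end ErdosModel

namespace ErdosModel

/-- A starting array followed by a list of increments. -/
structure Word where
  base : Arr
  steps : List Arr

instance : TopologicalSpace Word := ⊥

instance : DiscreteTopology Word := ⟨rfl⟩

open Classical in
/-- Truncation of the increments, dropping those that become zero. -/
def ltr (i : ℕ) (w : List Arr) : List Arr := (w.map (tr i)).filter (· ≠ 0)

@[simp] lemma ltr_nil (i : ℕ) : ltr i [] = [] := rfl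

lemma ltr_cons_of_eq {i : ℕ} {d : Arr} (h : tr i d = 0) (w : List Arr) :
    ltr i (d :: w) = ltr i w := by
  simp [ltr, h]

lemma ltr_cons_of_ne {i : ℕ} {d : Arr} (h : tr i d ≠ 0) (w : List Arr) :
    ltr i (d :: w) = tr i d :: ltr i w := by
  simp [ltr, h]

lemma ltr_ltr {i j : ℕ} (h : i ≤ j) (w : List Arr) : ltr i (ltr j w) = ltr i w := by
  induction w with
  | nil => rfl
  | cons d w ih =>
    by_cases hj : tr j d = 0
    · have hi : tr i d = 0 := by rw [← tr_tr h, hj, map_zero]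
      rw [ltr_cons_of_eq hj, ltr_cons_of_eq hi, ih]
    · rw [ltr_cons_of_ne hj]
      by_cases hi : tr i d = 0
      · rw [ltr_cons_of_eq hi, ltr_cons_of_eq (by rwa [tr_tr h]), ih]
      · rw [ltr_cons_of_ne hi, ltr_cons_of_ne (by rwa [tr_tr h]), ih, tr_tr h]

lemma ltr_map_mrows (i k : ℕ) (w : List Arr) :
    ltr i (w.map (mrows k)) = (ltr i w).map (mrows k) := by
  induction w with
  | nil => rfl
  | cons d w ih =>
    have hd : tr i (mrows k d) = 0 ↔ tr i d = 0 := by rw [tr_mrows, mrows_eq_zero]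
    rw [List.map_cons]
    by_cases h : tr i d = 0
    · rw [ltr_cons_of_eq h, ltr_cons_of_eq (hd.2 h), ih]
    · rw [ltr_cons_of_ne h, ltr_cons_of_ne (mt hd.1 h), ih, tr_mrows, List.map_cons]

lemma ltr_eq_self {i : ℕ} {w : List Arr} (h : ∀ d ∈ w, tr i d = d) (h0 : ∀ d ∈ w, d ≠ 0) :
    ltr i w = w := by
  induction w with
  | nil => rfl
  | cons d w ih =>
    have hd := h d List.mem_cons_self
    rw [ltr_cons_of_ne (by rw [hd]; exact h0 d List.mem_cons_self), hd,
      ih (fun x hx => h x (List.mem_cons_of_mem _ hx))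
        fun x hx => h0 x (List.mem_cons_of_mem _ hx)]

/-- Truncation of words. -/
def wtr (i : ℕ) (ω : Word) : Word := ⟨tr i ω.base, ltr i ω.steps⟩

lemma wtr_wtr {i j : ℕ} (h : i ≤ j) (ω : Word) : wtr i (wtr j ω) = wtr i ω := by
  simp only [wtr, tr_tr h, ltr_ltr h]

/-- Restriction of words to the rows up to `k`, with marked leading positions. -/
def wrows (k : ℕ) (ω : Word) : Word := ⟨rows k ω.base, ω.steps.map (mrows k)⟩

lemma wtr_wrows (i k : ℕ) (ω : Word) : wtr i (wrows k ω) = wrows k (wtr i ω) := by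
  simp only [wtr, wrows, tr_rows, ltr_map_mrows]

lemma wrows_wrows {k l : ℕ} (h : k ≤ l) (ω : Word) : wrows k (wrows l ω) = wrows k ω := by
  simp only [wrows, rows_rows h, List.map_map]
  congr 2
  exact funext fun d => mrows_mrows h d

lemma wrows_wtr {i k : ℕ} (h : i ≤ k) (ω : Word) : wrows k (wtr i ω) = wtr i ω := by
  rw [← wtr_wrows]
  have hrow : ∀ j < i, row j ≤ k := fun j hj => ((row_le j).trans hj.le).trans h
  have hbase : tr i (rows k ω.base) = tr i ω.base := by
    funext j
    simp only [tr_apply]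
    split_ifs with hj
    · exact rows_apply_of_le (hrow j hj) _
    · rfl
  have hstep : tr i ∘ mrows k = tr i := by
    funext d j
    simp only [Function.comp_apply, tr_apply]
    split_ifs with hj
    · exact mrows_apply_of_le (hrow j hj) _
    · rfl
  simp only [wtr, wrows, hbase, ltr, List.map_map, hstep]

/-- The size of a word at the distinguished position of row `k`. -/
def wsize (k : ℕ) (ω : Word) : ℕ :=
  size (ω.base (mark k)) + (ω.steps.map fun d => size (d (mark k))).sum

lemma wsize_wtr {i k : ℕ} (h : mark k < i) (ω : Word) : wsize k (wtr i ω) = wsize k ω := by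
  obtain ⟨x, w⟩ := ω
  simp only [wsize, wtr, tr_apply_of_lt h]
  congr 1
  induction w with
  | nil => rfl
  | cons d w ih =>
    by_cases hd : tr i d = 0
    · have : d (mark k) = 0 := by rw [← tr_apply_of_lt h d, hd]; rfl
      rw [ltr_cons_of_eq hd, ih, List.map_cons, List.sum_cons, this, size_zero, zero_add]
    · rw [ltr_cons_of_ne hd, List.map_cons, List.sum_cons, ih, tr_apply_of_lt h, List.map_cons,
        List.sum_cons]

lemma wsize_wrows (k : ℕ) (ω : Word) : wsize k (wrows k ω) = wsize k ω := by
  simp [wsize, wrows, rows_apply_of_le, mrows_apply_of_le, Function.comp_def]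

/-- The increments allowed at level `k`. -/
def IsStep (k : ℕ) (d : Arr) : Prop := Pos d ∧ FinSupp d ∧ mrows k d = d

lemma IsStep.succ {k : ℕ} {d : Arr} (h : IsStep k d) : IsStep (k + 1) d :=
  ⟨h.1, h.2.1, by rw [← h.2.2, mrows_mrows' k.le_succ]⟩

lemma IsStep.size_eq_zero {k : ℕ} {d : Arr} (h : IsStep k d) : size (d (mark (k + 1))) = 0 := by
  rw [← h.2.2]
  by_cases hd : IsLead d (mark (k + 1))
  · rw [mrows_apply_of_isLead (by simp) hd, size_unit]
  · rw [mrows_apply_of_not_isLead (by simp) hd, size_zero]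

/-- The words that make up level `k` of the tower for the `n`-th symmetric product. -/
def Level (n k : ℕ) : Type :=
  {ω : Word // FinSupp ω.base ∧ rows k ω.base = ω.base ∧ ω.steps.length < n ∧
    ∀ d ∈ ω.steps, IsStep k d}

variable {n : ℕ}

instance (k : ℕ) : TopologicalSpace (Level n k) :=
  TopologicalSpace.induced (fun ω i => wtr i ω.1) inferInstance

lemma Level.exists_wtr_eq {k : ℕ} (ω : Level n k) : ∃ M, ∀ i ≥ M, wtr i ω.1 = ω.1 := by
  obtain ⟨⟨x, w⟩, hx, -, -, hw⟩ := ω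
  obtain ⟨M, hM⟩ := finSupp_iff.1 hx
  have hw' : ∃ M, ∀ i ≥ M, ∀ d ∈ w, tr i d = d := by
    have : ∀ᶠ i in Filter.atTop, ∀ d ∈ {d | d ∈ w}, tr i d = d :=
      (Filter.eventually_all_finite w.finite_toSet).2 fun d hd =>
        Filter.eventually_atTop.2 (finSupp_iff.1 (hw d hd).2.1)
    exact Filter.eventually_atTop.1 this
  obtain ⟨M', hM'⟩ := hw'
  refine ⟨max M M', fun i hi => ?_⟩
  simp only [wtr]
  rw [hM i (le_of_max_le_left hi), ltr_eq_self (hM' i (le_of_max_le_right hi))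
    fun d hd => (hw d hd).1.ne_zero]

lemma Level.isEmbedding (k : ℕ) : IsEmbedding fun (ω : Level n k) i => wtr i ω.1 := by
  refine ⟨⟨rfl⟩, fun ω ω' h => Subtype.ext ?_⟩
  obtain ⟨M, hM⟩ := ω.exists_wtr_eq
  obtain ⟨M', hM'⟩ := ω'.exists_wtr_eq
  rw [← hM _ (le_max_left M M'), ← hM' _ (le_max_right M M')]
  exact congrFun h _

instance (k : ℕ) : TopologicalSpace.MetrizableSpace (Level n k) :=
  (Level.isEmbedding k).metrizableSpace

instance (k : ℕ) : Countable (Level n k) := by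
  have hl : {w : List Arr | ∀ d ∈ w, d ∈ {z | FinSupp z}}.Countable := by
    have := countable_finSupp.to_subtype
    rw [← Set.range_list_map_coe]
    exact countable_range _
  have := countable_finSupp.to_subtype
  have := hl.to_subtype
  let g : Level n k → {z : Arr | FinSupp z} × {w : List Arr | ∀ d ∈ w, d ∈ {z | FinSupp z}} :=
    fun ω => (⟨ω.1.base, ω.2.1⟩, ⟨ω.1.steps, fun d hd => (ω.2.2.2.2 d hd).2.1⟩)
  refine Function.Injective.countable (f := g) fun ω ω' h => ?_
  obtain ⟨⟨x, w⟩, hω⟩ := ω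
  obtain ⟨⟨x', w'⟩, hω'⟩ := ω'
  simp only [g, Prod.mk.injEq, Subtype.mk.injEq] at h
  obtain ⟨rfl, rfl⟩ := h
  rfl

lemma Level.mem_nhds_iff {k : ℕ} {ω : Level n k} {U : Set (Level n k)} :
    U ∈ 𝓝 ω ↔ ∃ i, ∀ ω' : Level n k, wtr i ω'.1 = wtr i ω.1 → ω' ∈ U := by
  rw [(Level.isEmbedding k).nhds_eq_comap, Filter.mem_comap]
  constructor
  · rintro ⟨V, hV, hVU⟩
    obtain ⟨_, ⟨f, i, rfl⟩, hf, hfV⟩ :=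
      (PiNat.isTopologicalBasis_cylinders fun _ => Word).mem_nhds_iff.1 hV
    refine ⟨i, fun ω' h => hVU (hfV fun j hj => ?_)⟩
    change wtr j ω'.1 = _
    rw [← wtr_wtr hj.le, h, wtr_wtr hj.le]
    exact hf j hj
  · rintro ⟨i, hi⟩
    have ho : IsOpen ((fun f : ℕ → Word => f i) ⁻¹' {wtr i ω.1}) :=
      (isOpen_discrete _).preimage (continuous_apply i)
    exact ⟨_, ho.mem_nhds rfl, fun ω' h => hi ω' h⟩

lemma Level.eventually_wtr_eq {k : ℕ} (ω : Level n k) (i : ℕ) :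
    ∀ᶠ ω' in 𝓝 ω, wtr i ω'.1 = wtr i ω.1 :=
  Level.mem_nhds_iff.2 ⟨i, fun _ h => h⟩

/-- The bonding maps of the tower of words. -/
def Level.proj (k : ℕ) (ω : Level n (k + 1)) : Level n k :=
  ⟨wrows k ω.1, ω.2.1.rows k, rows_rows le_rfl _, by simpa [wrows] using ω.2.2.2.1, by
    intro d hd
    obtain ⟨d', hd', rfl⟩ := List.mem_map.1 hd
    obtain ⟨h1, h2, h3⟩ := ω.2.2.2.2 d' hd'
    exact ⟨h1.mrows k, finSupp_mrows (h2.rows k), mrows_mrows le_rfl _⟩⟩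

lemma Level.continuous_proj (k : ℕ) : Continuous (Level.proj (n := n) k) := by
  refine continuous_iff_continuousAt.2 fun ω U hU => ?_
  obtain ⟨i, hi⟩ := Level.mem_nhds_iff.1 hU
  refine Filter.mem_map.2 (Filter.mem_of_superset (ω.eventually_wtr_eq i) fun ω' h => hi _ ?_)
  change wtr i (wrows k ω'.1) = wtr i (wrows k ω.1)
  rw [wtr_wrows, wtr_wrows, h]

lemma Level.continuous_wsize (k : ℕ) : Continuous fun ω : Level n k => wsize k ω.1 := by
  refine continuous_iff_continuousAt.2 fun ω => Filter.Tendsto.congr' ?_ tendsto_const_nhds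
  filter_upwards [ω.eventually_wtr_eq (mark k + 1)] with ω' h
  rw [← wsize_wtr (Nat.lt_succ_self _) ω'.1, h, wsize_wtr (Nat.lt_succ_self _)]

/-- Change of the base of a word at one position of row `k`. -/
def Level.update {k : ℕ} (ω : Level n k) {j : ℕ} (hj : row j = k) (γ : Coef) : Level n k :=
  ⟨⟨Function.update ω.1.base j γ, ω.1.steps⟩, by
    obtain ⟨M, hM⟩ := ω.2.1
    refine ⟨max M (j + 1), fun l hl => ?_⟩
    have := le_of_max_le_right hl
    change Function.update ω.1.base j γ l = 0
    rw [Function.update_of_ne (by omega), hM l (le_of_max_le_left hl)], by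
    funext l
    rcases eq_or_ne l j with rfl | hl
    · exact rows_apply_of_le hj.le _
    · change (if row l ≤ k then Function.update ω.1.base j γ l else 0) =
        Function.update ω.1.base j γ l
      rw [Function.update_of_ne hl]
      exact congrFun ω.2.2.1 l, ω.2.2.2⟩

lemma rows_update {k j : ℕ} (h : k < row j) (x : Arr) (γ : Coef) :
    rows k (Function.update x j γ) = rows k x := by
  funext l
  simp only [rows_apply]
  split_ifs with hl
  · rw [Function.update_of_ne]
    rintro rfl
    omega
  · rfl

lemma Level.exists_update {k : ℕ} (ω : Level n k) {U : Set (Level n k)} (hU : U ∈ 𝓝 ω) :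
    ∃ (j : ℕ) (hj : row j = k) (γ : Coef), ω.update hj γ ∈ U ∧ ω.update hj γ ≠ ω ∧
      wsize k (ω.update hj γ).1 = wsize k ω.1 := by
  obtain ⟨i, hi⟩ := Level.mem_nhds_iff.1 hU
  have hj : row (Nat.pair k (i + 1)) = k := row_pair _ _
  have hij : i < Nat.pair k (i + 1) := Nat.right_le_pair k (i + 1)
  have hne : mark k ≠ Nat.pair k (i + 1) := fun h => by simpa using (Nat.pair_eq_pair.1 h).2
  refine ⟨_, hj, ω.1.base (Nat.pair k (i + 1)) + unit, hi _ ?_, fun h => ?_, ?_⟩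
  · have : tr i (Function.update ω.1.base (Nat.pair k (i + 1))
        (ω.1.base (Nat.pair k (i + 1)) + unit)) = tr i ω.1.base := by
      funext l
      simp only [tr_apply]
      split_ifs with hl
      · rw [Function.update_of_ne (by omega)]
      · rfl
    simp only [wtr, Level.update, this]
  · have h' := congrFun (congrArg (fun ω : Level n k => ω.1.base) h) (Nat.pair k (i + 1))
    simp only [Level.update, Function.update_self] at h'
    exact unit_pos.ne' (by simpa using h')
  · simp only [wsize, Level.update, Function.update_of_ne hne]

/-- Lifting of increments: those that are visible below `i` receive their new row from `w`. -/
lemma exists_lift_steps {i k : ℕ} (v w : List Arr) (hv : ∀ a ∈ v, IsStep k a)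
    (hw : ∀ d ∈ w, IsStep (k + 1) d) (hwi : ∀ d ∈ w, tr i d = d)
    (h : ltr i v = w.map (mrows k)) :
    ∃ w', w'.map (mrows k) = v ∧ ltr i w' = w ∧ ∀ d ∈ w', IsStep (k + 1) d := by
  induction v generalizing w with
  | nil =>
    rw [ltr_nil] at h
    exact ⟨[], rfl, (List.map_eq_nil_iff.1 h.symm).symm, by simp⟩
  | cons a v ih =>
    obtain ⟨haP, haF, haM⟩ := hv a List.mem_cons_self
    have hv' : ∀ a ∈ v, IsStep k a := fun b hb => hv b (List.mem_cons_of_mem _ hb)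
    by_cases ha : tr i a = 0
    · rw [ltr_cons_of_eq ha] at h
      obtain ⟨w', h1, h2, h3⟩ := ih w hv' hw hwi h
      exact ⟨a :: w', by rw [List.map_cons, h1, haM], by rw [ltr_cons_of_eq ha, h2],
        List.forall_mem_cons.2 ⟨IsStep.succ ⟨haP, haF, haM⟩, h3⟩⟩
    rw [ltr_cons_of_ne ha] at h
    obtain ⟨d, w, rfl⟩ : ∃ d w', w = d :: w' := by
      cases w with
      | nil => simp at h
      | cons d w => exact ⟨d, w, rfl⟩
    rw [List.map_cons, List.cons.injEq] at h
    obtain ⟨⟨hdP, hdF, hdM⟩, hw⟩ := List.forall_mem_cons.1 hw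
    obtain ⟨hdi, hwi⟩ := List.forall_mem_cons.1 hwi
    obtain ⟨w', h1, h2, h3⟩ := ih w hv' hw hwi h.2
    let a' : Arr := fun j => if j < i then d j else a j
    have hlt : ∀ {j}, j < i → a' j = d j := fun hj => if_pos hj
    have hge : ∀ {j}, i ≤ j → a' j = a j := fun hj => if_neg hj.not_gt
    have hai : tr i a' = d := by
      funext j
      rcases lt_or_ge j i with hj | hj
      · rw [tr_apply_of_lt hj, hlt hj]
      · rw [← hdi, tr_apply_of_le hj, tr_apply_of_le hj]
    have hne : tr i a' ≠ 0 := hai ▸ hdP.ne_zero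
    have hlow : ∀ {j l}, j < i → mrows l a' j = mrows l d j := fun hj =>
      mrows_congr fun l hl => hlt (hl.trans_lt hj)
    have hhigh : ∀ {j}, i ≤ j → k < row j → a j = 0 := fun hj hr => by
      rw [← haM]
      exact mrows_apply_eq_zero ha hj hr
    refine ⟨a' :: w', ?_, ?_, List.forall_mem_cons.2 ⟨⟨?_, ?_, ?_⟩, h3⟩⟩
    · rw [List.map_cons, h1]
      congr 1
      funext j
      rcases lt_or_ge j i with hj | hj
      · rw [hlow hj, ← h.1, tr_apply_of_lt hj]
      · rcases le_or_gt (row j) k with hr | hr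
        · rw [mrows_apply_of_le hr, hge hj]
        · rw [mrows_apply_eq_zero hne hj hr, hhigh hj hr]
    · rw [ltr_cons_of_ne hne, h2, hai]
    · obtain ⟨m, hm, hpos⟩ := pos_iff.1 hdP
      have hmi : m < i := by
        by_contra hle
        rw [← hdi, tr_apply_of_le (not_lt.1 hle)] at hpos
        exact lt_irrefl _ hpos
      exact pos_iff.2 ⟨m, fun j hj => by rw [hlt (hj.trans hmi), hm j hj], by rwa [hlt hmi]⟩
    · obtain ⟨M, hM⟩ := haF
      exact ⟨max i M, fun j hj => by rw [hge (le_of_max_le_left hj), hM j (le_of_max_le_right hj)]⟩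
    · funext j
      rcases lt_or_ge j i with hj | hj
      · rw [hlow hj, hdM, hlt hj]
      · rcases le_or_gt (row j) (k + 1) with hr | hr
        · rw [mrows_apply_of_le hr]
        · rw [mrows_apply_eq_zero hne hj hr, hge hj, hhigh hj (by omega)]

lemma Level.exists_lift {i k : ℕ} (ω : Level n (k + 1)) (hω : wtr i ω.1 = ω.1) (v : Level n k)
    (h : wtr i v.1 = wtr i (ω.proj k).1) :
    ∃ ω' : Level n (k + 1), ω'.proj k = v ∧ wtr i ω'.1 = wtr i ω.1 := by
  have hbase : tr i ω.1.base = ω.1.base := congrArg Word.base hω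
  have hsteps : ltr i ω.1.steps = ω.1.steps := congrArg Word.steps hω
  have hmem : ∀ d ∈ ω.1.steps, tr i d = d := by
    intro d hd
    rw [← hsteps, ltr, List.mem_filter, List.mem_map] at hd
    obtain ⟨⟨d', -, rfl⟩, -⟩ := hd
    exact tr_tr le_rfl d'
  have h' : wtr i v.1 = wrows k ω.1 := by
    rw [h]
    change wtr i (wrows k ω.1) = _
    rw [wtr_wrows, hω]
  have hb : tr i v.1.base = rows k ω.1.base := congrArg Word.base h'
  obtain ⟨w', h1, h2, h3⟩ := exists_lift_steps v.1.steps ω.1.steps v.2.2.2.2 ω.2.2.2.2 hmem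
    (congrArg Word.steps h')
  have hlen : w'.length = v.1.steps.length := by rw [← h1, List.length_map]
  refine ⟨⟨⟨v.1.base + (ω.1.base + -rows k ω.1.base), w'⟩,
    v.2.1.add (ω.2.1.add (ω.2.1.rows k).neg), ?_, hlen.trans_lt v.2.2.2.1, h3⟩, ?_, ?_⟩
  · change rows (k + 1) (v.1.base + (ω.1.base + -rows k ω.1.base)) = _
    rw [map_add, map_add, map_neg, rows_rows' k.le_succ, ω.2.2.1]
    conv_lhs => rw [← v.2.2.1, rows_rows' k.le_succ, v.2.2.1]
  · refine Subtype.ext ?_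
    change (⟨rows k (v.1.base + (ω.1.base + -rows k ω.1.base)), w'.map (mrows k)⟩ : Word) = v.1
    rw [map_add, map_add, map_neg, rows_rows le_rfl, add_neg_cancel, add_zero, v.2.2.1, h1]
  · change (⟨tr i (v.1.base + (ω.1.base + -rows k ω.1.base)), ltr i w'⟩ : Word) = _
    rw [map_add, map_add, map_neg, tr_rows, hbase, hb, h2, add_comm, neg_add_cancel_right, hω]

variable (n) in
/-- The tower of words for the `n`-th symmetric product. -/
def wordTower (hn : 1 ≤ n) : Tower where
  A := Level n
  p := Level.proj
  s k ω := wsize k ω.1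
  bundle_zero :=
    { continuous := Level.continuous_wsize 0
      surjective := fun m => by
        let ω : Level n 0 := ⟨⟨0, []⟩, finSupp_zero, map_zero _, hn, by simp⟩
        refine ⟨ω.update (row_mark 0) (toLex (0, (m : ℤ))), ?_⟩
        simp [wsize, Level.update, ω, size_toLex]
      image_mem_nhds := fun a U hU => mem_nhds_discrete.2 ⟨a, mem_of_mem_nhds hU, rfl⟩
      exists_ne := fun ω U hU => by
        obtain ⟨j, hj, γ, h1, h2, h3⟩ := ω.exists_update hU
        exact ⟨_, h1, h2, h3⟩ }
  bundle_succ k :=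
    { continuous := (Level.continuous_proj k).prodMk (Level.continuous_wsize (k + 1))
      surjective := fun ⟨v, m⟩ => by
        let ω : Level n (k + 1) := ⟨v.1, v.2.1, by rw [← v.2.2.1, rows_rows' k.le_succ],
          v.2.2.2.1, fun d hd => (v.2.2.2.2 d hd).succ⟩
        refine ⟨ω.update (row_mark (k + 1)) (toLex (0, (m : ℤ))), Prod.ext (Subtype.ext ?_) ?_⟩
        · change (⟨rows k (Function.update v.1.base _ _), v.1.steps.map (mrows k)⟩ : Word) = v.1
          rw [rows_update (by simp), v.2.2.1, List.map_congr_left (g := id)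
            fun d hd => (v.2.2.2.2 d hd).2.2, List.map_id]
        · change size (Function.update v.1.base _ _ _) + (v.1.steps.map _).sum = m
          rw [Function.update_self, size_toLex, List.map_congr_left (g := fun _ => 0)
            fun d hd => (v.2.2.2.2 d hd).size_eq_zero]
          simp
      image_mem_nhds := fun ω U hU => by
        obtain ⟨i₀, hi₀⟩ := Level.mem_nhds_iff.1 hU
        obtain ⟨M, hM⟩ := ω.exists_wtr_eq
        obtain ⟨i, hi⟩ : ∃ i, i₀ ≤ i ∧ M ≤ i ∧ mark (k + 1) < i :=
          ⟨i₀ + M + mark (k + 1) + 1, by omega, by omega, by omega⟩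
        rw [nhds_prod_eq, nhds_discrete ℕ]
        filter_upwards [Filter.prod_mem_prod ((ω.proj k).eventually_wtr_eq i)
          (Filter.mem_pure.2 (mem_singleton _))]
        rintro ⟨v, m⟩ ⟨hv, rfl⟩
        obtain ⟨ω', h1, h2⟩ := ω.exists_lift (hM i hi.2.1) v hv
        refine ⟨ω', hi₀ ω' ?_, Prod.ext h1 ?_⟩
        · rw [← wtr_wtr hi.1, h2, wtr_wtr hi.1]
        · change wsize (k + 1) ω'.1 = wsize (k + 1) ω.1
          rw [← wsize_wtr hi.2.2, h2, wsize_wtr hi.2.2]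
      exists_ne := fun ω U hU => by
        obtain ⟨j, hj, γ, h1, h2, h3⟩ := ω.exists_update hU
        refine ⟨_, h1, h2, Prod.ext (Subtype.ext ?_) h3⟩
        change (⟨rows k (Function.update ω.1.base j γ), _⟩ : Word) = ⟨_, _⟩
        rw [rows_update (by omega)]
        rfl }

end ErdosModel

namespace ErdosModel

/-- The points visited by a word. -/
def pts : Arr → List Arr → Set Arr
  | x, [] => {x}
  | x, d :: w => insert x (pts (x + d) w)

@[simp] lemma pts_nil (x : Arr) : pts x [] = {x} := rfl

@[simp] lemma pts_cons (x d : Arr) (w : List Arr) : pts x (d :: w) = insert x (pts (x + d) w) := rfl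

lemma self_mem_pts (x : Arr) (w : List Arr) : x ∈ pts x w := by
  cases w <;> simp

lemma finite_pts (x : Arr) (w : List Arr) : (pts x w).Finite := by
  induction w generalizing x with
  | nil => exact finite_singleton x
  | cons d w ih => exact (ih _).insert x

lemma ncard_pts_le (x : Arr) (w : List Arr) : (pts x w).ncard ≤ w.length + 1 := by
  induction w generalizing x with
  | nil => simp
  | cons d w ih =>
    exact (ncard_insert_le _ _).trans (Nat.succ_le_succ (ih _))

lemma eq_or_pos_of_mem_pts {x z : Arr} {w : List Arr} (hw : ∀ d ∈ w, Pos d) (hz : z ∈ pts x w) :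
    z = x ∨ Pos (z - x) := by
  induction w generalizing x with
  | nil => exact Or.inl hz
  | cons d w ih =>
    obtain ⟨hd, hw⟩ := List.forall_mem_cons.1 hw
    rcases hz with rfl | hz
    · exact Or.inl rfl
    · right
      rcases ih hw hz with rfl | h
      · rwa [add_sub_cancel_left]
      · have := h.add hd
        rwa [sub_add_eq_sub_sub, sub_add_cancel] at this

lemma notMem_pts_add {x d : Arr} {w : List Arr} (hd : Pos d) (hw : ∀ d ∈ w, Pos d) :
    x ∉ pts (x + d) w := fun h => by
  rcases eq_or_pos_of_mem_pts hw h with h | h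
  · exact hd.ne_zero (by simpa using h)
  · exact hd.not_neg (by simpa using h)

lemma pts_injective {x x' : Arr} {w w' : List Arr} (hw : ∀ d ∈ w, Pos d) (hw' : ∀ d ∈ w', Pos d)
    (h : pts x w = pts x' w') : x = x' ∧ w = w' := by
  have hbase : ∀ {x x' w w'}, (∀ d ∈ w, Pos d) → (∀ d ∈ w', Pos d) →
      pts x w = pts x' w' → x = x' := by
    intro x x' w w' hw hw' h
    rcases eq_or_pos_of_mem_pts hw' (h ▸ self_mem_pts x w) with h1 | h1
    · exact h1
    rcases eq_or_pos_of_mem_pts hw (h ▸ self_mem_pts x' w') with h2 | h2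
    · exact h2.symm
    exact absurd (neg_sub x' x ▸ h1) h2.not_neg
  obtain rfl := hbase hw hw' h
  refine ⟨rfl, ?_⟩
  induction w generalizing w' x with
  | nil =>
    cases w' with
    | nil => rfl
    | cons d' w' =>
      obtain ⟨hd', hw'⟩ := List.forall_mem_cons.1 hw'
      have hmem : x + d' ∈ pts x [] := by
        rw [h]
        exact Or.inr (self_mem_pts _ _)
      exact absurd (by simpa using hmem) hd'.ne_zero
  | cons d w ih =>
    obtain ⟨hd, hw⟩ := List.forall_mem_cons.1 hw
    cases w' with
    | nil =>
      have hmem : x + d ∈ pts x [] := by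
        rw [← h]
        exact Or.inr (self_mem_pts _ _)
      exact absurd (by simpa using hmem) hd.ne_zero
    | cons d' w' =>
      obtain ⟨hd', ht⟩ := List.forall_mem_cons.1 hw'
      have h' : pts (x + d) w = pts (x + d') w' := by
        have := congrArg (· \ {x}) h
        simpa [insert_sdiff_of_mem, sdiff_singleton_eq_self (notMem_pts_add hd hw),
          sdiff_singleton_eq_self (notMem_pts_add hd' ht)] using this
      obtain rfl : d = d' := add_left_cancel (hbase hw ht h')
      rw [ih hw ht h']

lemma exists_pts_eq (S : Finset Arr) (hS : S.Nonempty) :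
    ∃ x w, (∀ d ∈ w, Pos d) ∧ pts x w = S ∧ w.length + 1 = S.card := by
  classical
  induction hc : S.card generalizing S with
  | zero => exact absurd (Finset.card_eq_zero.1 hc) hS.ne_empty
  | succ c ih =>
    obtain ⟨x, hx, hmin⟩ := S.exists_min_image toLex hS
    rcases (S.erase x).eq_empty_or_nonempty with h0 | hne
    · have hSx : S = {x} := by rw [← Finset.insert_erase hx, h0]; rfl
      refine ⟨x, [], by simp, by simp [hSx], ?_⟩
      rw [← hc, hSx]
      rfl
    · obtain ⟨y, w, hw, hp, hl⟩ := ih (S.erase x) hne (by rw [Finset.card_erase_of_mem hx, hc]; rfl)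
      refine ⟨x, (y - x) :: w, List.forall_mem_cons.2 ⟨?_, hw⟩, ?_, by rw [List.length_cons, hl]⟩
      · have hy : y ∈ S.erase x := by
          rw [← Finset.mem_coe, ← hp]
          exact self_mem_pts y w
        have hlt : toLex x < toLex y := (hmin y (Finset.mem_of_mem_erase hy)).lt_of_ne
          fun h => Finset.ne_of_mem_erase hy (toLex.injective h).symm
        exact sub_pos.2 hlt
      · rw [pts_cons, add_sub_cancel, hp, ← Finset.coe_insert, Finset.insert_erase hx]

lemma pts_ltr (i : ℕ) (x : Arr) (w : List Arr) : pts (tr i x) (ltr i w) = tr i '' pts x w := by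
  induction w generalizing x with
  | nil => simp
  | cons d w ih =>
    rw [pts_cons, image_insert_eq, ← ih, map_add]
    by_cases h : tr i d = 0
    · rw [ltr_cons_of_eq h, h, add_zero, insert_eq_of_mem (self_mem_pts _ _)]
    · rw [ltr_cons_of_ne h, pts_cons]

lemma pos_of_mem_ltr {i : ℕ} {w : List Arr} (hw : ∀ d ∈ w, Pos d) : ∀ d ∈ ltr i w, Pos d := by
  intro d hd
  rw [ltr, List.mem_filter, List.mem_map] at hd
  obtain ⟨⟨e, he, rfl⟩, h0⟩ := hd
  exact (hw e he).tr i (by simpa using h0)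

lemma forall_mem_pts_good {x : Arr} {w : List Arr} :
    (∀ z ∈ pts x w, z ∈ good) ↔ x ∈ good ∧ ∀ d ∈ w, d ∈ good := by
  induction w generalizing x with
  | nil => simp
  | cons d w ih =>
    rw [pts_cons, forall_mem_insert, ih, List.forall_mem_cons]
    refine and_congr_right fun hx => and_congr_left fun _ => ?_
    exact AddSubgroup.add_mem_cancel_left good hx

end ErdosModel

namespace ErdosModel

/-- The total weight of a list of increments. -/
def lwt (w : List Arr) : ℝ := (w.map wt).sum

/-- The total weight of the part of a list of increments beyond `i`. -/
def ltail (i : ℕ) (w : List Arr) : ℝ := (w.map fun d => wt (d - tr i d)).sum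

/-- The total weight of a word. -/
def wwt (ω : Word) : ℝ := wt ω.base + lwt ω.steps

@[simp] lemma lwt_nil : lwt [] = 0 := rfl

@[simp] lemma lwt_cons (d : Arr) (w : List Arr) : lwt (d :: w) = wt d + lwt w := by simp [lwt]

@[simp] lemma ltail_nil (i : ℕ) : ltail i [] = 0 := rfl

@[simp] lemma ltail_cons (i : ℕ) (d : Arr) (w : List Arr) :
    ltail i (d :: w) = wt (d - tr i d) + ltail i w := by simp [ltail]

lemma tendsto_ltail {w : List Arr} (hw : ∀ d ∈ w, d ∈ good) :
    Filter.Tendsto (fun i => ltail i w) Filter.atTop (𝓝 0) := by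
  induction w with
  | nil => exact tendsto_const_nhds
  | cons d w ih =>
    obtain ⟨hd, hw⟩ := List.forall_mem_cons.1 hw
    simpa using (tendsto_wt_sub_tr hd).add (ih hw)

/-- Words with a common truncation whose corresponding points are close have almost the same
weight. -/
lemma abs_lwt_sub_lwt_le {i : ℕ} {ε : ℝ} {x x₀ : Arr} {w w₀ : List Arr} (hx : x ∈ good)
    (hx₀ : x₀ ∈ good) (hw : ∀ d ∈ w, d ∈ good) (hw₀ : ∀ d ∈ w₀, d ∈ good)
    (htr : tr i x = tr i x₀) (hltr : ltr i w = w₀.map (tr i))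
    (hε : ∀ z ∈ pts x w, ∀ y ∈ pts x₀ w₀, tr i z = tr i y → wt (z - y) ≤ ε) :
    |lwt w - lwt w₀| ≤ 2 * ε * w.length := by
  induction w generalizing x x₀ w₀ with
  | nil =>
    rw [ltr_nil] at hltr
    simp [List.map_eq_nil_iff.1 hltr.symm]
  | cons d w ih =>
    obtain ⟨hd, ht⟩ := List.forall_mem_cons.1 hw
    have h0 := hε x (self_mem_pts _ _) x₀ (self_mem_pts _ _) htr
    by_cases hdi : tr i d = 0
    · rw [ltr_cons_of_eq hdi] at hltr
      have htr' : tr i (x + d) = tr i x₀ := by rw [map_add, hdi, add_zero, htr]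
      have h1 := hε (x + d) (Or.inr (self_mem_pts _ _)) x₀ (self_mem_pts _ _) htr'
      have h2 := wt_sub_le (good.sub_mem (good.add_mem hx hd) hx₀) (good.sub_mem hx hx₀)
      rw [show x + d - x₀ - (x - x₀) = d by abel] at h2
      have h3 := abs_le.1 (ih (good.add_mem hx hd) hx₀ ht hw₀ htr' hltr
        fun z hz => hε z (Or.inr hz))
      have h4 := wt_nonneg d
      rw [abs_le, lwt_cons, List.length_cons]
      push_cast
      constructor <;> linarith
    · rw [ltr_cons_of_ne hdi] at hltr
      cases w₀ with
      | nil => simp at hltr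
      | cons d₀ w₀ =>
        obtain ⟨hd₀, ht₀⟩ := List.forall_mem_cons.1 hw₀
        rw [List.map_cons, List.cons.injEq] at hltr
        have htr' : tr i (x + d) = tr i (x₀ + d₀) := by rw [map_add, map_add, htr, hltr.1]
        have h1 := hε (x + d) (Or.inr (self_mem_pts _ _)) (x₀ + d₀) (Or.inr (self_mem_pts _ _)) htr'
        have h2 := wt_sub_le (good.sub_mem (good.add_mem hx hd) (good.add_mem hx₀ hd₀))
          (good.sub_mem hx hx₀)
        rw [show x + d - (x₀ + d₀) - (x - x₀) = d - d₀ by abel] at h2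
        have h3 := abs_le.1 (ih (good.add_mem hx hd) (good.add_mem hx₀ hd₀) ht ht₀ htr' hltr.2
          fun z hz y hy => hε z (Or.inr hz) y (Or.inr hy))
        have h4 := abs_le.1 (abs_wt_sub_wt_le hd hd₀)
        rw [abs_le, lwt_cons, lwt_cons, List.length_cons]
        push_cast
        constructor <;> linarith

/-- Words with a common truncation and almost the same weight visit points that are close. -/
lemma pts_close {i : ℕ} {x x₀ : Arr} {w w₀ : List Arr} (hx : x ∈ good)
    (hx₀ : x₀ ∈ good) (hw : ∀ d ∈ w, d ∈ good) (hw₀ : ∀ d ∈ w₀, d ∈ good)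
    (htr : tr i x = tr i x₀) (hltr : ltr i w = w₀.map (tr i)) :
    0 ≤ lwt w - lwt w₀ + 2 * ltail i w₀ ∧
    (∀ z ∈ pts x w, ∃ y ∈ pts x₀ w₀, tr i z = tr i y ∧
      wt (z - y) ≤ wt (x - x₀) + (lwt w - lwt w₀ + 2 * ltail i w₀)) ∧
    ∀ y ∈ pts x₀ w₀, ∃ z ∈ pts x w, tr i z = tr i y ∧
      wt (z - y) ≤ wt (x - x₀) + (lwt w - lwt w₀ + 2 * ltail i w₀) := by
  induction w generalizing x x₀ w₀ with
  | nil =>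
    rw [ltr_nil] at hltr
    simp [List.map_eq_nil_iff.1 hltr.symm, htr]
  | cons d w ih =>
    obtain ⟨hd, ht⟩ := List.forall_mem_cons.1 hw
    by_cases hdi : tr i d = 0
    · rw [ltr_cons_of_eq hdi] at hltr
      have htr' : tr i (x + d) = tr i x₀ := by rw [map_add, hdi, add_zero, htr]
      obtain ⟨h1, h2, h3⟩ := ih (good.add_mem hx hd) hx₀ ht hw₀ htr' hltr
      have h4 := wt_add_le (good.sub_mem hx hx₀) hd
      rw [show x - x₀ + d = x + d - x₀ by abel] at h4
      have h5 := wt_nonneg d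
      rw [lwt_cons]
      refine ⟨by linarith, ?_, fun y hy => ?_⟩
      · rintro z (rfl | hz)
        · exact ⟨x₀, self_mem_pts _ _, htr, by linarith⟩
        · obtain ⟨y, hy, hzy, hle⟩ := h2 z hz
          exact ⟨y, hy, hzy, by linarith⟩
      · obtain ⟨z, hz, hzy, hle⟩ := h3 y hy
        exact ⟨z, Or.inr hz, hzy, by linarith⟩
    · rw [ltr_cons_of_ne hdi] at hltr
      cases w₀ with
      | nil => simp at hltr
      | cons d₀ w₀ =>
        obtain ⟨hd₀, ht₀⟩ := List.forall_mem_cons.1 hw₀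
        rw [List.map_cons, List.cons.injEq] at hltr
        have htr' : tr i (x + d) = tr i (x₀ + d₀) := by rw [map_add, map_add, htr, hltr.1]
        obtain ⟨h1, h2, h3⟩ := ih (good.add_mem hx hd) (good.add_mem hx₀ hd₀) ht ht₀ htr' hltr.2
        have h4 := wt_add_le (good.sub_mem hx hx₀) (good.sub_mem hd hd₀)
        rw [show x - x₀ + (d - d₀) = x + d - (x₀ + d₀) by abel] at h4
        have h5 := wt_sub_le_of_tr_eq hd hd₀ hltr.1
        have h6 := wt_nonneg (d - d₀)
        rw [lwt_cons, lwt_cons, ltail_cons]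
        refine ⟨by linarith, ?_, ?_⟩
        · rintro z (rfl | hz)
          · exact ⟨x₀, self_mem_pts _ _, htr, by linarith⟩
          · obtain ⟨y, hy, hzy, hle⟩ := h2 z hz
            exact ⟨y, Or.inr hy, hzy, by linarith⟩
        · rintro y (rfl | hy)
          · exact ⟨x, self_mem_pts _ _, htr, by linarith⟩
          · obtain ⟨z, hz, hzy, hle⟩ := h3 y hy
            exact ⟨z, Or.inr hz, hzy, by linarith⟩

lemma eventually_tr_ne_zero {d : Arr} (hd : d ≠ 0) : ∀ᶠ i in Filter.atTop, tr i d ≠ 0 := by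
  obtain ⟨j, hj⟩ := Function.ne_iff.1 hd
  filter_upwards [Filter.eventually_gt_atTop j] with i hi h
  exact hj (by rw [← tr_apply_of_lt hi d, h])

lemma eventually_ltr_eq_map {w : List Arr} (hw : ∀ d ∈ w, Pos d) :
    ∀ᶠ i in Filter.atTop, ltr i w = w.map (tr i) := by
  induction w with
  | nil => exact Filter.Eventually.of_forall fun _ => rfl
  | cons d w ih =>
    obtain ⟨hd, hw⟩ := List.forall_mem_cons.1 hw
    filter_upwards [eventually_tr_ne_zero hd.ne_zero, ih hw] with i h1 h2
    rw [ltr_cons_of_ne h1, h2, List.map_cons]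

end ErdosModel

namespace ErdosModel

open Filter

lemma mem_comap_nhds_iff {E : Type*} {g : E → ℕ → Word} {u : E → ℝ}
    (hg : ∀ x i j, i ≤ j → wtr i (g x j) = g x i) {y : E} {U : Set E} :
    U ∈ comap (fun x => (g x, u x)) (𝓝 (g y, u y)) ↔
      ∃ i, ∃ ε > 0, ∀ z, g z i = g y i → |u z - u y| < ε → z ∈ U := by
  constructor
  · intro h
    rw [mem_comap, nhds_prod_eq] at h
    obtain ⟨T, hT, hTU⟩ := h
    obtain ⟨V, hV, W, hW, hVW⟩ := mem_prod_iff.1 hT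
    obtain ⟨_, ⟨f, i, rfl⟩, hf, hfV⟩ :=
      (PiNat.isTopologicalBasis_cylinders fun _ => Word).mem_nhds_iff.1 hV
    obtain ⟨ε, hε, hεW⟩ := Metric.mem_nhds_iff.1 hW
    refine ⟨i, ε, hε, fun z h1 h2 => hTU (hVW ⟨hfV fun j hj => ?_, hεW h2⟩)⟩
    change g z j = f j
    rw [← hg z j i hj.le, h1, hg y j i hj.le]
    exact hf j hj
  · rintro ⟨i, ε, hε, h⟩
    have h1 : ∀ᶠ f in 𝓝 (g y), f i = g y i :=
      (continuous_apply i).continuousAt.eventually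
        ((isOpen_discrete {g y i}).mem_nhds rfl)
    have h2 : ∀ᶠ t in 𝓝 (u y), |t - u y| < ε := Metric.ball_mem_nhds _ hε
    filter_upwards [tendsto_comap.eventually (h1.prod_nhds h2)] with z hz
    exact h z hz.1 hz.2

/-- A model of Erdős space. -/
structure Model where
  arr : Arr
  mem : arr ∈ good

namespace Model

lemma arr_injective : Function.Injective arr := fun ⟨_, _⟩ ⟨_, _⟩ h => by
  cases h
  rfl

instance : TopologicalSpace Model :=
  TopologicalSpace.induced (fun z => (fun i => (⟨tr i z.1, []⟩ : Word), wt z.1)) inferInstance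

lemma mem_nhds_iff {y : Model} {U : Set Model} :
    U ∈ 𝓝 y ↔ ∃ i, ∃ ε > 0, ∀ z : Model, tr i z.1 = tr i y.1 → wt (z.1 - y.1) < ε → z ∈ U := by
  rw [nhds_induced, mem_comap_nhds_iff (g := fun (z : Model) i => (⟨tr i z.1, []⟩ : Word))
    fun z i j hij => by simp only [wtr, tr_tr hij, ltr_nil]]
  simp only [Word.mk.injEq, and_true]
  constructor
  · rintro ⟨i, ε, hε, h⟩
    exact ⟨i, ε, hε, fun z h1 h2 => h z h1 ((abs_wt_sub_wt_le z.2 y.2).trans_lt h2)⟩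
  · rintro ⟨i, ε, hε, h⟩
    obtain ⟨j, hij, hj⟩ : ∃ j, i ≤ j ∧ wt (y.1 - tr j y.1) < ε / 4 :=
      ((eventually_ge_atTop i).and
        ((tendsto_wt_sub_tr y.2).eventually (gt_mem_nhds (by positivity)))).exists
    refine ⟨j, ε / 2, by positivity, fun z h1 h2 => h z ?_ ?_⟩
    · rw [← tr_tr hij, h1, tr_tr hij]
    · have := wt_sub_le_of_tr_eq z.2 y.2 h1
      linarith [(abs_lt.1 h2).2]

lemma eventually_forall_mem {y : Model} {U : Set Model} (hU : U ∈ 𝓝 y) :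
    ∀ᶠ i : ℕ in atTop, ∀ z : Model, tr i z.1 = tr i y.1 →
      wt (z.1 - y.1) < 1 / ((i : ℝ) + 1) → z ∈ U := by
  obtain ⟨i, ε, hε, h⟩ := mem_nhds_iff.1 hU
  filter_upwards [eventually_ge_atTop i,
    tendsto_one_div_add_atTop_nhds_zero_nat.eventually (gt_mem_nhds hε)] with j hj hjε z h1 h2
  exact h z (by rw [← tr_tr hj, h1, tr_tr hj]) (h2.trans hjε)

end Model

section Vietoris

variable {n : ℕ} {X : Type*} [TopologicalSpace X]

lemma eventually_hypFn_subset {F₀ : HypFn n X} {U : Set X} (hU : ∀ y ∈ F₀.1, U ∈ 𝓝 y) :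
    ∀ᶠ F in 𝓝 F₀, F.1 ⊆ U := by
  have hsub : F₀.1 ⊆ interior U := fun y hy => mem_interior_iff_mem_nhds.2 (hU y hy)
  have ho : IsOpen {F : HypFn n X | F.1 ⊆ interior U} :=
    isOpen_induced (t := VietorisTop _) (TopologicalSpace.isOpen_generateFrom_of_mem
      (Or.inl ⟨interior U, isOpen_interior, F₀.2.1.mono hsub, rfl⟩))
  filter_upwards [ho.mem_nhds hsub] with F hF using hF.trans interior_subset

lemma eventually_hypFn_inter {F₀ : HypFn n X} {U : Set X} {y : X} (hy : y ∈ F₀.1) (hU : U ∈ 𝓝 y) :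
    ∀ᶠ F in 𝓝 F₀, (F.1 ∩ U).Nonempty := by
  have hyU : y ∈ interior U := mem_interior_iff_mem_nhds.2 hU
  have ho : IsOpen {F : HypFn n X | (F.1 ∩ interior U).Nonempty} :=
    isOpen_induced (t := VietorisTop _) (TopologicalSpace.isOpen_generateFrom_of_mem
      (Or.inr ⟨interior U, isOpen_interior, ⟨y, hyU⟩, rfl⟩))
  filter_upwards [ho.mem_nhds ⟨y, hy, hyU⟩] with F hF
  exact hF.mono (inter_subset_inter_right _ interior_subset)

lemma le_nhds_hypFn {F₀ : HypFn n X} {l : Filter (HypFn n X)}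
    (h1 : ∀ U : Set X, (∀ y ∈ F₀.1, U ∈ 𝓝 y) → ∀ᶠ F in l, F.1 ⊆ U)
    (h2 : ∀ U : Set X, ∀ y ∈ F₀.1, U ∈ 𝓝 y → ∀ᶠ F in l, (F.1 ∩ U).Nonempty) :
    l ≤ 𝓝 F₀ := by
  rw [@nhds_induced _ _ (VietorisTop _), ← tendsto_iff_comap, VietorisTop,
    TopologicalSpace.tendsto_nhds_generateFrom_iff]
  rintro S (⟨U, hU, -, rfl⟩ | ⟨U, hU, -, rfl⟩) hF
  · exact h1 U fun y hy => hU.mem_nhds (hF hy)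
  · obtain ⟨y, hy, hyU⟩ := hF
    exact h2 U y hy (hU.mem_nhds hyU)

end Vietoris

variable {n : ℕ}

lemma exists_word (F : HypFn n Model) : ∃ ω : Word, (∀ d ∈ ω.steps, Pos d) ∧
    pts ω.base ω.steps = Model.arr '' F.1 ∧ ω.steps.length < n := by
  obtain ⟨F, hne, hfin, hcard⟩ := F
  have hfin' : (Model.arr '' F : Set Arr).Finite := hfin.image _
  obtain ⟨x, w, hw, hp, hl⟩ := exists_pts_eq hfin'.toFinset (by simpa using hne)
  refine ⟨⟨x, w⟩, hw, by simpa using hp, ?_⟩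
  rw [← ncard_eq_toFinset_card _ hfin', ncard_image_of_injective _ Model.arr_injective] at hl
  change w.length < n
  omega

/-- The word visiting the points of a finite set in increasing order. -/
def word (F : HypFn n Model) : Word := (exists_word F).choose

lemma pos_word (F : HypFn n Model) : ∀ d ∈ (word F).steps, Pos d := (exists_word F).choose_spec.1

lemma pts_word (F : HypFn n Model) : pts (word F).base (word F).steps = Model.arr '' F.1 :=
  (exists_word F).choose_spec.2.1

lemma length_word (F : HypFn n Model) : (word F).steps.length < n :=
  (exists_word F).choose_spec.2.2

lemma good_word (F : HypFn n Model) :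
    (word F).base ∈ good ∧ ∀ d ∈ (word F).steps, d ∈ good := by
  rw [← forall_mem_pts_good, pts_word]
  rintro _ ⟨z, -, rfl⟩
  exact z.2

lemma word_injective : Function.Injective (word (n := n)) := fun F F' h => by
  have := pts_word F
  rw [h, pts_word F'] at this
  exact Subtype.ext (Model.arr_injective.image_injective this).symm

lemma exists_word_eq {ω : Word} (hpos : ∀ d ∈ ω.steps, Pos d) (hbase : ω.base ∈ good)
    (hgood : ∀ d ∈ ω.steps, d ∈ good) (hlen : ω.steps.length < n) :
    ∃ F : HypFn n Model, word F = ω := by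
  have hg := forall_mem_pts_good.2 ⟨hbase, hgood⟩
  have himg : Model.arr '' (Model.arr ⁻¹' pts ω.base ω.steps : Set Model) =
      pts ω.base ω.steps := by
    rw [image_preimage_eq_inter_range, inter_eq_left]
    exact fun z hz => ⟨⟨z, hg z hz⟩, rfl⟩
  let F : HypFn n Model := ⟨Model.arr ⁻¹' pts ω.base ω.steps,
    ⟨⟨_, hbase⟩, self_mem_pts _ _⟩,
    (finite_pts _ _).preimage Model.arr_injective.injOn, by
      rw [← ncard_image_of_injective _ Model.arr_injective, himg]
      exact (ncard_pts_le _ _).trans hlen⟩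
  obtain ⟨h1, h2⟩ := pts_injective (pos_word F) hpos ((pts_word F).trans himg)
  refine ⟨F, ?_⟩
  rcases hω : word F with ⟨x, w⟩
  rw [hω] at h1 h2
  cases h1
  cases h2
  rfl

lemma wtr_word_eq {i : ℕ} {F F' : HypFn n Model}
    (h : tr i '' (Model.arr '' F.1) = tr i '' (Model.arr '' F'.1)) :
    wtr i (word F) = wtr i (word F') := by
  rw [← pts_word, ← pts_word, ← pts_ltr, ← pts_ltr] at h
  obtain ⟨h1, h2⟩ := pts_injective (pos_of_mem_ltr (pos_word F)) (pos_of_mem_ltr (pos_word F')) h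
  simp only [wtr, h1, h2]

lemma eventually_injOn_tr {S : Set Arr} (hS : S.Finite) : ∀ᶠ i in atTop, InjOn (tr i) S := by
  have : ∀ᶠ i in atTop, ∀ y ∈ S, ∀ z ∈ S, y - z ≠ 0 → tr i (y - z) ≠ 0 :=
    (eventually_all_finite hS).2 fun y _ => (eventually_all_finite hS).2 fun z _ => by
      by_cases h : y - z = 0
      · exact Eventually.of_forall fun _ h' => absurd h h'
      · exact (eventually_tr_ne_zero h).mono fun _ h' _ => h'
  filter_upwards [this] with i hi y hy z hz hyz
  by_contra hne
  exact hi y hy z hz (sub_ne_zero.2 hne) (by rw [map_sub, hyz, sub_self])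

lemma eventually_word_close (F₀ : HypFn n Model) (i : ℕ) {ε : ℝ} (hε : 0 < ε) :
    ∀ᶠ F in 𝓝 F₀, wtr i (word F) = wtr i (word F₀) ∧ |wwt (word F) - wwt (word F₀)| < ε := by
  obtain ⟨j, hij, hinj, hltr⟩ := ((eventually_ge_atTop i).and
    ((eventually_injOn_tr (F₀.2.2.1.image Model.arr)).and
      (eventually_ltr_eq_map (pos_word F₀)))).exists
  set δ : ℝ := ε / (2 * n + 2) with hδ
  have hδ0 : 0 < δ := by positivity
  let V : Model → Set Model := fun y => {z | tr j z.1 = tr j y.1 ∧ wt (z.1 - y.1) < δ}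
  have hV : ∀ y, V y ∈ 𝓝 y := fun y => Model.mem_nhds_iff.2 ⟨j, δ, hδ0, fun z h1 h2 => ⟨h1, h2⟩⟩
  have hsub := eventually_hypFn_subset (F₀ := F₀) (U := ⋃ y ∈ F₀.1, V y) fun y hy =>
    mem_of_superset (hV y) (subset_biUnion_of_mem hy)
  have hmeet : ∀ᶠ F in 𝓝 F₀, ∀ y ∈ F₀.1, (F.1 ∩ V y).Nonempty :=
    (eventually_all_finite F₀.2.2.1).2 fun y hy => eventually_hypFn_inter hy (hV y)
  filter_upwards [hsub, hmeet] with F h1 h2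
  have hwtr : wtr j (word F) = wtr j (word F₀) := by
    refine wtr_word_eq (subset_antisymm ?_ ?_)
    · rintro _ ⟨_, ⟨z, hz, rfl⟩, rfl⟩
      obtain ⟨y, hy, hzy⟩ := mem_iUnion₂.1 (h1 hz)
      exact ⟨_, ⟨y, hy, rfl⟩, hzy.1.symm⟩
    · rintro _ ⟨_, ⟨y, hy, rfl⟩, rfl⟩
      obtain ⟨z, hz, hzy⟩ := h2 y hy
      exact ⟨_, ⟨z, hz, rfl⟩, hzy.1⟩
  have hclose : ∀ z ∈ pts (word F).base (word F).steps, ∀ y ∈ pts (word F₀).base (word F₀).steps,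
      tr j z = tr j y → wt (z - y) ≤ δ := by
    rw [pts_word, pts_word]
    rintro _ ⟨z, hz, rfl⟩ _ ⟨y, hy, rfl⟩ hzy
    obtain ⟨y', hy', hzy'⟩ := mem_iUnion₂.1 (h1 hz)
    rw [hinj (mem_image_of_mem _ hy) (mem_image_of_mem _ hy') (hzy.symm.trans hzy'.1)]
    exact hzy'.2.le
  obtain ⟨hg, hgs⟩ := good_word F
  obtain ⟨hg₀, hgs₀⟩ := good_word F₀
  have hbase : tr j (word F).base = tr j (word F₀).base := congrArg Word.base hwtr
  refine ⟨by rw [← wtr_wtr hij, hwtr, wtr_wtr hij], ?_⟩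
  have h3 := (abs_wt_sub_wt_le hg hg₀).trans
    (hclose _ (self_mem_pts _ _) _ (self_mem_pts _ _) hbase)
  have h4 := abs_lwt_sub_lwt_le hg hg₀ hgs hgs₀ hbase
    ((congrArg Word.steps hwtr).trans hltr) hclose
  have h5 : ((word F).steps.length : ℝ) ≤ n := by exact_mod_cast (length_word F).le
  have h6 : δ * (2 * n + 2) = ε := div_mul_cancel₀ _ (by positivity)
  have h7 : 2 * δ * (word F).steps.length ≤ 2 * δ * n := by gcongr
  simp only [wwt]
  rw [abs_le] at h3 h4
  rw [abs_lt]
  constructor <;> linarith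

lemma eventually_close_of_word (F₀ : HypFn n Model) (m : ℕ) {ε : ℝ} (hε : 0 < ε) :
    ∃ i, ∃ δ > 0, ∀ F : HypFn n Model, wtr i (word F) = wtr i (word F₀) →
      |wwt (word F) - wwt (word F₀)| < δ →
      (∀ z ∈ F.1, ∃ y ∈ F₀.1, tr m z.1 = tr m y.1 ∧ wt (z.1 - y.1) < ε) ∧
      ∀ y ∈ F₀.1, ∃ z ∈ F.1, tr m z.1 = tr m y.1 ∧ wt (z.1 - y.1) < ε := by
  obtain ⟨hg₀, hgs₀⟩ := good_word F₀
  have hε8 : 0 < ε / 8 := by positivity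
  obtain ⟨i, hmi, hltr, h1, h2⟩ := ((eventually_ge_atTop m).and
    ((eventually_ltr_eq_map (pos_word F₀)).and
      (((tendsto_wt_sub_tr hg₀).eventually (gt_mem_nhds hε8)).and
        ((tendsto_ltail hgs₀).eventually (gt_mem_nhds hε8))))).exists
  refine ⟨i, ε / 2, by positivity, fun F hwtr hwt => ?_⟩
  obtain ⟨hg, hgs⟩ := good_word F
  have hbase : tr i (word F).base = tr i (word F₀).base := congrArg Word.base hwtr
  obtain ⟨-, h3, h4⟩ := pts_close hg hg₀ hgs hgs₀ hbase
    ((congrArg Word.steps hwtr).trans hltr)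
  have h5 := wt_sub_le_of_tr_eq hg hg₀ hbase
  have h6 := (abs_lt.1 hwt).2
  simp only [wwt] at h6
  rw [pts_word, pts_word] at h3 h4
  constructor
  · intro z hz
    obtain ⟨_, ⟨y, hy, rfl⟩, hzy, hle⟩ := h3 z.1 ⟨z, hz, rfl⟩
    exact ⟨y, hy, by rw [← tr_tr hmi, hzy, tr_tr hmi], by linarith⟩
  · intro y hy
    obtain ⟨_, ⟨z, hz, rfl⟩, hzy, hle⟩ := h4 y.1 ⟨y, hy, rfl⟩
    exact ⟨z, hz, by rw [← tr_tr hmi, hzy, tr_tr hmi], by linarith⟩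

lemma isInducing_word :
    IsInducing fun F : HypFn n Model => ((fun i => wtr i (word F)), wwt (word F)) := by
  have hg : ∀ (F : HypFn n Model) i j, i ≤ j → wtr i (wtr j (word F)) = wtr i (word F) :=
    fun F i j hij => wtr_wtr hij _
  refine isInducing_iff_nhds.2 fun F₀ => le_antisymm (fun U hU => ?_) ?_
  · obtain ⟨i, ε, hε, h⟩ := (mem_comap_nhds_iff (g := fun F i => wtr i (word F))
      (u := fun F => wwt (word F)) hg).1 hU
    exact (eventually_word_close F₀ i hε).mono fun F hF => h F hF.1 hF.2
  · have key : ∀ (m : ℕ) {ε : ℝ}, 0 < ε →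
        ∀ᶠ F in comap (fun F : HypFn n Model => ((fun i => wtr i (word F)), wwt (word F)))
          (𝓝 ((fun i => wtr i (word F₀)), wwt (word F₀))),
          (∀ z ∈ F.1, ∃ y ∈ F₀.1, tr m z.1 = tr m y.1 ∧ wt (z.1 - y.1) < ε) ∧
          ∀ y ∈ F₀.1, ∃ z ∈ F.1, tr m z.1 = tr m y.1 ∧ wt (z.1 - y.1) < ε := fun m ε hε =>
      (mem_comap_nhds_iff (g := fun F i => wtr i (word F)) (u := fun F => wwt (word F)) hg).2
        (eventually_close_of_word F₀ m hε)
    refine le_nhds_hypFn (fun U hU => ?_) fun U y hy hU => ?_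
    · obtain ⟨m, hm⟩ := ((eventually_all_finite F₀.2.2.1).2 fun y hy =>
        Model.eventually_forall_mem (hU y hy)).exists
      filter_upwards [key m Nat.one_div_pos_of_nat] with F hF z hz
      obtain ⟨y, hy, h1, h2⟩ := hF.1 z hz
      exact hm y hy z h1 h2
    · obtain ⟨m, hm⟩ := (Model.eventually_forall_mem hU).exists
      filter_upwards [key m Nat.one_div_pos_of_nat] with F hF
      obtain ⟨z, hz, h1, h2⟩ := hF.2 y hy
      exact ⟨z, hz, hm z h1 h2⟩

end ErdosModel

namespace ErdosModel

variable {n : ℕ}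

lemma hasSum_wwt {ω : Word} (hbase : ω.base ∈ good) (hsteps : ∀ d ∈ ω.steps, d ∈ good) :
    HasSum (fun k => (2⁻¹ : ℝ) ^ k * wsize k ω) (wwt ω) := by
  obtain ⟨x, w⟩ := ω
  simp only [wsize, wwt, Nat.cast_add, mul_add]
  refine hbase.2.hasSum.add ?_
  induction w with
  | nil => simp
  | cons d w ih =>
    obtain ⟨hd, hw⟩ := List.forall_mem_cons.1 hsteps
    simp only [List.map_cons, List.sum_cons, Nat.cast_add, mul_add, lwt_cons]
    exact hd.2.hasSum.add (ih hbase hw)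

/-- The coordinate of a finite set at level `k` of the tower of words. -/
def levelWord (F : HypFn n Model) (k : ℕ) : Level n k :=
  ⟨wrows k (word F), (good_word F).1.1 k, rows_rows le_rfl _,
    by simpa [wrows] using length_word F, by
      intro d hd
      obtain ⟨e, he, rfl⟩ := List.mem_map.1 hd
      exact ⟨(pos_word F e he).mrows k, finSupp_mrows (((good_word F).2 e he).1 k),
        mrows_mrows le_rfl _⟩⟩

lemma hasSum_levelWord (F : HypFn n Model) :
    HasSum (fun k => (2⁻¹ : ℝ) ^ k * wsize k (levelWord F k).1) (wwt (word F)) := by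
  convert hasSum_wwt (good_word F).1 (good_word F).2 using 4 with k
  exact wsize_wrows k _

lemma arr_ext_mrows {d d' : Arr} (h : ∀ k, mrows k d = mrows k d') : d = d' := by
  funext j
  rw [← mrows_apply_of_le (le_refl (row j)) d, h, mrows_apply_of_le le_rfl]

lemma word_ext_wrows {ω ω' : Word} (h : ∀ k, wrows k ω = wrows k ω') : ω = ω' := by
  obtain ⟨x, w⟩ := ω
  obtain ⟨x', w'⟩ := ω'
  simp only [wrows, Word.mk.injEq] at h
  obtain rfl : x = x' := by
    funext j
    rw [← rows_apply_of_le (le_refl (row j)) x, (h _).1, rows_apply_of_le le_rfl]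
  obtain rfl : w = w' := by
    have hlen : w.length = w'.length := by simpa using congrArg List.length (h 0).2
    refine List.ext_getElem hlen fun m h1 h2 => arr_ext_mrows fun k => ?_
    have := congrArg (·[m]?) (h k).2
    simpa [h1, h2] using this
  rfl

lemma exists_arr_limit (d : ℕ → Arr) (h : ∀ k l, k ≤ l → mrows k (d l) = d k) :
    ∃ e, ∀ k, mrows k e = d k := by
  refine ⟨fun j => d (row j) j, fun k => funext fun j => ?_⟩
  rw [← h k (max j k) (le_max_right _ _)]
  refine mrows_congr fun l hl => ?_
  have hle : row l ≤ max j k := ((row_le l).trans hl).trans (le_max_left _ _)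
  rw [← h (row l) (max j k) hle, mrows_apply_of_le le_rfl]

lemma exists_list_limit (w : ℕ → List Arr) (h : ∀ k l, k ≤ l → (w l).map (mrows k) = w k) :
    ∃ v : List Arr, ∀ k, v.map (mrows k) = w k := by
  induction hm : (w 0).length generalizing w with
  | zero =>
    refine ⟨[], fun k => ?_⟩
    have hk : (w k).length = 0 := by rw [← hm, ← h 0 k (Nat.zero_le k), List.length_map]
    rw [List.length_eq_zero_iff.1 hk, List.map_nil]
  | succ m ih =>
    have hk : ∀ k, ∃ d v, w k = d :: v := fun k => List.exists_cons_of_length_eq_add_one (n := m)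
      (by rw [← hm, ← h 0 k (Nat.zero_le k), List.length_map])
    choose d v hdv using hk
    simp only [hdv, List.map_cons, List.cons.injEq] at h
    obtain ⟨e, he⟩ := exists_arr_limit d fun k l hkl => (h k l hkl).1
    obtain ⟨u, hu⟩ := ih v (fun k l hkl => (h k l hkl).2)
      (by simpa [hdv] using hm)
    exact ⟨e :: u, fun k => by rw [List.map_cons, he, hu, hdv]⟩

lemma exists_word_limit (ω : ℕ → Word) (h : ∀ k, wrows k (ω (k + 1)) = ω k) :
    ∃ ω' : Word, ∀ k, wrows k ω' = ω k := by
  have hself : ∀ k, wrows k (ω k) = ω k := fun k => by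
    conv_lhs => rw [← h k]
    rw [wrows_wrows le_rfl, h]
  have hle : ∀ k l, k ≤ l → wrows k (ω l) = ω k := fun k l hkl => by
    induction l, hkl using Nat.le_induction with
    | base => exact hself k
    | succ l hkl ih => rw [← ih, ← h l, wrows_wrows hkl]
  obtain ⟨v, hv⟩ := exists_list_limit (fun k => (ω k).steps)
    fun k l hkl => congrArg Word.steps (hle k l hkl)
  refine ⟨⟨fun j => (ω (row j)).base j, v⟩, fun k => ?_⟩
  have hb : rows k (fun j => (ω (row j)).base j) = (ω k).base := by
    rw [← congrArg Word.base (hself k)]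
    funext j
    simp only [wrows, rows_apply]
    split_ifs with hj
    · rw [← congrArg Word.base (hle (row j) k hj)]
      exact rows_apply_of_le le_rfl _
    · rfl
  simp only [wrows, hb, hv]

theorem realizes_hypFn (hn : 1 ≤ n) :
    (wordTower n hn).Realizes (HypFn n Model) (levelWord (n := n)) where
  isThread F := ⟨fun k => Subtype.ext (wrows_wrows k.le_succ (word F)),
    (hasSum_levelWord F).summable⟩
  injective F F' h := word_injective
    (word_ext_wrows fun k => congrArg Subtype.val (congrFun h k))
  exists_eq a ha := by
    obtain ⟨hthr, hsum⟩ := ha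
    obtain ⟨ω, hω⟩ := exists_word_limit (fun k => (a k).1)
      fun k => congrArg Subtype.val (hthr k)
    have hstep : ∀ d ∈ ω.steps, ∀ k, IsStep k (mrows k d) := fun d hd k =>
      (a k).2.2.2.2 _ (by rw [← hω k]; exact List.mem_map_of_mem hd)
    have hsum' : Summable fun k => (2⁻¹ : ℝ) ^ k * wsize k ω := by
      convert hsum using 3 with k
      change (wsize k ω : ℝ) = wsize k (a k).1
      rw [← hω k, wsize_wrows]
    have hle : ∀ z : Arr, (∀ k, size (z (mark k)) ≤ wsize k ω) →
        Summable fun k => (2⁻¹ : ℝ) ^ k * size (z (mark k)) := fun z hz =>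
      hsum'.of_nonneg_of_le (fun k => by positivity) fun k => by
        gcongr
        exact hz k
    obtain ⟨F, rfl⟩ := exists_word_eq (n := n) (ω := ω)
      (fun d hd => pos_of_forall_mrows fun k => (hstep d hd k).1)
      ⟨fun k => by
        rw [show rows k ω.base = (a k).1.base from congrArg Word.base (hω k)]
        exact (a k).2.1, hle _ fun k => Nat.le_add_right _ _⟩
      (fun d hd => ⟨fun k => by
        rw [← rows_mrows]
        exact (hstep d hd k).2.1.rows k, hle _ fun k =>
          (List.single_le_sum (by simp) _
            (List.mem_map_of_mem (f := fun d => size (d (mark k))) hd)).trans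
            (Nat.le_add_left _ _)⟩)
      (by simpa [← hω 0, wrows] using (a 0).2.2.2.1)
    exact ⟨F, funext fun k => Subtype.ext (hω k)⟩
  isInducing := by
    have hw : ∀ F : HypFn n Model, (wordTower n hn).weight (levelWord F) = wwt (word F) :=
      fun F => (hasSum_levelWord F).tsum_eq
    simp only [hw]
    have hi := isInducing_word (n := n)
    have hc : ∀ i, Continuous fun F : HypFn n Model => wtr i (word F) := fun i =>
      (continuous_apply i).comp (continuous_fst.comp hi.continuous)
    refine IsInducing.of_comp (g := fun p : (∀ k, Level n k) × ℝ =>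
      ((fun i => wtr i (p.1 i).1), p.2)) (Continuous.prodMk ?_ ?_) (Continuous.prodMk ?_ ?_) ?_
    · refine continuous_pi fun k => (Level.isEmbedding k).isInducing.continuous_iff.2
        (continuous_pi fun i => ?_)
      change Continuous fun F : HypFn n Model => wtr i (wrows k (word F))
      simp only [wtr_wrows]
      exact (continuous_of_discreteTopology (f := wrows k)).comp (hc i)
    · exact continuous_snd.comp hi.continuous
    · refine continuous_pi fun i => ?_
      exact (continuous_apply i).comp ((Level.isEmbedding i).continuous.comp
        ((continuous_apply i).comp continuous_fst))
    · exact continuous_snd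
    · have hwtr : ∀ (F : HypFn n Model) i, wtr i (levelWord F i).1 = wtr i (word F) := fun F i => by
        rw [levelWord, wtr_wrows, wrows_wtr le_rfl]
      convert hi using 1
      exact funext fun F => Prod.ext (funext (hwtr F)) rfl

end ErdosModel

section HypFn

variable {n : ℕ} {X Y : Type*} [TopologicalSpace X] [TopologicalSpace Y]

/-- The map of symmetric products induced by a map of spaces. -/
def HypFn.map (n : ℕ) (f : X → Y) (F : HypFn n X) : HypFn n Y :=
  ⟨f '' F.1, F.2.1.image f, F.2.2.1.image f, (ncard_image_le F.2.2.1).trans F.2.2.2⟩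

lemma HypFn.continuous_map {f : X → Y} (hf : Continuous f) : Continuous (HypFn.map n f) := by
  refine continuous_iff_continuousAt.2 fun F₀ => ErdosModel.le_nhds_hypFn (fun U hU => ?_) ?_
  · have := ErdosModel.eventually_hypFn_subset (F₀ := F₀) (U := f ⁻¹' U) fun y hy =>
      hf.continuousAt (hU _ (mem_image_of_mem f hy))
    exact this.mono fun F hF => image_subset_iff.2 hF
  · rintro U _ ⟨y, hy, rfl⟩ hU
    refine (ErdosModel.eventually_hypFn_inter hy (hf.continuousAt hU)).mono ?_
    rintro F ⟨z, hz, hzU⟩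
    exact ⟨f z, mem_image_of_mem f hz, hzU⟩

/-- Homeomorphic spaces have homeomorphic symmetric products. -/
def HypFn.congr (n : ℕ) (e : X ≃ₜ Y) : HypFn n X ≃ₜ HypFn n Y where
  toFun := HypFn.map n e
  invFun := HypFn.map n e.symm
  left_inv F := Subtype.ext (by simp [HypFn.map, image_image])
  right_inv F := Subtype.ext (by simp [HypFn.map, image_image])
  continuous_toFun := HypFn.continuous_map e.continuous
  continuous_invFun := HypFn.continuous_map e.symm.continuous

/-- The first symmetric product of a space is the space itself. -/
lemma HypFn.nonempty_homeomorph_one : Nonempty (X ≃ₜ HypFn 1 X) := by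
  let s : X → HypFn 1 X := fun x =>
    ⟨{x}, singleton_nonempty x, finite_singleton x, (ncard_singleton x).le⟩
  have hs : Function.Bijective s := by
    refine ⟨fun x y h => singleton_injective (congrArg Subtype.val h), fun F => ?_⟩
    obtain ⟨x, hx⟩ := ncard_eq_one.1
      (le_antisymm F.2.2.2 ((ncard_pos F.2.2.1).2 F.2.1))
    exact ⟨x, Subtype.ext hx.symm⟩
  have hi : IsInducing s := by
    refine isInducing_iff_nhds.2 fun x => le_antisymm ?_ fun U hU => ?_
    · refine Filter.tendsto_iff_comap.1 (ErdosModel.le_nhds_hypFn (fun U hU => ?_) ?_)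
      · filter_upwards [Filter.image_mem_map (hU x rfl)]
        rintro _ ⟨y, hy, rfl⟩
        exact singleton_subset_iff.2 hy
      · rintro U _ rfl hU
        filter_upwards [Filter.image_mem_map hU]
        rintro _ ⟨y, hy, rfl⟩
        exact ⟨y, rfl, hy⟩
    · have := ErdosModel.eventually_hypFn_subset (F₀ := s x) (U := U) (by rintro _ rfl; exact hU)
      filter_upwards [Filter.preimage_mem_comap this] with y hy
      exact hy rfl
  exact ⟨(Equiv.ofBijective s hs).toHomeomorphOfIsInducing hi⟩

end HypFn

/-- For every `n ≥ 1`, the `n`-th symmetric product of Erdős space, with the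
Vietoris topology, is homeomorphic to Erdős space. -/
theorem symmetricProduct_erdos_homeomorph (n : ℕ) (hn : 1 ≤ n) :
    Nonempty (HypFn n ErdosSpace ≃ₜ ErdosSpace) := by
  obtain ⟨e⟩ := HypFn.nonempty_homeomorph_one (X := ErdosModel.Model)
  obtain ⟨e₁⟩ := (ErdosModel.realizes_hypFn le_rfl).homeomorph ErdosSpace.realizes
  obtain ⟨eₙ⟩ := (ErdosModel.realizes_hypFn hn).homeomorph ErdosSpace.realizes
  exact ⟨(HypFn.congr n (e.trans e₁).symm).trans eₙ⟩
end
end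

section
/- For every n ≥ 1, the spaces F_n(𝔈_c), F_n(𝔈), F(𝔈_c), F(𝔈), K(𝔈_c) and K(𝔈), each with the Vietoris topology, are cohesive and almost zero-dimensional. -/
open Set Topology

noncomputable section

/-! ### Intersections of clopen sets -/

/-- Every point outside `A` is separated from `A` by a clopen set; equivalently, `A` is an
intersection of clopen sets. -/
def IsClopenSeparated {X : Type*} [TopologicalSpace X] (A : Set X) : Prop :=
  ∀ y ∉ A, ∃ c : Set X, IsClopen c ∧ A ⊆ c ∧ y ∉ c

section ClopenSeparated

variable {X : Type*} [TopologicalSpace X] {A B : Set X}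

theorem IsClopenSeparated.exists_eq_sInter (hA : IsClopenSeparated A) :
    ∃ C : Set (Set X), (∀ c ∈ C, IsClopen c) ∧ A = ⋂₀ C := by
  refine ⟨{c | IsClopen c ∧ A ⊆ c}, fun c hc => hc.1, ?_⟩
  refine Subset.antisymm (subset_sInter fun c hc => hc.2) fun y hy => ?_
  by_contra hyA
  obtain ⟨c, hc, hAc, hyc⟩ := hA y hyA
  exact hyc (hy c ⟨hc, hAc⟩)

theorem isClopenSeparated_sInter {C : Set (Set X)} (hC : ∀ c ∈ C, IsClopen c) :
    IsClopenSeparated (⋂₀ C) := by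
  intro y hy
  simp only [mem_sInter, not_forall] at hy
  obtain ⟨c, hc, hyc⟩ := hy
  exact ⟨c, hC c hc, sInter_subset_of_mem hc, hyc⟩

theorem isClopenSeparated_univ : IsClopenSeparated (univ : Set X) :=
  fun y hy => (hy (mem_univ y)).elim

theorem isClopenSeparated_empty : IsClopenSeparated (∅ : Set X) :=
  fun _ _ => ⟨∅, isClopen_empty, Subset.rfl, notMem_empty _⟩

theorem IsClopenSeparated.inter (hA : IsClopenSeparated A) (hB : IsClopenSeparated B) :
    IsClopenSeparated (A ∩ B) := by
  intro y hy
  by_cases hyA : y ∈ A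
  · obtain ⟨c, hc, hBc, hyc⟩ := hB y fun h => hy ⟨hyA, h⟩
    exact ⟨c, hc, inter_subset_right.trans hBc, hyc⟩
  · obtain ⟨c, hc, hAc, hyc⟩ := hA y hyA
    exact ⟨c, hc, inter_subset_left.trans hAc, hyc⟩

theorem IsClopenSeparated.union (hA : IsClopenSeparated A) (hB : IsClopenSeparated B) :
    IsClopenSeparated (A ∪ B) := by
  intro y hy
  obtain ⟨c, hc, hAc, hyc⟩ := hA y fun h => hy (Or.inl h)
  obtain ⟨d, hd, hBd, hyd⟩ := hB y fun h => hy (Or.inr h)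
  exact ⟨c ∪ d, hc.union hd, union_subset_union hAc hBd, fun h => h.elim hyc hyd⟩

theorem IsAZD.exists_isClopenSeparated (hX : IsAZD X) {x : X} {U : Set X} (hU : U ∈ 𝓝 x) :
    ∃ V ∈ 𝓝 x, V ⊆ U ∧ IsClopenSeparated V := by
  obtain ⟨V, hV, hVU, C, hC, rfl⟩ := hX x U hU
  exact ⟨_, hV, hVU, isClopenSeparated_sInter hC⟩

/-- Almost zero-dimensionality may be checked on a subbasis. -/
theorem isAZD_of_generateFrom {Y : Type*} [t : TopologicalSpace Y] {g : Set (Set Y)}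
    (ht : t = TopologicalSpace.generateFrom g)
    (h : ∀ s ∈ g, ∀ x ∈ s, ∃ V ∈ 𝓝 x, V ⊆ s ∧ IsClopenSeparated V) : IsAZD Y := by
  have key : ∀ U : Set Y, TopologicalSpace.GenerateOpen g U →
      ∀ x ∈ U, ∃ V ∈ 𝓝 x, V ⊆ U ∧ IsClopenSeparated V := by
    intro U hU
    induction hU with
    | basic s hs => exact h s hs
    | univ => exact fun x _ => ⟨univ, Filter.univ_mem, Subset.rfl, isClopenSeparated_univ⟩
    | inter s t _ _ hs ht =>
      intro x hx
      obtain ⟨V, hV, hVs, hVc⟩ := hs x hx.1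
      obtain ⟨W, hW, hWt, hWc⟩ := ht x hx.2
      exact ⟨V ∩ W, Filter.inter_mem hV hW, inter_subset_inter hVs hWt, hVc.inter hWc⟩
    | sUnion S _ hS =>
      rintro x ⟨s, hs, hxs⟩
      obtain ⟨V, hV, hVs, hVc⟩ := hS s hs x hxs
      exact ⟨V, hV, hVs.trans (subset_sUnion_of_mem hs), hVc⟩
  intro x U hU
  obtain ⟨O, hOU, hO, hxO⟩ := mem_nhds_iff.1 hU
  have hO' : TopologicalSpace.GenerateOpen g O := by
    rw [ht] at hO
    exact hO
  obtain ⟨V, hV, hVO, hVc⟩ := key O hO' x hxO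
  exact ⟨V, hV, hVO.trans hOU, hVc.exists_eq_sInter⟩

/-- In an almost zero-dimensional space, a compact set inside an open set has a neighborhood
inside that open set which is an intersection of clopen sets. -/
theorem IsAZD.exists_isClopenSeparated_of_isCompact (hX : IsAZD X) {K U : Set X}
    (hK : IsCompact K) (hU : IsOpen U) (hKU : K ⊆ U) :
    ∃ V : Set X, K ⊆ interior V ∧ V ⊆ U ∧ IsClopenSeparated V := by
  refine hK.induction_on (p := fun K => ∃ V : Set X, K ⊆ interior V ∧ V ⊆ U ∧ IsClopenSeparated V)
    ⟨∅, empty_subset _, empty_subset _, isClopenSeparated_empty⟩ ?_ ?_ ?_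
  · rintro s t hst ⟨V, hV, h⟩
    exact ⟨V, hst.trans hV, h⟩
  · rintro s t ⟨V, hV, hVU, hVc⟩ ⟨W, hW, hWU, hWc⟩
    refine ⟨V ∪ W, union_subset ?_ ?_, union_subset hVU hWU, hVc.union hWc⟩
    · exact hV.trans (interior_mono subset_union_left)
    · exact hW.trans (interior_mono subset_union_right)
  · intro x hx
    obtain ⟨V, hV, hVU, hVc⟩ := hX.exists_isClopenSeparated (hU.mem_nhds (hKU hx))
    exact ⟨interior V, mem_nhdsWithin_of_mem_nhds (interior_mem_nhds.2 hV),
      V, Subset.rfl, hVU, hVc⟩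

end ClopenSeparated

/-! ### Hyperspaces -/

section Hyperspace

variable {X H : Type*} [τ : TopologicalSpace X] [tH : TopologicalSpace H] {e : H → Set X}

theorem isOpen_setOf_subset (he : tH = (VietorisTop τ).induced e) (hne : ∀ F, (e F).Nonempty)
    {U : Set X} (hU : IsOpen U) : IsOpen {F | e F ⊆ U} := by
  rcases U.eq_empty_or_nonempty with rfl | hUne
  · convert isOpen_empty
    ext F
    simpa [subset_empty_iff] using (hne F).ne_empty
  · rw [he]
    exact ⟨{F | F ⊆ U}, TopologicalSpace.isOpen_generateFrom_of_mem (Or.inl ⟨U, hU, hUne, rfl⟩), rfl⟩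

theorem isOpen_setOf_inter_nonempty (he : tH = (VietorisTop τ).induced e)
    {U : Set X} (hU : IsOpen U) : IsOpen {F | (e F ∩ U).Nonempty} := by
  rcases U.eq_empty_or_nonempty with rfl | hUne
  · simp
  · rw [he]
    exact ⟨{F | (F ∩ U).Nonempty},
      TopologicalSpace.isOpen_generateFrom_of_mem (Or.inr ⟨U, hU, hUne, rfl⟩), rfl⟩

theorem isClopen_setOf_subset (he : tH = (VietorisTop τ).induced e) (hne : ∀ F, (e F).Nonempty)
    {U : Set X} (hU : IsClopen U) : IsClopen {F | e F ⊆ U} := by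
  refine ⟨⟨?_⟩, isOpen_setOf_subset he hne hU.isOpen⟩
  convert isOpen_setOf_inter_nonempty he hU.compl.isOpen using 1
  ext F
  simp [inter_compl_nonempty_iff]

theorem isClopen_setOf_inter_nonempty (he : tH = (VietorisTop τ).induced e)
    (hne : ∀ F, (e F).Nonempty) {U : Set X} (hU : IsClopen U) :
    IsClopen {F | (e F ∩ U).Nonempty} := by
  convert (isClopen_setOf_subset he hne hU.compl).compl using 1
  ext F
  simp [not_subset, Set.Nonempty]

/-- A hyperspace of nonempty compact subsets of an almost zero-dimensional space is almost
zero-dimensional. -/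
theorem IsAZD.hyperspace (hX : IsAZD X) (he : tH = (VietorisTop τ).induced e)
    (hne : ∀ F, (e F).Nonempty) (hK : ∀ F, IsCompact (e F)) : IsAZD H := by
  refine isAZD_of_generateFrom (he.trans induced_generateFrom_eq) ?_
  rintro _ ⟨_, ⟨U, hU, -, rfl⟩ | ⟨U, hU, -, rfl⟩, rfl⟩ F hF
  · obtain ⟨V, hFV, hVU, hVc⟩ := hX.exists_isClopenSeparated_of_isCompact (hK F) hU hF
    refine ⟨{G | e G ⊆ V}, ?_, fun G hG => hG.trans hVU, ?_⟩
    · filter_upwards [(isOpen_setOf_subset he hne isOpen_interior).mem_nhds hFV] with G hG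
      exact hG.trans interior_subset
    · intro G hG
      obtain ⟨y, hyG, hyV⟩ := not_subset.1 hG
      obtain ⟨c, hc, hVc, hyc⟩ := hVc y hyV
      exact ⟨{G | e G ⊆ c}, isClopen_setOf_subset he hne hc, fun G' hG' => hG'.trans hVc,
        fun h => hyc (h hyG)⟩
  · obtain ⟨x, hxF, hxU⟩ := hF
    obtain ⟨V, hV, hVU, hVc⟩ := hX.exists_isClopenSeparated (hU.mem_nhds hxU)
    refine ⟨{G | (e G ∩ V).Nonempty}, ?_, fun G hG => hG.mono (inter_subset_inter_right _ hVU), ?_⟩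
    · filter_upwards [(isOpen_setOf_inter_nonempty he isOpen_interior).mem_nhds
        ⟨x, hxF, mem_interior_iff_mem_nhds.2 hV⟩] with G hG
      exact hG.mono (inter_subset_inter_right _ interior_subset)
    · intro G hG
      obtain ⟨c, hc, hVc', hGc⟩ : ∃ c : Set X, IsClopen c ∧ V ⊆ c ∧ Disjoint (e G) c := by
        refine (hK G).induction_on (p := fun K => ∃ c : Set X, IsClopen c ∧ V ⊆ c ∧ Disjoint K c)
          ⟨univ, isClopen_univ, subset_univ _, empty_disjoint _⟩ ?_ ?_ ?_
        · rintro s t hst ⟨c, hc, hVc, hd⟩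
          exact ⟨c, hc, hVc, hd.mono_left hst⟩
        · rintro s t ⟨c, hc, hVc, hsc⟩ ⟨d, hd, hVd, htd⟩
          exact ⟨c ∩ d, hc.inter hd, subset_inter hVc hVd, disjoint_union_left.2
            ⟨hsc.mono_right inter_subset_left, htd.mono_right inter_subset_right⟩⟩
        · intro y hy
          obtain ⟨c, hc, hVc, hyc⟩ := hVc y fun h => hG ⟨y, hy, h⟩
          exact ⟨cᶜ, mem_nhdsWithin_of_mem_nhds (hc.compl.isOpen.mem_nhds hyc), c, hc, hVc,
            disjoint_compl_left⟩
      exact ⟨{G | (e G ∩ c).Nonempty}, isClopen_setOf_inter_nonempty he hne hc,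
        fun G' hG' => hG'.mono (inter_subset_inter_right _ hVc'),
        fun h => not_disjoint_iff_nonempty_inter.2 h hGc⟩

theorem continuous_insert_vietorisTop (G : Set X) :
    @Continuous X (Set X) τ (VietorisTop τ) fun z => insert z G := by
  refine continuous_generateFrom_iff.2 ?_
  rintro _ (⟨U, hU, -, rfl⟩ | ⟨U, hU, -, rfl⟩)
  · by_cases hG : G ⊆ U
    · simpa [preimage, insert_subset_iff, hG] using hU
    · simp [preimage, insert_subset_iff, hG]
  · by_cases hG : (G ∩ U).Nonempty
    · convert isOpen_univ
      ext z
      simpa using hG.mono (inter_subset_inter_left _ (subset_insert z G))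
    · convert hU using 1
      ext z
      rw [not_nonempty_iff_eq_empty] at hG
      by_cases hz : z ∈ U <;> simp [hz, hG, insert_inter_of_mem, insert_inter_of_notMem]

/-- If nonempty clopen subsets of `X` are unbounded for a continuous gauge `ν`, then a hyperspace
of compact sets in which one point of every member may be moved freely is cohesive. -/
theorem cohesive_hyperspace {ν : X → ℝ} (hν : Continuous ν)
    (hX : ∀ C : Set X, IsClopen C → C.Nonempty → ∀ R : ℝ, ∃ x ∈ C, R ≤ ν x)
    (he : tH = (VietorisTop τ).induced e) (hinj : e.Injective)
    (hne : ∀ F, (e F).Nonempty) (hK : ∀ F, IsCompact (e F))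
    (hmove : ∀ F, ∃ x G, insert x G = e F ∧ ∀ z, ∃ F', e F' = insert z G) : Cohesive H := by
  intro F
  obtain ⟨R, hR⟩ := (hK F).bddAbove_image hν.continuousOn
  refine ⟨{G | e G ⊆ {x | ν x < R + 1}},
    (isOpen_setOf_subset he hne (isOpen_lt hν continuous_const)).mem_nhds fun x hx => ?_, ?_⟩
  · exact (hR (mem_image_of_mem ν hx)).trans_lt (lt_add_one R)
  rintro _ rfl C hCU - ⟨F₀, hF₀⟩ - hC
  obtain ⟨x, G, hxG, hG⟩ := hmove F₀
  choose f hf using hG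
  have hfc : Continuous f := by
    rw [he]
    refine continuous_induced_rng.2 ?_
    convert continuous_insert_vietorisTop G using 1
    exact funext hf
  have hC' : IsClopen (f ⁻¹' C) :=
    hC.preimage (hfc.subtype_mk fun z => mem_univ (f z))
  have hx : f x ∈ C := by rwa [hinj ((hf x).trans hxG)]
  obtain ⟨y, hy, hRy⟩ := hX _ hC' ⟨x, hx⟩ (R + 1)
  have := hCU hy (show y ∈ e (f y) by rw [hf]; exact mem_insert y G)
  exact (not_lt.2 hRy) this

end Hyperspace

theorem cohesive_and_isAZD_hypFn {X : Type*} [TopologicalSpace X] (hAZD : IsAZD X) {ν : X → ℝ}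
    (hν : Continuous ν)
    (hX : ∀ C : Set X, IsClopen C → C.Nonempty → ∀ R : ℝ, ∃ x ∈ C, R ≤ ν x) (n : ℕ) :
    Cohesive (HypFn n X) ∧ IsAZD (HypFn n X) := by
  refine ⟨cohesive_hyperspace (H := HypFn n X) (e := Subtype.val) hν hX rfl
      Subtype.val_injective (fun F => F.2.1) (fun F => F.2.2.1.isCompact) ?_,
    hAZD.hyperspace (H := HypFn n X) (e := Subtype.val) rfl
      (fun F => F.2.1) (fun F => F.2.2.1.isCompact)⟩
  rintro ⟨F, ⟨x, hx⟩, hfin, hcard⟩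
  refine ⟨x, F \ {x}, insert_sdiff_self_of_mem hx, fun z =>
    ⟨⟨insert z (F \ {x}), insert_nonempty _ _, hfin.sdiff.insert z, ?_⟩, rfl⟩⟩
  have h₁ := ncard_insert_le z (F \ {x})
  have h₂ := ncard_sdiff_singleton_add_one hx hfin
  omega

theorem cohesive_and_isAZD_hypFin {X : Type*} [TopologicalSpace X] (hAZD : IsAZD X) {ν : X → ℝ}
    (hν : Continuous ν)
    (hX : ∀ C : Set X, IsClopen C → C.Nonempty → ∀ R : ℝ, ∃ x ∈ C, R ≤ ν x) :
    Cohesive (HypFin X) ∧ IsAZD (HypFin X) := by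
  refine ⟨cohesive_hyperspace (H := HypFin X) (e := Subtype.val) hν hX rfl
      Subtype.val_injective (fun F => F.2.1) (fun F => F.2.2.isCompact) ?_,
    hAZD.hyperspace (H := HypFin X) (e := Subtype.val) rfl
      (fun F => F.2.1) (fun F => F.2.2.isCompact)⟩
  rintro ⟨F, ⟨x, hx⟩, hfin⟩
  exact ⟨x, F, insert_eq_of_mem hx, fun z => ⟨⟨insert z F, insert_nonempty _ _, hfin.insert z⟩, rfl⟩⟩

theorem cohesive_and_isAZD_hypK {X : Type*} [TopologicalSpace X] (hAZD : IsAZD X) {ν : X → ℝ}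
    (hν : Continuous ν)
    (hX : ∀ C : Set X, IsClopen C → C.Nonempty → ∀ R : ℝ, ∃ x ∈ C, R ≤ ν x) :
    Cohesive (HypK X) ∧ IsAZD (HypK X) := by
  refine ⟨cohesive_hyperspace (H := HypK X) (e := Subtype.val) hν hX rfl
      Subtype.val_injective (fun F => F.2.1) (fun F => F.2.2) ?_,
    hAZD.hyperspace (H := HypK X) (e := Subtype.val) rfl (fun F => F.2.1) (fun F => F.2.2)⟩
  rintro ⟨F, ⟨x, hx⟩, hF⟩
  exact ⟨x, F, insert_eq_of_mem hx, fun z => ⟨⟨insert z F, insert_nonempty _ _, hF.insert z⟩, rfl⟩⟩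

/-! ### Subspaces of `ℓ²` given by coordinate restrictions -/

/-- The points of `ℓ²` all of whose coordinates lie in `S`. -/
abbrev CoordSpace (S : Set ℝ) : Type :=
  {x : lp (fun _ : ℕ => ℝ) 2 // ∀ n : ℕ, x.val n ∈ S}

theorem continuous_coord (i : ℕ) : Continuous fun x : lp (fun _ : ℕ => ℝ) 2 => x.val i :=
  (continuous_apply i).comp (lp.uniformContinuous_coe (E := fun _ : ℕ => ℝ) (p := 2)).continuous

theorem sum_sq_le_norm_sq (x : lp (fun _ : ℕ => ℝ) 2) (s : Finset ℕ) :
    ∑ i ∈ s, x.val i ^ 2 ≤ ‖x‖ ^ 2 := by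
  simpa using lp.sum_rpow_le_norm_rpow (p := 2) (by norm_num) x s

theorem norm_le_of_forall_sum_sq_le {x : lp (fun _ : ℕ => ℝ) 2} {r : ℝ} (hr : 0 ≤ r)
    (h : ∀ n, ∑ i ∈ Finset.range n, x.val i ^ 2 ≤ r ^ 2) : ‖x‖ ≤ r := by
  refine lp.norm_le_of_forall_sum_le (p := 2) (by norm_num) hr fun s => ?_
  obtain ⟨n, hn⟩ := s.exists_nat_subset_range
  simpa using (Finset.sum_le_sum_of_subset_of_nonneg hn fun i _ _ => sq_nonneg _).trans (h n)

theorem isAZD_coordSpace {S : Set ℝ} (hS : S.Countable) : IsAZD (CoordSpace S) := by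
  intro a U hU
  obtain ⟨r, hr, hrU⟩ := Metric.nhds_basis_closedBall.mem_iff.1 hU
  refine ⟨Metric.closedBall a r, Metric.closedBall_mem_nhds a hr, hrU,
    IsClopenSeparated.exists_eq_sInter fun y hy => ?_⟩
  have hy' : ¬ ‖y.1 - a.1‖ ≤ r := by
    rwa [Metric.mem_closedBall, Subtype.dist_eq, dist_eq_norm] at hy
  obtain ⟨n, hn⟩ : ∃ n, r ^ 2 < ∑ i ∈ Finset.range n, (y.1 - a.1).val i ^ 2 := by
    by_contra! h
    exact hy' (norm_le_of_forall_sum_sq_le hr.le h)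
  let f : CoordSpace S → ℝ := fun x => ∑ i ∈ Finset.range n, (x.1 - a.1).val i ^ 2
  have hf : Continuous f := continuous_finsetSum _ fun i _ =>
    ((continuous_coord i).comp (continuous_subtype_val.sub continuous_const)).pow 2
  have hrange : (range f).Countable := by
    refine ((countable_univ_pi fun _ : Fin n => hS).image
      fun v => ∑ i : Fin n, (v i - a.1.val i) ^ 2).mono ?_
    rintro _ ⟨x, rfl⟩
    exact ⟨fun i => x.1.val i, fun i _ => x.2 i,
      (Finset.sum_range fun i => (x.1.val i - a.1.val i) ^ 2).symm⟩
  obtain ⟨t, ht, hrt, hty⟩ :=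
    (hrange.dense_compl ℝ).exists_mem_open isOpen_Ioo (nonempty_Ioo.2 hn)
  refine ⟨{x | f x < t}, ⟨?_, isOpen_lt hf continuous_const⟩, fun x hx => ?_, not_lt.2 hty.le⟩
  · convert isClosed_le hf continuous_const using 1
    ext x
    rw [mem_ofPred_eq, mem_ofPred_eq]
    exact ⟨le_of_lt, fun h => lt_of_le_of_ne h fun heq => ht ⟨x, heq⟩⟩
  · rw [Metric.mem_closedBall, Subtype.dist_eq, dist_eq_norm] at hx
    exact (sum_sq_le_norm_sq (x.1 - a.1) _).trans_lt
      ((pow_le_pow_left₀ (norm_nonneg _) hx 2).trans_lt hrt)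

/-- A bounded set `C` can be left from any of its points by a small move, after modifying
finitely many coordinates beyond any prescribed place. -/
theorem exists_near_compl {S : Set ℝ} (hS : ∀ m : ℕ, 0 < m → 1 / (m : ℝ) ∈ S)
    {C : Set (CoordSpace S)} {R : ℝ} (hR : ∀ x ∈ C, ‖x.1‖ < R) {x : CoordSpace S} (hx : x ∈ C)
    {ε : ℝ} (hε : 0 < ε) (N : ℕ) :
    ∃ y ∈ C, ∃ z ∉ C, dist y z ≤ ε ∧ ∃ M > N, ∀ i, i < N ∨ M ≤ i → y.1.val i = x.1.val i := by
  obtain ⟨k, hk⟩ := exists_nat_one_div_lt (half_pos hε)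
  let δ : ℝ := 1 / ((k + 1 : ℕ) : ℝ)
  have hδ : 0 < δ := by positivity
  have hδε : δ < ε / 2 := by simpa [δ] using hk
  have hx0 : Filter.Tendsto (fun i => x.1.val i) Filter.atTop (𝓝 0) := by
    have h := (lp.hasSum_norm (p := 2) (by norm_num) x.1).summable.tendsto_atTop_zero
    have h' := (Real.continuous_sqrt.tendsto 0).comp h
    simp only [Function.comp_def, Real.sqrt_zero] at h'
    refine squeeze_zero_norm (fun i => le_of_eq ?_) h'
    simp [Real.sqrt_sq_eq_abs]
  obtain ⟨N₀, hN₀⟩ := Filter.eventually_atTop.1 (Metric.tendsto_nhds.1 hx0 (ε / 2) (half_pos hε))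
  let L := max N N₀
  let w : ℕ → lp (fun _ : ℕ => ℝ) 2 := fun j =>
    x.1 + ∑ i ∈ Finset.Ico L (L + j), lp.single 2 i (δ - x.1.val i)
  have hw : ∀ j i, (w j).val i = if i ∈ Finset.Ico L (L + j) then δ else x.1.val i := by
    intro j i
    have : (w j).val i
        = x.1.val i + ∑ l ∈ Finset.Ico L (L + j), if i = l then δ - x.1.val i else 0 := by
      simp only [w, lp.coeFn_add, lp.coeFn_sum, Pi.add_apply, Finset.sum_apply, lp.single_apply,
        Pi.single_apply]
      congr 1
      refine Finset.sum_congr rfl fun l _ => ?_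
      split_ifs with h
      · rw [h]
      · rfl
    rw [this, Finset.sum_ite_eq]
    split_ifs <;> ring
  let y : ℕ → CoordSpace S := fun j => ⟨w j, fun i => by
    rw [hw]
    split_ifs
    · exact hS _ k.succ_pos
    · exact x.2 i⟩
  have hy0 : y 0 ∈ C := by
    convert hx
    exact Subtype.ext (by simp [y, w])
  have hexit : ∃ j, y j ∉ C := by
    obtain ⟨j, hj⟩ := exists_nat_gt (R ^ 2 / δ ^ 2)
    refine ⟨j, fun hjC => ?_⟩
    have h₁ := sum_sq_le_norm_sq (w j) (Finset.Ico L (L + j))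
    rw [Finset.sum_congr rfl fun i hi => by rw [hw, if_pos hi]] at h₁
    simp only [Finset.sum_const, Nat.card_Ico, add_tsub_cancel_left, nsmul_eq_mul] at h₁
    have h₂ : ‖w j‖ ^ 2 < R ^ 2 := pow_lt_pow_left₀ (hR _ hjC) (norm_nonneg _) two_ne_zero
    rw [div_lt_iff₀ (by positivity)] at hj
    linarith
  obtain ⟨j, hj, hj'⟩ : ∃ j, y j ∈ C ∧ y (j + 1) ∉ C := by
    by_contra! h
    obtain ⟨j, hj⟩ := hexit
    exact hj (Nat.rec hy0 (fun j ih => h j ih) j)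
  refine ⟨y j, hj, y (j + 1), hj', ?_, L + j + 1, by omega, fun i hi => ?_⟩
  · have hdiff : w (j + 1) - w j = lp.single 2 (L + j) (δ - x.1.val (L + j)) := by
      simp only [w]
      rw [← add_assoc, Finset.sum_Ico_succ_top (by omega)]
      abel
    have hxL : |x.1.val (L + j)| < ε / 2 := by
      simpa using hN₀ (L + j) (by omega)
    rw [dist_comm, Subtype.dist_eq, dist_eq_norm, hdiff, lp.norm_single (by norm_num),
      Real.norm_eq_abs]
    have := abs_sub δ (x.1.val (L + j))
    rw [abs_of_pos hδ] at this
    linarith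
  · rw [hw, if_neg]
    rw [Finset.mem_Ico]
    omega

/-- Nonempty clopen subsets of `CoordSpace S` are unbounded when `S` contains all `1 / m`. -/
theorem exists_le_norm_of_isClopen {S : Set ℝ} (hS : ∀ m : ℕ, 0 < m → 1 / (m : ℝ) ∈ S)
    (C : Set (CoordSpace S)) (hC : IsClopen C) (hne : C.Nonempty) (R : ℝ) :
    ∃ x ∈ C, R ≤ ‖x.1‖ := by
  by_contra! hR
  obtain ⟨x₀, hx₀⟩ := hne
  have hstep : ∀ (p : C × ℕ) (k : ℕ), ∃ q : C × ℕ, p.2 < q.2 ∧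
      (∃ z ∉ C, dist q.1.1 z ≤ 1 / ((k : ℝ) + 1)) ∧
      ∀ i, i < p.2 ∨ q.2 ≤ i → q.1.1.1.val i = p.1.1.1.val i := by
    rintro ⟨⟨x, hx⟩, N⟩ k
    obtain ⟨y, hy, z, hz, hyz, M, hM, hyx⟩ :=
      exists_near_compl hS hR hx (Nat.one_div_pos_of_nat (α := ℝ) (n := k)) N
    exact ⟨(⟨y, hy⟩, M), hM, ⟨z, hz, hyz⟩, hyx⟩
  choose step hlt hnear hagree using hstep
  let p : ℕ → C × ℕ := fun k => Nat.rec (⟨x₀, hx₀⟩, 0) (fun k q => step q k) k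
  have hp : ∀ k, p (k + 1) = step (p k) k := fun _ => rfl
  let N : ℕ → ℕ := fun k => (p k).2
  let x : ℕ → CoordSpace S := fun k => (p k).1.1
  have hN : StrictMono N := strictMono_nat_of_lt_succ fun k => hlt (p k) k
  have hhead : ∀ k l i, k ≤ l → i < N k → (x l).1.val i = (x k).1.val i := by
    intro k l i hkl hi
    induction l, hkl using Nat.le_induction with
    | base => rfl
    | succ l hkl ih =>
      exact (hagree (p l) l i (Or.inl (hi.trans_le (hN.monotone hkl)))).trans ih
  have htail : ∀ k i, N k ≤ i → (x k).1.val i = x₀.1.val i := by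
    intro k
    induction k with
    | zero => exact fun _ _ => rfl
    | succ k ih =>
      exact fun i hi => (hagree (p k) k i (Or.inr hi)).trans
        (ih i ((hN.monotone k.le_succ).trans hi))
  let v : ℕ → ℝ := fun i => (x (i + 1)).1.val i
  have hv : ∀ k i, i < N k → v i = (x k).1.val i := by
    intro k i hi
    have hi' : i < N (i + 1) := hN.le_apply
    rcases le_total k (i + 1) with h | h
    · exact hhead k (i + 1) i h hi
    · exact (hhead (i + 1) k i h hi').symm
  have hvmem : Memℓp v 2 := by
    refine memℓp_gen' (C := R ^ 2) fun s => ?_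
    obtain ⟨n, hn⟩ := s.exists_nat_subset_range
    have h₁ : ∀ i ∈ s, v i = (x n).1.val i := fun i hi =>
      hv n i ((Finset.mem_range.1 (hn hi)).trans_le hN.le_apply)
    rw [Finset.sum_congr rfl fun i hi => by rw [h₁ i hi]]
    have h₂ := sum_sq_le_norm_sq (x n).1 s
    have h₃ := pow_le_pow_left₀ (norm_nonneg _) (hR _ (p n).1.2).le 2
    simpa using h₂.trans h₃
  let y : CoordSpace S := ⟨⟨v, hvmem⟩, fun i => (x (i + 1)).2 i⟩
  have hlim : Filter.Tendsto x Filter.atTop (𝓝 y) := by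
    rw [tendsto_subtype_rng]
    have h := ((lp.hasSum_single (p := 2) (by norm_num) (y.1 - x₀.1)).tendsto_sum_nat.comp
      hN.tendsto_atTop).const_add x₀.1
    rw [add_sub_cancel] at h
    refine h.congr fun k => ?_
    ext i
    simp only [Function.comp_apply, lp.coeFn_add, lp.coeFn_sum, Pi.add_apply, Finset.sum_apply,
      lp.single_apply, Pi.single_apply]
    rw [Finset.sum_ite_eq]
    split_ifs with hi
    · rw [← hv k i (Finset.mem_range.1 hi)]
      exact add_sub_cancel _ _
    · rw [htail k i (by simpa using hi), add_zero]
  have hy : y ∈ C := hC.isClosed.mem_of_tendsto hlim (Filter.Eventually.of_forall fun k => (p k).1.2)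
  choose z hz hxz using fun k => hnear (p k) k
  have hzlim : Filter.Tendsto z Filter.atTop (𝓝 y) := by
    refine (tendsto_iff_of_dist ?_).1 (hlim.comp (Filter.tendsto_add_atTop_nat 1))
    exact squeeze_zero (fun _ => dist_nonneg) hxz tendsto_one_div_add_atTop_nhds_zero_nat
  exact hC.compl.isClosed.mem_of_tendsto hzlim (Filter.Eventually.of_forall hz) hy

theorem cohesive_and_isAZD_hyperspaces_coordSpace {S : Set ℝ} (hS : S.Countable)
    (hS' : ∀ m : ℕ, 0 < m → 1 / (m : ℝ) ∈ S) :
    (∀ n : ℕ, Cohesive (HypFn n (CoordSpace S)) ∧ IsAZD (HypFn n (CoordSpace S))) ∧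
    (Cohesive (HypFin (CoordSpace S)) ∧ IsAZD (HypFin (CoordSpace S))) ∧
    (Cohesive (HypK (CoordSpace S)) ∧ IsAZD (HypK (CoordSpace S))) :=
  have hν : Continuous fun x : CoordSpace S => ‖x.1‖ := continuous_subtype_val.norm
  have hA := isAZD_coordSpace hS
  have hX := exists_le_norm_of_isClopen hS'
  ⟨cohesive_and_isAZD_hypFn hA hν hX, cohesive_and_isAZD_hypFin hA hν hX,
    cohesive_and_isAZD_hypK hA hν hX⟩

/-- The symmetric products, finite-subset hyperspaces and compact hyperspaces of complete
Erdős space and of Erdős space are all cohesive and almost zero-dimensional. -/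
theorem erdos_hyperspaces_cohesive_and_isAZD :
    (∀ n : ℕ, 1 ≤ n →
      (Cohesive (HypFn n CompleteErdosSpace) ∧ IsAZD (HypFn n CompleteErdosSpace)) ∧
      (Cohesive (HypFn n ErdosSpace) ∧ IsAZD (HypFn n ErdosSpace))) ∧
    (Cohesive (HypFin CompleteErdosSpace) ∧ IsAZD (HypFin CompleteErdosSpace)) ∧
    (Cohesive (HypFin ErdosSpace) ∧ IsAZD (HypFin ErdosSpace)) ∧
    (Cohesive (HypK CompleteErdosSpace) ∧ IsAZD (HypK CompleteErdosSpace)) ∧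
    (Cohesive (HypK ErdosSpace) ∧ IsAZD (HypK ErdosSpace)) := by
  have hE := cohesive_and_isAZD_hyperspaces_coordSpace
    (S := {r | ∃ q : ℚ, r = (q : ℝ)})
    ((countable_range fun q : ℚ => (q : ℝ)).mono
      (by rintro r ⟨q, hq⟩; exact ⟨q, hq.symm⟩))
    (fun m _ => ⟨1 / m, by push_cast; rfl⟩)
  have hEc := cohesive_and_isAZD_hyperspaces_coordSpace
    (S := {r | r = 0 ∨ ∃ m : ℕ, 0 < m ∧ r = 1 / (m : ℝ)})
    (((countable_singleton 0).union (countable_range fun m : ℕ => 1 / (m : ℝ))).mono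
      (by rintro r (hr | ⟨m, -, hm⟩); exacts [Or.inl hr, Or.inr ⟨m, hm.symm⟩]))
    (fun m hm => Or.inr ⟨m, hm, rfl⟩)
  exact ⟨fun n _ => ⟨hEc.1 n, hE.1 n⟩, hEc.2.1, hE.2.1, hEc.2.2, hE.2.2⟩
end
end

section
/- Let X be a set and let τ₁ ⊆ τ₂ be topologies on X, both separable metrizable, such that τ₁ is zero-dimensional (it has a base of τ₁-clopen sets) and every point of X has a τ₂-neighborhood that is completely metrizable in its subspace topology inherited from τ₁. Then for every n ≥ 1, on F_n(X): the Vietoris topology V(τ₁) is coarser than the Vietoris topology V(τ₂), V(τ₁) is zero-dimensional, and every element of F_n(X) has a V(τ₂)-neighborhood that is completely metrizable in its subspace topology inherited from V(τ₁). -/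
open Set Topology

noncomputable section

/-- The underlying set of the `n`-th symmetric product: nonempty subsets of `X`
with at most `n` points. -/
def FnSub (n : ℕ) (X : Type*) : Type _ :=
  {F : Set X // F.Nonempty ∧ F.Finite ∧ F.ncard ≤ n}

/-- The Vietoris topology on `F_n(X)` induced by a topology `τ` on `X`. -/
def VietFn (n : ℕ) {X : Type*} (τ : TopologicalSpace X) : TopologicalSpace (FnSub n X) :=
  (VietorisTop τ).induced Subtype.val

/-- A topology is zero-dimensional if it has a base of clopen sets. -/
def IsZeroDimTop {X : Type*} (τ : TopologicalSpace X) : Prop :=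
  ∀ U : Set X, IsOpen[τ] U → ∀ x ∈ U, ∃ V : Set X, IsOpen[τ] V ∧ IsClosed[τ] V ∧ x ∈ V ∧ V ⊆ U

/-- A topology is completely metrizable if it is induced by some complete metric. -/
def IsCompletelyMetrizableTop {Y : Type*} (t : TopologicalSpace Y) : Prop :=
  ∃ m : MetricSpace Y, m.toUniformSpace.toTopologicalSpace = t ∧
    @CompleteSpace Y m.toUniformSpace

open TopologicalSpace

theorem isCompletelyMetrizableTop_iff {Y : Type*} (t : TopologicalSpace Y) :
    IsCompletelyMetrizableTop t ↔ IsCompletelyMetrizableSpace Y :=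
  ⟨fun h => ⟨h⟩, fun h => h.complete⟩

/-- On `F_n(X)` the empty open set contributes nothing to the Vietoris topology, so it may be
computed from Mathlib's Vietoris topology on `Set X`. -/
theorem vietFn_eq_induced_vietoris (n : ℕ) {X : Type*} [τ : TopologicalSpace X] :
    VietFn n τ = (TopologicalSpace.vietoris X).induced Subtype.val := by
  apply le_antisymm
  · unfold TopologicalSpace.vietoris
    rw [induced_generateFrom_eq]
    refine le_generateFrom ?_
    rintro _ ⟨_, ⟨U, hU, rfl⟩ | ⟨U, hU, rfl⟩, rfl⟩
    · rcases U.eq_empty_or_nonempty with rfl | hne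
      · have hempty : {F : FnSub n X | F.1 ⊆ ∅} = ∅ :=
          eq_empty_of_forall_notMem fun F hF => F.2.1.ne_empty (subset_empty_iff.1 hF)
        exact (congrArg IsOpen[VietFn n τ] hempty).mpr (@isOpen_empty _ (VietFn n τ))
      · exact ⟨_, isOpen_generateFrom_of_mem (.inl ⟨U, hU, hne, rfl⟩), rfl⟩
    · rcases U.eq_empty_or_nonempty with rfl | hne
      · have hempty : {F : FnSub n X | (F.1 ∩ ∅).Nonempty} = ∅ := by simp
        exact (congrArg IsOpen[VietFn n τ] hempty).mpr (@isOpen_empty _ (VietFn n τ))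
      · exact ⟨_, isOpen_generateFrom_of_mem (.inr ⟨U, hU, hne, rfl⟩), rfl⟩
  · refine induced_mono (le_generateFrom ?_)
    rintro _ (⟨U, hU, -, rfl⟩ | ⟨U, hU, -, rfl⟩)
    · exact hU.powerset_vietoris
    · exact vietoris.isOpen_inter_nonempty_of_isOpen hU

theorem isEmbedding_vietFn_val (n : ℕ) {X : Type*} [τ : TopologicalSpace X] :
    @IsEmbedding (FnSub n X) (Set X) (VietFn n τ) (TopologicalSpace.vietoris X) fun G => G.1 :=
  @IsEmbedding.mk _ _ (VietFn n τ) (TopologicalSpace.vietoris X) _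
    (@IsInducing.mk _ _ (VietFn n τ) (TopologicalSpace.vietoris X) _
      (vietFn_eq_induced_vietoris n)) Subtype.val_injective

theorem vietFn_mono (n : ℕ) {X : Type*} {τ₁ τ₂ : TopologicalSpace X} (h : τ₂ ≤ τ₁) :
    VietFn n τ₂ ≤ VietFn n τ₁ := by
  refine induced_mono (le_generateFrom ?_)
  rintro _ (⟨U, hU, hne, rfl⟩ | ⟨U, hU, hne, rfl⟩)
  · exact isOpen_generateFrom_of_mem (.inl ⟨U, h U hU, hne, rfl⟩)
  · exact isOpen_generateFrom_of_mem (.inr ⟨U, h U hU, hne, rfl⟩)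

theorem IsZeroDimTop.isTopologicalBasis_isClopen {X : Type*} [τ : TopologicalSpace X]
    (h : IsZeroDimTop τ) : IsTopologicalBasis {U : Set X | IsClopen U} :=
  isTopologicalBasis_of_isOpen_of_nhds (fun _ hU => hU.isOpen) fun x U hx hU => by
    obtain ⟨V, hVo, hVc, hxV, hVU⟩ := h U hU x hx
    exact ⟨V, ⟨hVc, hVo⟩, hxV, hVU⟩

theorem IsZeroDimTop.exists_isClopen_of_finite {X : Type*} [τ : TopologicalSpace X]
    (h : IsZeroDimTop τ) {F V : Set X} (hF : F.Finite) (hV : IsOpen V) (hFV : F ⊆ V) :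
    ∃ W, IsClopen W ∧ F ⊆ W ∧ W ⊆ V := by
  choose! C hCo hCc hxC hCV using fun x (hx : x ∈ F) => h V hV x (hFV hx)
  exact ⟨⋃ x ∈ F, C x, hF.isClopen_biUnion fun x hx => ⟨hCc x hx, hCo x hx⟩,
    fun x hx => mem_biUnion hx (hxC x hx), iUnion₂_subset hCV⟩

theorem IsZeroDimTop.vietFn (n : ℕ) {X : Type*} {τ : TopologicalSpace X}
    (h : IsZeroDimTop τ) : IsZeroDimTop (VietFn n τ) := by
  let := TopologicalSpace.vietoris X
  let := VietFn n τ
  have hval : Continuous fun G : FnSub n X => G.1 := (isEmbedding_vietFn_val n).continuous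
  intro S hS F hFS
  rw [vietFn_eq_induced_vietoris] at hS
  obtain ⟨T, hT, rfl⟩ := hS
  obtain ⟨_, ⟨⟨V, u⟩, ⟨hV, hu, huB, -⟩, rfl⟩, ⟨hFV, hFu⟩, hsub⟩ :=
    h.isTopologicalBasis_isClopen.vietoris.exists_subset_of_mem_open hFS hT
  obtain ⟨W, hW, hFW, hWV⟩ := h.exists_isClopen_of_finite F.2.2.1 hV hFV
  have hclopen : IsClopen {s : Set X | s ⊆ W ∧ ∀ U ∈ u, (s ∩ U).Nonempty} := by
    simp_rw [ofPred_and, ofPred_forall]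
    exact IsClopen.inter ⟨hW.isClosed.powerset_vietoris, hW.isOpen.powerset_vietoris⟩ <|
      hu.isClopen_biInter fun U hU =>
        ⟨vietoris.isClosed_inter_nonempty_of_isClosed (huB hU).isClosed,
          vietoris.isOpen_inter_nonempty_of_isOpen (huB hU).isOpen⟩
  refine ⟨{G : FnSub n X | G.1 ⊆ W ∧ ∀ U ∈ u, (G.1 ∩ U).Nonempty},
    hclopen.isOpen.preimage hval, hclopen.isClosed.preimage hval, ⟨hFW, hFu⟩, ?_⟩
  exact fun G hG => hsub ⟨hG.1.trans hWV, hG.2⟩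

theorem isClosed_nonemptyCompacts_encard_le {X : Type*} [TopologicalSpace X] [T2Space X] (n : ℕ) :
    IsClosed {K : NonemptyCompacts X | (K : Set X).encard ≤ n} := by
  rw [← isOpen_compl_iff, isOpen_iff_forall_mem_open]
  intro K hK
  have hK' : ((n + 1 : ℕ) : ℕ∞) ≤ (K : Set X).encard := by
    rw [mem_compl_iff, mem_ofPred_eq, not_le] at hK
    exact_mod_cast Order.add_one_le_of_lt hK
  obtain ⟨t, htK, htn⟩ := exists_subset_encard_eq hK'
  have htf : t.Finite := finite_of_encard_eq_coe htn
  obtain ⟨U, hU, hdisj⟩ := htf.t2_separation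
  refine ⟨⋂ x ∈ t, {L : NonemptyCompacts X | ((L : Set X) ∩ U x).Nonempty}, ?_, ?_, ?_⟩
  · intro L hL hLn
    rw [mem_iInter₂] at hL
    choose! g hgL hgU using hL
    have hinj : InjOn g t := fun x hx y hy hxy => by
      by_contra hne
      exact disjoint_left.1 (hdisj hx hy hne) (hgU x hx) (hxy ▸ hgU y hy)
    have := (encard_le_encard (image_subset_iff.2 hgL)).trans hLn
    rw [hinj.encard_image, htn] at this
    have : n + 1 ≤ n := by exact_mod_cast this
    omega
  · exact htf.isOpen_biInter fun x _ => NonemptyCompacts.isOpen_inter_nonempty_of_isOpen (hU x).2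
  · exact mem_iInter₂.2 fun x hx => ⟨x, htK hx, (hU x).1⟩

theorem isCompletelyMetrizableSpace_nonemptyCompacts (X : Type*) [TopologicalSpace X]
    [IsCompletelyMetrizableSpace X] : IsCompletelyMetrizableSpace (NonemptyCompacts X) := by
  let := upgradeIsCompletelyMetrizable X
  infer_instance

/-- The elements of `F_n(X)` contained in `N` form a completely metrizable space as soon as `N`
is completely metrizable. -/
theorem isCompletelyMetrizableSpace_vietFn_subset (n : ℕ) {X : Type*} [τ : TopologicalSpace X]
    (N : Set X) [IsCompletelyMetrizableSpace N] :
    @IsCompletelyMetrizableSpace {G : FnSub n X | G.1 ⊆ N}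
      (TopologicalSpace.induced Subtype.val (VietFn n τ)) := by
  let := TopologicalSpace.vietoris X
  let := TopologicalSpace.vietoris N
  let := VietFn n τ
  have := isCompletelyMetrizableSpace_nonemptyCompacts N
  let φ : {G : FnSub n X | G.1 ⊆ N} → NonemptyCompacts N := fun G =>
    ⟨⟨Subtype.val ⁻¹' G.1.1, (G.1.2.2.1.preimage Subtype.val_injective.injOn).isCompact⟩, by
      obtain ⟨x, hx⟩ := G.1.2.1
      exact ⟨⟨x, G.2 hx⟩, hx⟩⟩
  have hg : IsEmbedding fun K : NonemptyCompacts N => (Subtype.val '' (K : Set N) : Set X) :=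
    IsEmbedding.subtypeVal.image_vietoris.comp NonemptyCompacts.isEmbedding_coe
  have hcomp : (fun K : NonemptyCompacts N => (Subtype.val '' (K : Set N) : Set X)) ∘ φ =
      fun G => G.1.1 := by
    funext G
    exact (Subtype.image_preimage_coe _ _).trans (inter_eq_right.2 G.2)
  have hφ : IsEmbedding φ := by
    rw [← hg.of_comp_iff, hcomp]
    exact (isEmbedding_vietFn_val n).comp IsEmbedding.subtypeVal
  refine IsClosedEmbedding.IsCompletelyMetrizableSpace (f := φ) ⟨hφ, ?_⟩
  convert isClosed_nonemptyCompacts_encard_le (X := N) n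
  ext K
  have hcard : (Subtype.val '' (K : Set N) : Set X).encard = (K : Set N).encard :=
    Subtype.val_injective.encard_image _
  constructor
  · rintro ⟨G, rfl⟩
    have hG : (Subtype.val '' (φ G : Set N) : Set X) = G.1.1 := congrFun hcomp G
    rw [mem_ofPred_eq, ← hcard, hG, ← G.1.2.2.1.cast_ncard_eq]
    exact_mod_cast G.1.2.2.2
  · intro hK
    rw [mem_ofPred_eq, ← hcard] at hK
    have hfin := finite_of_encard_le_coe hK
    rw [← hfin.cast_ncard_eq] at hK
    refine ⟨⟨⟨Subtype.val '' (K : Set N), K.nonempty.image _, hfin, by exact_mod_cast hK⟩,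
      Subtype.coe_image_subset _ _⟩, ?_⟩
    exact NonemptyCompacts.ext (preimage_image_eq _ Subtype.val_injective)

/-- A union of completely metrizable pieces, cut out by pairwise disjoint clopen sets, is
completely metrizable. -/
theorem isCompletelyMetrizableSpace_iUnion_inter {X ι : Type*} [TopologicalSpace X]
    (N W : ι → Set X) (hW : ∀ i, IsClopen (W i)) (hdisj : Pairwise fun i j => Disjoint (W i) (W j))
    (hN : ∀ i, IsCompletelyMetrizableSpace (N i)) :
    IsCompletelyMetrizableSpace (⋃ i, N i ∩ W i : Set X) := by
  have hpiece (i : ι) : IsCompletelyMetrizableSpace (N i ∩ W i : Set X) := by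
    have hemb : IsEmbedding (inclusion (inter_subset_left : N i ∩ W i ⊆ N i)) :=
      .inclusion _
    refine IsClosedEmbedding.IsCompletelyMetrizableSpace ⟨hemb, ?_⟩
    convert (hW i).isClosed.preimage (continuous_subtype_val (p := (· ∈ N i)))
    ext x
    simp [range_inclusion]
  let f : (Σ i, (N i ∩ W i : Set X)) → (⋃ i, N i ∩ W i : Set X) := fun p =>
    ⟨p.2, mem_iUnion.2 ⟨p.1, p.2.2⟩⟩
  have hf : IsHomeomorph f := by
    refine ⟨?_, ?_, ?_, ?_⟩
    · exact continuous_sigma fun i => continuous_subtype_val.subtype_mk _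
    · refine isOpenMap_sigma.2 fun i => ?_
      have hemb : IsEmbedding (inclusion (subset_iUnion (fun i => N i ∩ W i) i)) := .inclusion _
      refine (IsOpenEmbedding.mk hemb ?_).isOpenMap
      convert (hW i).isOpen.preimage (continuous_subtype_val (p := (· ∈ ⋃ i, N i ∩ W i)))
      ext ⟨x, hx⟩
      simp only [range_inclusion, mem_ofPred_eq, mem_preimage]
      refine ⟨fun h => h.2, fun hxi => ?_⟩
      obtain ⟨j, hj⟩ := mem_iUnion.1 hx
      rcases eq_or_ne i j with rfl | hij
      · exact hj
      · exact (disjoint_left.1 (hdisj hij) hxi hj.2).elim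
    · rintro ⟨i, x, hx⟩ ⟨j, y, hy⟩ hxy
      obtain rfl : x = y := congrArg Subtype.val hxy
      obtain rfl : i = j := by
        by_contra hij
        exact disjoint_left.1 (hdisj hij) hx.2 hy.2
      rfl
    · rintro ⟨x, hx⟩
      obtain ⟨i, hi⟩ := mem_iUnion.1 hx
      exact ⟨⟨i, x, hi⟩, rfl⟩
  exact (hf.homeomorph f).symm.isClosedEmbedding.IsCompletelyMetrizableSpace

theorem IsZeroDimTop.exists_isCompletelyMetrizableSpace_iUnion_inter {X : Type*}
    [τ : TopologicalSpace X] [T2Space X] (h : IsZeroDimTop τ) {F : Set X} (hF : F.Finite)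
    (N : X → Set X) (hN : ∀ x, IsCompletelyMetrizableSpace (N x)) :
    ∃ W : X → Set X, (∀ x, IsOpen (W x) ∧ x ∈ W x) ∧
      IsCompletelyMetrizableSpace (⋃ x : F, N x ∩ W x : Set X) := by
  obtain ⟨U, hU, hdisj⟩ := hF.t2_separation
  choose W hWo hWc hxW hWU using fun x => h (U x) (hU x).2 x (hU x).1
  exact ⟨W, fun x => ⟨hWo x, hxW x⟩,
    isCompletelyMetrizableSpace_iUnion_inter (fun x : F => N x) (fun x => W x)
      (fun x => ⟨hWc x, hWo x⟩)
      (fun x y hxy => (hdisj x.2 y.2 (Subtype.coe_injective.ne hxy)).mono (hWU x) (hWU y))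
      (fun x => hN x)⟩

theorem setOf_subset_mem_nhds_vietFn {n : ℕ} {X : Type*} [τ : TopologicalSpace X] {M : Set X}
    {F : FnSub n X} (hF : ∀ x ∈ F.1, M ∈ 𝓝 x) :
    {G : FnSub n X | G.1 ⊆ M} ∈ @nhds (FnSub n X) (VietFn n τ) F := by
  let := VietFn n τ
  let := TopologicalSpace.vietoris X
  have hopen : IsOpen {G : FnSub n X | G.1 ⊆ interior M} :=
    isOpen_interior.powerset_vietoris.preimage (isEmbedding_vietFn_val n).continuous
  exact Filter.mem_of_superset
    (hopen.mem_nhds fun x hx => mem_interior_iff_mem_nhds.2 (hF x hx))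
    fun G hG => hG.trans interior_subset

/-- Property `C₂` passes to symmetric products: if `τ₁ ⊆ τ₂` are separable metrizable
topologies, `τ₁` is zero-dimensional, and every point has a `τ₂`-neighborhood that is
completely metrizable in the `τ₁`-subspace topology, then on `F_n(X)` (for `n ≥ 1`) the
Vietoris topology of `τ₁` is coarser than that of `τ₂`, is zero-dimensional, and every
element has a `V(τ₂)`-neighborhood that is completely metrizable in the `V(τ₁)`-subspace
topology. -/
theorem property_C2_hypFn {X : Type*} (τ₁ τ₂ : TopologicalSpace X)
    (hle : ∀ U : Set X, IsOpen[τ₁] U → IsOpen[τ₂] U)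
    (hm₁ : @TopologicalSpace.MetrizableSpace X τ₁) (hs₁ : @TopologicalSpace.SeparableSpace X τ₁)
    (hm₂ : @TopologicalSpace.MetrizableSpace X τ₂) (hs₂ : @TopologicalSpace.SeparableSpace X τ₂)
    (hzd : IsZeroDimTop τ₁)
    (hcomp : ∀ x : X, ∃ N : Set X, N ∈ @nhds X τ₂ x ∧
      IsCompletelyMetrizableTop (TopologicalSpace.induced ((↑) : N → X) τ₁))
    (n : ℕ) (hn : 1 ≤ n) :
    (∀ S : Set (FnSub n X), IsOpen[VietFn n τ₁] S → IsOpen[VietFn n τ₂] S) ∧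
    IsZeroDimTop (VietFn n τ₁) ∧
    (∀ F : FnSub n X, ∃ N : Set (FnSub n X),
      N ∈ @nhds (FnSub n X) (VietFn n τ₂) F ∧
      IsCompletelyMetrizableTop
        (TopologicalSpace.induced ((↑) : N → FnSub n X) (VietFn n τ₁))) := by
  have hle' : τ₂ ≤ τ₁ := hle
  refine ⟨vietFn_mono n hle', hzd.vietFn n, fun F => ?_⟩
  choose N hN hNc using hcomp
  have hT2 : @T2Space X τ₁ := @t2Space_of_metrizableSpace X τ₁ hm₁
  obtain ⟨W, hW, hM⟩ := @IsZeroDimTop.exists_isCompletelyMetrizableSpace_iUnion_inter X τ₁ hT2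
    hzd F.1 F.2.2.1 N fun x => (isCompletelyMetrizableTop_iff _).1 (hNc x)
  refine ⟨{G | G.1 ⊆ ⋃ x : F.1, N x ∩ W x}, ?_, (isCompletelyMetrizableTop_iff _).2
    (@isCompletelyMetrizableSpace_vietFn_subset n X τ₁ _ hM)⟩
  exact setOf_subset_mem_nhds_vietFn fun x hx => Filter.mem_of_superset
    (Filter.inter_mem (hN x) ((hle _ (hW x).1).mem_nhds (hW x).2))
    (subset_iUnion (fun x : F.1 => N x ∩ W x) ⟨x, hx⟩)
end
end
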